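/- arXiv:1406.3283 — 3 statements merged into one kernel-verified Lean document; each statement's English description precedes it below -/
import Mathlib

section
/- Let g be a nonconstant complex-valued step function on T all of whose jump discontinuities occur at rational multiples of π. Then for almost every t ∈ ℝ, the graphs of (the continuous representatives of) |e^{it∂ₓₓ}g|² and |e^{it∂ₓₓ}g| each have upper Minkowski dimension exactly 3/2. -/
open MeasureTheory Finset Filter

/-- The `n`-th Fourier coefficient `ĝ(n) = (1/2π) ∫₀^{2π} e^{-inx} g(x) dx` of a
`2π`-periodic function `g : ℝ → ℂ`. -/
noncomputable def fourierCoef (g : ℝ → ℂ) (n : ℤ) : ℂ :=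
  (1 / (2 * Real.pi)) * ∫ x in (0 : ℝ)..(2 * Real.pi),
    Complex.exp (-Complex.I * (n : ℂ) * (x : ℂ)) * g x

/-- The minimal number of `ε`-balls needed to cover `E ⊆ ℝ²`. -/
noncomputable def coveringNumber (E : Set (ℝ × ℝ)) (ε : ℝ) : ℕ :=
  sInf {n : ℕ | ∃ S : Finset (ℝ × ℝ), S.card = n ∧ E ⊆ ⋃ c ∈ S, Metric.ball c ε}

/-- The upper Minkowski (box-counting) dimension of a set `E ⊆ ℝ²`:
`limsup_{ε→0⁺} log N(E,ε) / log (1/ε)`. -/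
noncomputable def upperMinkowskiDim (E : Set (ℝ × ℝ)) : ℝ :=
  Filter.limsup (fun ε : ℝ => Real.log (coveringNumber E ε) / Real.log (1 / ε))
    (nhdsWithin 0 (Set.Ioi 0))

/-- The graph `{(x, h x) : x ∈ [0, 2π)} ⊆ ℝ²` of a function on one period. -/
def graphOn (h : ℝ → ℝ) : Set (ℝ × ℝ) :=
  {p : ℝ × ℝ | ∃ x ∈ Set.Ico (0 : ℝ) (2 * Real.pi), p = (x, h x)}


theorem cover_lower (f : ℝ → ℝ) (hf : Continuous f) (hp : Function.Periodic f (2 * Real.pi))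
    (h : ℝ) (hh : 0 < h) (hh1 : h < 1) (S : Finset (ℝ × ℝ))
    (hS : graphOn f ⊆ ⋃ c ∈ S, Metric.ball c h) :
    ∫ x in (0:ℝ)..(2 * Real.pi), |f (x + h) - f x| ≤ 16 * h ^ 2 * S.card := by
  have hpi := Real.pi_gt_three
  -- pointwise bound
  let J : ℝ → Set ℝ := fun c => Set.Ioo (c - 2 * h) (c + 2 * h)
  let w : ℝ → ℝ := fun x => ∑ c ∈ S, ((J c.1).indicator (fun _ => 2 * h) x +
      (J (c.1 + 2 * Real.pi)).indicator (fun _ => 2 * h) x)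
  have key : ∀ x ∈ Set.Ico (0:ℝ) (2 * Real.pi), |f (x + h) - f x| ≤ w x := by
    intro x hx
    classical
    let S1 := S.filter (fun c => x ∈ J c.1)
    let S2 := S.filter (fun c => x ∈ J (c.1 + 2 * Real.pi))
    have hsub : Set.uIcc (f x) (f (x + h)) ⊆
        (⋃ c ∈ S1, Metric.ball c.2 h) ∪ (⋃ c ∈ S2, Metric.ball c.2 h) := by
      refine (intermediate_value_uIcc hf.continuousOn).trans ?_
      rintro _ ⟨y, hy, rfl⟩
      rw [Set.uIcc_of_le (by linarith)] at hy
      by_cases hy2 : y < 2 * Real.pi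
      · left
        have : ((y, f y) : ℝ × ℝ) ∈ graphOn f := ⟨y, ⟨by linarith [hx.1, hy.1], hy2⟩, rfl⟩
        have := hS this
        simp only [Set.mem_iUnion] at this ⊢
        obtain ⟨c, hc, hb⟩ := this
        rw [Metric.mem_ball, Prod.dist_eq, max_lt_iff, Real.dist_eq, abs_lt] at hb
        refine ⟨c, ?_, hb.2⟩
        simp only [S1, Finset.mem_filter, J, Set.mem_Ioo]
        refine ⟨hc, ?_, ?_⟩ <;> linarith [hb.1.1, hb.1.2, hy.1, hy.2]
      · right
        have : ((y - 2 * Real.pi, f y) : ℝ × ℝ) ∈ graphOn f :=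
          ⟨y - 2 * Real.pi, ⟨by linarith [hx.1, hy.1], by linarith [hy.2, hx.2]⟩, by
            rw [hp.sub_eq]⟩
        have := hS this
        simp only [Set.mem_iUnion] at this ⊢
        obtain ⟨c, hc, hb⟩ := this
        rw [Metric.mem_ball, Prod.dist_eq, max_lt_iff, Real.dist_eq, abs_lt] at hb
        refine ⟨c, ?_, hb.2⟩
        simp only [S2, Finset.mem_filter, J, Set.mem_Ioo]
        simp only at hb
        refine ⟨hc, ?_, ?_⟩ <;> linarith [hb.1.1, hb.1.2, hy.1, hy.2]
    have hvol := measure_mono (μ := volume) hsub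
    rw [Real.volume_interval] at hvol
    have h1 : ∀ S' : Finset (ℝ × ℝ), volume (⋃ c ∈ S', Metric.ball c.2 h) ≤
        ENNReal.ofReal (S'.card * (2 * h)) := by
      intro S'
      refine (measure_biUnion_finset_le _ _).trans ?_
      simp only [Real.volume_ball, Finset.sum_const, nsmul_eq_mul]
      rw [ENNReal.ofReal_mul (p := (S'.card : ℝ)) (by positivity), ENNReal.ofReal_natCast]
    have h2 := hvol.trans ((measure_union_le _ _).trans (add_le_add (h1 S1) (h1 S2)))
    rw [← ENNReal.ofReal_add (by positivity) (by positivity),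
      ENNReal.ofReal_le_ofReal_iff (by positivity)] at h2
    refine h2.trans (le_of_eq ?_)
    simp only [w, Finset.sum_add_distrib, Set.indicator_apply]
    rw [← Finset.sum_filter, ← Finset.sum_filter]
    simp [S1, S2]
  have hind : ∀ c : ℝ, IntervalIntegrable ((J c).indicator (fun _ => 2 * h)) volume 0 (2 * Real.pi) := by
    intro c
    constructor
    · exact (integrable_const (2 * h)).indicator measurableSet_Ioo
    · exact (integrable_const (2 * h)).indicator measurableSet_Ioo
  have hb : ∀ c : ℝ, ∫ x in (0:ℝ)..(2 * Real.pi), (J c).indicator (fun _ => 2 * h) x ≤ 8 * h ^ 2 := by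
    intro c
    rw [intervalIntegral.integral_of_le (by positivity), integral_indicator measurableSet_Ioo,
      setIntegral_const, smul_eq_mul]
    have : (volume.restrict (Set.Ioc 0 (2 * Real.pi))).real (J c) ≤ 4 * h := by
      rw [measureReal_restrict_apply measurableSet_Ioo]
      refine (measureReal_mono (Set.inter_subset_left) (by simp [J])).trans ?_
      rw [Real.volume_real_Ioo_of_le (by linarith)]
      linarith
    nlinarith
  calc ∫ x in (0:ℝ)..(2 * Real.pi), |f (x + h) - f x|
      ≤ ∫ x in (0:ℝ)..(2 * Real.pi), w x := by
        refine intervalIntegral.integral_mono_on_of_le_Ioo (by positivity) ?_ ?_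
          (fun x hx => key x ⟨hx.1.le, hx.2⟩)
        · exact Continuous.intervalIntegrable (by fun_prop) _ _
        · have := IntervalIntegrable.sum S (f := fun (c : ℝ × ℝ) (x : ℝ) => ((J c.1).indicator (fun _ => 2 * h) x +
            (J (c.1 + 2 * Real.pi)).indicator (fun _ => 2 * h) x)) (fun c _ => (hind c.1).add (hind _))
          refine this.congr (fun x _ => ?_)
          simp [w]
    _ = ∑ c ∈ S, ((∫ x in (0:ℝ)..(2 * Real.pi), (J c.1).indicator (fun _ => 2 * h) x) +
      ∫ x in (0:ℝ)..(2 * Real.pi), (J (c.1 + 2 * Real.pi)).indicator (fun _ => 2 * h) x) := by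
        simp only [w]
        rw [intervalIntegral.integral_finsetSum (fun c _ => (hind c.1).add (hind _))]
        refine Finset.sum_congr rfl fun c _ => ?_
        rw [intervalIntegral.integral_add (hind _) (hind _)]
    _ ≤ ∑ c ∈ S, 16 * h ^ 2 := by
        refine Finset.sum_le_sum fun c _ => ?_
        linarith [hb c.1, hb (c.1 + 2 * Real.pi)]
    _ = 16 * h ^ 2 * S.card := by simp; ring

theorem cover_upper (f : ℝ → ℝ) (θ C : ℝ) (hθ : 0 < θ) (hθ1 : θ < 1) (hC : 0 < C)
    (hf : ∀ x y, |f x - f y| ≤ C * |x - y| ^ θ) (h : ℝ) (hh : 0 < h) (hh1 : h < 1) :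
    ∃ S : Finset (ℝ × ℝ), (graphOn f ⊆ ⋃ c ∈ S, Metric.ball c h) ∧
      (S.card : ℝ) ≤ 8 * (2 * C + 3) * h ^ (θ - 2) := by
  have hpi := Real.pi_gt_three
  have hpi4 := Real.pi_lt_d2
  classical
  let K : ℕ := ⌈C * h ^ (θ - 1)⌉₊
  let A : Finset ℕ := Finset.range (⌊2 * Real.pi / h⌋₊ + 1)
  let B : Finset ℤ := Finset.Icc (-(K:ℤ)) K
  refine ⟨(A ×ˢ B).image (fun p => ((p.1 : ℝ) * h, f ((p.1 : ℝ) * h) + (p.2 : ℝ) * h)), ?_, ?_⟩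
  · rintro _ ⟨x, hx, rfl⟩
    simp only [Set.mem_iUnion]
    have hx0 : 0 ≤ x / h := div_nonneg hx.1 hh.le
    set i : ℕ := ⌊x / h⌋₊ with hi
    have hi1 : (i:ℝ) * h ≤ x := by
      have := Nat.floor_le hx0
      rwa [le_div_iff₀ hh] at this
    have hi2 : x < (i:ℝ) * h + h := by
      have := Nat.lt_floor_add_one (x / h)
      rw [div_lt_iff₀ hh] at this
      linarith
    set j : ℤ := ⌊(f x - f (i * h)) / h⌋ with hj
    have hj1 : (j:ℝ) * h ≤ f x - f (i * h) := by
      have := Int.floor_le ((f x - f (i * h)) / h)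
      rwa [le_div_iff₀ hh] at this
    have hj2 : f x - f (i * h) < (j:ℝ) * h + h := by
      have := Int.lt_floor_add_one ((f x - f (i * h)) / h)
      rw [div_lt_iff₀ hh] at this
      linarith
    have hb : |f x - f (i * h)| ≤ C * h ^ θ := by
      refine (hf _ _).trans ?_
      gcongr
      rw [abs_of_nonneg (by linarith)]; linarith
    have hK : C * h ^ θ ≤ K * h := by
      have := Nat.le_ceil (C * h ^ (θ - 1))
      have h2 : h ^ θ = h ^ (θ - 1) * h := by
        rw [Real.rpow_sub_one hh.ne']; field_simp
      rw [h2, ← mul_assoc]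
      exact mul_le_mul_of_nonneg_right this hh.le
    rw [abs_le] at hb
    refine ⟨((i : ℝ) * h, f ((i : ℝ) * h) + (j : ℝ) * h), ?_, ?_⟩
    · rw [Finset.mem_image]
      refine ⟨(i, j), ?_, rfl⟩
      simp only [A, B, Finset.mem_product, Finset.mem_range, Finset.mem_Icc]
      refine ⟨?_, ?_, ?_⟩
      · have : i ≤ ⌊2 * Real.pi / h⌋₊ := Nat.floor_le_floor (by gcongr; exact hx.2.le)
        omega
      · rw [hj, Int.le_floor, le_div_iff₀ hh]
        push_cast
        linarith
      · have : (j:ℝ) ≤ K := by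
          by_contra hcon
          push Not at hcon
          nlinarith
        exact_mod_cast this
    · rw [Metric.mem_ball, Prod.dist_eq, max_lt_iff, Real.dist_eq, Real.dist_eq, abs_lt, abs_lt]
      simp only
      refine ⟨⟨?_, ?_⟩, ?_, ?_⟩ <;> linarith
  · have h1 : (((A ×ˢ B).image (fun p : ℕ × ℤ => ((p.1 : ℝ) * h, f ((p.1 : ℝ) * h) + (p.2 : ℝ) * h))).card : ℝ)
        ≤ ((⌊2 * Real.pi / h⌋₊ + 1 : ℕ) : ℝ) * ((2 * K + 1 : ℕ) : ℝ) := by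
      rw [← Nat.cast_mul]
      refine Nat.cast_le.mpr (Finset.card_image_le.trans (le_of_eq ?_))
      rw [Finset.card_product]
      simp only [A, B, Finset.card_range, Int.card_Icc]
      congr 1
      omega
    have h2 : ((⌊2 * Real.pi / h⌋₊ + 1 : ℕ) : ℝ) ≤ 8 * h⁻¹ := by
      push_cast
      have := Nat.floor_le (show 0 ≤ 2 * Real.pi / h by positivity)
      have h3 : 1 ≤ h⁻¹ := (one_le_inv₀ hh).2 hh1.le
      rw [div_eq_mul_inv] at this ⊢
      nlinarith
    have hone : 1 ≤ h ^ (θ - 1) := Real.one_le_rpow_of_pos_of_le_one_of_nonpos hh hh1.le (by linarith)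
    have h3 : ((2 * K + 1 : ℕ) : ℝ) ≤ (2 * C + 3) * h ^ (θ - 1) := by
      push_cast
      have := Nat.ceil_lt_add_one (show 0 ≤ C * h ^ (θ - 1) by positivity)
      have h4 : (K : ℝ) < C * h ^ (θ - 1) + 1 := this
      nlinarith
    refine h1.trans ((mul_le_mul h2 h3 (by positivity) (by positivity)).trans (le_of_eq ?_))
    have h5 : h ^ (θ - 2) = h⁻¹ * h ^ (θ - 1) := by
      rw [← Real.rpow_neg_one, ← Real.rpow_add hh]; ring_nf
    rw [h5]; ring

/-- log comparison -/
theorem log_ratio_bounds (N : ℝ → ℝ) (s : ℝ)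
    (hu : ∀ δ > 0, ∃ A > 0, ∀ᶠ h in nhdsWithin (0:ℝ) (Set.Ioi 0), N h ≤ A * h ^ (-s - δ))
    (hl : ∀ δ > 0, ∃ A > 0, ∀ᶠ h in nhdsWithin (0:ℝ) (Set.Ioi 0), A * h ^ (-s + δ) ≤ N h) :
    Tendsto (fun h => Real.log (N h) / Real.log (1 / h)) (nhdsWithin 0 (Set.Ioi 0)) (nhds s) := by
  have hlog : Tendsto (fun h : ℝ => Real.log (1 / h)) (nhdsWithin 0 (Set.Ioi 0)) atTop := by
    have := tendsto_neg_atBot_atTop.comp Real.tendsto_log_nhdsGT_zero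
    refine this.congr fun x => ?_
    simp
  have hzero : ∀ A : ℝ, ∀ δ > 0, ∀ᶠ h in nhdsWithin (0:ℝ) (Set.Ioi 0),
      |Real.log A| ≤ δ * Real.log (1 / h) := by
    intro A δ hδ
    filter_upwards [hlog.eventually_ge_atTop (|Real.log A| / δ)] with h hh
    rwa [div_le_iff₀' hδ] at hh
  have hpos : ∀ᶠ h in nhdsWithin (0:ℝ) (Set.Ioi 0), 0 < Real.log (1 / h) :=
    hlog.eventually_gt_atTop 0
  have h0 : ∀ᶠ h in nhdsWithin (0:ℝ) (Set.Ioi 0), 0 < h := eventually_mem_nhdsWithin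
  rw [Metric.tendsto_nhds]
  intro ε hε
  obtain ⟨A, hA, hAu⟩ := hu (ε / 4) (by positivity)
  obtain ⟨B, hB, hBl⟩ := hl (ε / 4) (by positivity)
  filter_upwards [hAu, hBl, hzero A (ε/4) (by positivity), hzero B (ε/4) (by positivity), hpos, h0]
    with h h1 h2 h3 h4 h5 h6
  have hN : 0 < N h := lt_of_lt_of_le (by positivity) h2
  have hl1 := Real.log_le_log hN h1
  have hl2 := Real.log_le_log (by positivity) h2
  rw [Real.log_mul hA.ne' (by positivity), Real.log_rpow h6] at hl1
  rw [Real.log_mul hB.ne' (by positivity), Real.log_rpow h6] at hl2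
  have hh : Real.log h = - Real.log (1 / h) := by simp
  rw [hh] at hl1 hl2
  set ll := Real.log (1 / h)
  rw [abs_le] at h3 h4
  rw [Real.dist_eq, abs_lt]
  constructor
  · rw [lt_sub_iff_add_lt, lt_div_iff₀ h5]
    nlinarith
  · rw [sub_lt_iff_lt_add, div_lt_iff₀ h5]
    nlinarith

theorem dim_of_bounds (f : ℝ → ℝ) (hp : Function.Periodic f (2 * Real.pi))
    (hu : ∀ θ : ℝ, 0 < θ → θ < 1 / 2 → ∃ C > 0, ∀ x y, |f x - f y| ≤ C * |x - y| ^ θ)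
    (hl : ∀ δ : ℝ, δ > 0 → ∃ A > 0, ∀ᶠ h in nhdsWithin (0:ℝ) (Set.Ioi 0),
      A * h ^ (1 / 2 + δ) ≤ ∫ x in (0:ℝ)..(2 * Real.pi), |f (x + h) - f x|) :
    upperMinkowskiDim (graphOn f) = 3 / 2 := by
  have hcont : Continuous f := by
    obtain ⟨C, hC, h⟩ := hu (1/4) (by norm_num) (by norm_num)
    rw [continuous_iff_continuousAt]
    intro x
    rw [ContinuousAt, tendsto_iff_norm_sub_tendsto_zero]
    have h1 : Tendsto (fun y => C * |y - x| ^ (1/4:ℝ)) (nhds x) (nhds 0) := by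
      have : Continuous (fun y => C * |y - x| ^ (1/4:ℝ)) := by
        refine continuous_const.mul (Continuous.rpow_const (by fun_prop) (fun _ => Or.inr (by norm_num)))
      have := this.tendsto x
      simpa using this
    exact squeeze_zero (fun _ => norm_nonneg _) (fun y => h y x) h1
  have hsm : ∀ᶠ h in nhdsWithin (0:ℝ) (Set.Ioi 0), 0 < h ∧ h < 1 :=
    Ioo_mem_nhdsGT one_pos
  unfold upperMinkowskiDim
  refine (log_ratio_bounds (fun h => (coveringNumber (graphOn f) h : ℝ)) (3/2) ?_ ?_).limsup_eq
  · intro δ hδ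
    set θ : ℝ := max (1/2 - δ) (1/4) with hθ
    have hθ1 : 1/4 ≤ θ := le_max_right _ _
    have hθ2 : θ < 1/2 := max_lt (by linarith) (by norm_num)
    have hθ3 : 1/2 - δ ≤ θ := le_max_left _ _
    obtain ⟨C, hC, h⟩ := hu θ (by linarith) hθ2
    refine ⟨8 * (2 * C + 3), by positivity, ?_⟩
    filter_upwards [hsm] with ε hε
    obtain ⟨S, hS1, hS2⟩ := cover_upper f θ C (by linarith) (by linarith) hC h ε hε.1 hε.2
    have : coveringNumber (graphOn f) ε ≤ S.card := Nat.sInf_le ⟨S, rfl, hS1⟩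
    refine (Nat.cast_le.mpr this).trans (hS2.trans ?_)
    gcongr ?_ * ?_
    exact Real.rpow_le_rpow_of_exponent_ge hε.1 hε.2.le (by linarith)
  · intro δ hδ
    obtain ⟨A, hA, h⟩ := hl δ hδ
    obtain ⟨C, hC, h'⟩ := hu (1/4) (by norm_num) (by norm_num)
    refine ⟨A / 16, by positivity, ?_⟩
    filter_upwards [hsm, h] with ε hε hA
    obtain ⟨S, hS1, hS2⟩ := cover_upper f (1/4) C (by norm_num) (by norm_num) hC h' ε hε.1 hε.2
    obtain ⟨S', hS'1, hS'2⟩ := Nat.sInf_mem (s := {n : ℕ | ∃ S : Finset (ℝ × ℝ), S.card = n ∧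
      graphOn f ⊆ ⋃ c ∈ S, Metric.ball c ε}) ⟨_, S, rfl, hS1⟩
    have := cover_lower f hcont hp ε hε.1 hε.2 S' hS'2
    change _ ≤ ((sInf _ : ℕ) : ℝ)
    rw [← hS'1]
    have h3 := hA.trans this
    have h4 : ε ^ (1/2 + δ) = ε ^ (-(3/2) + δ) * ε ^ 2 := by
      rw [← Real.rpow_natCast, ← Real.rpow_add hε.1]; norm_num; ring_nf
    rw [h4] at h3
    have h5 : 0 < ε ^ 2 := by have := hε.1; positivity
    nlinarith


theorem rot_aux (X η r : ℝ) (hη : 0 < η) (hr : 3 * η ≤ r) :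
    ∃ i : ℕ, i ≤ ⌈1 / η⌉₊ ∧ ∃ z : ℤ, ∀ e : ℕ, e ≤ 2 →
      (z : ℝ) ≤ X + ((i : ℝ) + e) * η ∧ X + ((i : ℝ) + e) * η < z + r := by
  have h1 := Int.le_ceil X
  have h2 := Int.ceil_lt_add_one X
  refine ⟨⌈((⌈X⌉ : ℝ) - X) / η⌉₊, Nat.ceil_le_ceil (by gcongr; linarith), ⌈X⌉, ?_⟩
  intro e he
  have h3 := Nat.le_ceil (((⌈X⌉ : ℝ) - X) / η)
  have h4 := Nat.ceil_lt_add_one (show 0 ≤ ((⌈X⌉ : ℝ) - X) / η by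
    apply div_nonneg <;> linarith)
  set i := ⌈((⌈X⌉ : ℝ) - X) / η⌉₊
  rw [div_le_iff₀ hη] at h3
  have h5 : (i : ℝ) * η < (⌈X⌉ : ℝ) - X + η := by
    have := mul_lt_mul_of_pos_right h4 hη
    rwa [add_mul, div_mul_cancel₀ _ hη.ne', one_mul] at this
  have he' : (e : ℝ) ≤ 2 := by exact_mod_cast he
  have he0 : (0:ℝ) ≤ e := by positivity
  constructor <;> nlinarith

theorem three_aux (α : ℝ) (hα : Irrational α) (M : ℕ) (hM : 0 < M) :
    ∃ c : ℝ, 0 < c ∧ ∀ k : ℝ, ∃ e : ℕ, e ≤ 2 ∧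
      c ≤ ‖Complex.exp (2 * Real.pi * α * (k + e * M) ^ 2 * Complex.I) - 1‖ := by
  set ω := Complex.exp (2 * Real.pi * (2 * α * M ^ 2) * Complex.I) with hω
  have hω1 : ω ≠ 1 := by
    intro h
    rw [hω, Complex.exp_eq_one_iff] at h
    obtain ⟨n, hn⟩ := h
    have h2 : (2 * α * M ^ 2 : ℂ) = n := by
      have : (2 * Real.pi * Complex.I : ℂ) ≠ 0 := Complex.two_pi_I_ne_zero
      apply mul_left_cancel₀ this
      linear_combination hn
    have h3 : 2 * α * (M:ℝ) ^ 2 = n := by exact_mod_cast h2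
    apply hα
    refine ⟨(n : ℚ) / (2 * M ^ 2), ?_⟩
    push_cast
    rw [← h3]
    field_simp
  refine ⟨‖ω - 1‖ / 4, by have := norm_pos_iff.mpr (sub_ne_zero.mpr hω1); positivity, ?_⟩
  intro k
  by_contra hcon
  push Not at hcon
  have h0 := hcon 0 (by norm_num)
  have h1 := hcon 1 (by norm_num)
  have h2 := hcon 2 (by norm_num)
  set E : ℕ → ℂ := fun e => Complex.exp (2 * Real.pi * α * (k + e * M) ^ 2 * Complex.I) with hE
  change ‖E 0 - 1‖ < _ at h0
  change ‖E 1 - 1‖ < _ at h1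
  change ‖E 2 - 1‖ < _ at h2
  have hn : ∀ e, ‖E e‖ = 1 := by
    intro e
    have := Complex.norm_exp_ofReal_mul_I (2 * Real.pi * α * (k + e * M) ^ 2)
    rw [← this, hE]
    push_cast
    rfl
  have hid : E 0 * E 2 = ω * (E 1 * E 1) := by
    simp only [hE, hω, ← Complex.exp_add]
    congr 1
    push_cast
    ring
  have h3 : ‖ω - 1‖ = ‖E 0 * E 2 - E 1 * E 1‖ := by
    rw [hid, show ω * (E 1 * E 1) - E 1 * E 1 = (ω - 1) * (E 1 * E 1) by ring, norm_mul, norm_mul, hn]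
    simp
  have h4 : E 0 * E 2 - E 1 * E 1 = E 0 * (E 2 - 1) + (E 0 - 1) - E 1 * (E 1 - 1) - (E 1 - 1) := by ring
  have h5 : ‖E 0 * E 2 - E 1 * E 1‖ ≤ ‖E 2 - 1‖ + ‖E 0 - 1‖ + ‖E 1 - 1‖ + ‖E 1 - 1‖ := by
    rw [h4]
    refine (norm_sub_le _ _).trans (add_le_add ((norm_sub_le _ _).trans (add_le_add
      ((norm_add_le _ _).trans (add_le_add ?_ le_rfl)) ?_)) le_rfl)
    · rw [norm_mul, hn, one_mul]
    · rw [norm_mul, hn, one_mul]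
  linarith

theorem good_k (α : ℝ) (hα : Irrational α) (q : ℕ) (hq : 0 < q) :
    ∃ P : ℕ, 0 < P ∧ ∃ c : ℝ, 0 < c ∧ ∀ i : ℕ, ∃ k : ℕ, P * i ≤ k ∧ k < P * (i + 1) ∧ q ∣ k ∧
      (∃ z : ℤ, (z : ℝ) ≤ α * k ∧ α * k < z + 1 / q) ∧
      c ≤ ‖Complex.exp (2 * Real.pi * α * (k : ℂ) ^ 2 * Complex.I) - 1‖ := by
  obtain ⟨m, hm0, -, hm⟩ := Real.exists_nat_abs_mul_sub_round_le (α * q) (show 0 < 3 * q by omega)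
  set p : ℤ := round (m * (α * q)) with hp
  set η : ℝ := |m * (α * q) - p| with hη
  have hη0 : 0 < η := by
    rw [hη, abs_pos]
    intro h
    apply hα
    refine ⟨(p : ℚ) / (m * q), ?_⟩
    push_cast
    field_simp
    linarith
  have hη1 : 3 * η ≤ 1 / q := by
    have hq' : (0:ℝ) < q := by exact_mod_cast hq
    rw [le_div_iff₀ hq']
    push_cast at hm
    rw [le_div_iff₀ (by positivity)] at hm
    nlinarith
  obtain ⟨c, hc, h3⟩ := three_aux α hα (q * m) (by positivity)
  set M := ⌈1 / η⌉₊ + 2 with hM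
  refine ⟨q * m * (M + 1), by positivity, c, hc, ?_⟩
  intro i
  set k0 := q * m * (M + 1) * i with hk0
  rcases le_or_gt 0 ((m:ℝ) * (α * q) - p) with hs | hs
  · rw [abs_of_nonneg hs] at hη
    obtain ⟨j, hj, z, hz⟩ := rot_aux (α * k0) η (1 / q) hη0 hη1
    obtain ⟨e, he, hc'⟩ := h3 (k0 + q * m * j)
    refine ⟨k0 + q * m * (j + e), by omega, ?_, ?_, ?_, ?_⟩
    · have : q * m * (j + e) < q * m * (M + 1) := by
        apply Nat.mul_lt_mul_of_pos_left (by omega) (by positivity)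
      rw [mul_add _ i 1, mul_one]; omega
    · exact (Dvd.dvd.mul_right (Dvd.dvd.mul_right (Dvd.intro _ rfl) _) _).add (Dvd.dvd.mul_right (Dvd.intro _ rfl) _)
    · refine ⟨z + (j + e) * p, ?_⟩
      have := hz e he
      have h4 : α * ((k0 + q * m * (j + e) : ℕ) : ℝ) = α * k0 + ((j:ℝ) + e) * η + (j + e) * p := by
        rw [hη]; push_cast; ring
      rw [h4]
      push_cast
      constructor <;> linarith [this.1, this.2]
    · convert hc' using 6
      push_cast; ring
  · rw [abs_of_neg hs] at hη
    obtain ⟨j, hj, z, hz⟩ := rot_aux (α * k0 - M * η) η (1 / q) hη0 hη1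
    obtain ⟨e', he', hc'⟩ := h3 (k0 + q * m * (M - j - 2))
    obtain ⟨e, he, hee⟩ : ∃ e : ℕ, e ≤ 2 ∧ e + e' = 2 := ⟨2 - e', by omega, by omega⟩
    obtain ⟨s, hs'⟩ : ∃ s, s + (j + e) = M := ⟨M - (j + e), by omega⟩
    have hsR : (s : ℝ) + (j + e) = M := by exact_mod_cast hs'
    have heR : (e:ℂ) + e' = 2 := by exact_mod_cast hee
    have hsC : (s : ℂ) + (j + e) = M := by exact_mod_cast hs'
    refine ⟨k0 + q * m * s, by omega, ?_, ?_, ?_, ?_⟩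
    · have : q * m * s < q * m * (M + 1) := by
        apply Nat.mul_lt_mul_of_pos_left (by omega) (by positivity)
      rw [mul_add _ i 1, mul_one]; omega
    · exact (Dvd.dvd.mul_right (Dvd.dvd.mul_right (Dvd.intro _ rfl) _) _).add (Dvd.dvd.mul_right (Dvd.intro _ rfl) _)
    · refine ⟨z + s * p, ?_⟩
      have := hz e he
      have h4 : α * ((k0 + q * m * s : ℕ) : ℝ) = α * k0 - M * η + ((j:ℝ) + e) * η + s * p := by
        rw [← hsR, hη]; push_cast; ring
      rw [h4]
      push_cast
      constructor <;> linarith [this.1, this.2]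
    · convert hc' using 7
      push_cast
      linear_combination (q * m : ℂ) * hsC - (q * m : ℂ) * heR


theorem coef_eq (F : ℝ → ℂ) (n : ℤ) :
    fourierCoef F n = fourierCoeffOn Real.two_pi_pos F n := by
  rw [fourierCoeffOn_eq_integral, fourierCoef, Complex.real_smul]
  congr 1
  · push_cast; ring
  · refine intervalIntegral.integral_congr fun x _ => ?_
    simp only [smul_eq_mul]
    rw [fourier_coe_apply]
    congr 2
    have := Complex.ofReal_ne_zero.mpr Real.pi_ne_zero
    push_cast
    field_simp
    ring

theorem parseval_sq (F : ℝ → ℂ) (hF : MemLp F 2 (volume.restrict (Set.Ioc 0 (2 * Real.pi)))) :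
    HasSum (fun n => ‖fourierCoef F n‖ ^ 2)
      ((2 * Real.pi)⁻¹ * ∫ x in (0:ℝ)..(2 * Real.pi), ‖F x‖ ^ 2) := by
  have := hasSum_sq_fourierCoeffOn Real.two_pi_pos hF
  simpa [coef_eq] using this

theorem parseval (F G : ℝ → ℂ) (hF : MemLp F 2 (volume.restrict (Set.Ioc 0 (2 * Real.pi))))
    (hG : MemLp G 2 (volume.restrict (Set.Ioc 0 (2 * Real.pi)))) :
    HasSum (fun n => (starRingEnd ℂ) (fourierCoef F n) * fourierCoef G n)
      ((1 / (2 * Real.pi)) * ∫ x in (0:ℝ)..(2 * Real.pi), (starRingEnd ℂ) (F x) * G x) := by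
  have hT := Fact.mk (Real.two_pi_pos)
  have e : Set.Ioc 0 (2 * Real.pi) = Set.Ioc 0 (0 + 2 * Real.pi) := by rw [zero_add]
  rw [e] at hF hG
  have hf := hF.memLp_liftIoc.haarAddCircle
  have hg := hG.memLp_liftIoc.haarAddCircle
  have h := fourierBasis.hasSum_inner_mul_inner hf.toLp hg.toLp
  convert! h using 1
  · ext n
    rw [← inner_conj_symm, ← HilbertBasis.repr_apply_apply, ← HilbertBasis.repr_apply_apply,
      fourierBasis_repr, fourierBasis_repr, fourierCoeff_congr_ae hf.coeFn_toLp,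
      fourierCoeff_congr_ae hg.coeFn_toLp, fourierCoeff_liftIoc_eq, fourierCoeff_liftIoc_eq,
      coef_eq, coef_eq]
    simp only [zero_add]
  · rw [MeasureTheory.L2.inner_def]
    have h1 : ∫ a, inner ℂ (hf.toLp _ a) (hg.toLp _ a) ∂AddCircle.haarAddCircle =
      ∫ a, AddCircle.liftIoc (2 * Real.pi) 0 (fun x => (starRingEnd ℂ) (F x) * G x) a ∂AddCircle.haarAddCircle := by
      apply integral_congr_ae
      filter_upwards [hf.coeFn_toLp, hg.coeFn_toLp] with x h1 h2
      rw [h1, h2]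
      simp only [RCLike.inner_apply']
      rfl
    rw [h1, AddCircle.integral_haarAddCircle, AddCircle.integral_liftIoc_eq_intervalIntegral, zero_add,
      Complex.real_smul]
    congr 1
    push_cast; ring


theorem ii_of_bdd (f : ℝ → ℂ) (hf : Measurable f) (B : ℝ) (hB : ∀ x, ‖f x‖ ≤ B) (a b : ℝ) :
    IntervalIntegrable f volume a b := by
  have : IntervalIntegrable (fun _ : ℝ => B) volume a b := intervalIntegrable_const
  exact this.mono_fun hf.aestronglyMeasurable (ae_of_all _ fun x => (hB x).trans (le_abs_self B))

theorem memLp_of_bdd (f : ℝ → ℂ) (hf : Measurable f) (B : ℝ) (hB : ∀ x, ‖f x‖ ≤ B) :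
    MemLp f 2 (volume.restrict (Set.Ioc 0 (2 * Real.pi))) :=
  MemLp.of_bound hf.aestronglyMeasurable B (ae_of_all _ hB)

theorem coef_shift (F : ℝ → ℂ) (hF : Function.Periodic F (2 * Real.pi)) (r : ℝ) (n : ℤ) :
    fourierCoef (fun x => F (x + r)) n = Complex.exp (Complex.I * n * r) * fourierCoef F n := by
  unfold fourierCoef
  have hper : Function.Periodic (fun x : ℝ => Complex.exp (-Complex.I * n * x) * F x) (2 * Real.pi) := by
    intro x
    simp only
    rw [hF x]
    congr 1
    rw [Complex.exp_eq_exp_iff_exists_int]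
    refine ⟨-n, ?_⟩
    push_cast; ring
  have h1 : ∀ x : ℝ, Complex.exp (-Complex.I * n * x) * F (x + r) = Complex.exp (Complex.I * n * r) *
      (Complex.exp (-Complex.I * n * (x + r : ℝ)) * F (x + r)) := by
    intro x
    rw [← mul_assoc, ← Complex.exp_add]
    congr 2
    push_cast; ring
  simp_rw [h1]
  rw [intervalIntegral.integral_const_mul,
    intervalIntegral.integral_comp_add_right (fun x : ℝ => Complex.exp (-Complex.I * n * x) * F x),
    add_comm (2 * Real.pi), zero_add, hper.intervalIntegral_add_eq r 0, zero_add]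
  ring

theorem coef_mod (F : ℝ → ℂ) (k n : ℤ) :
    fourierCoef (fun x => Complex.exp (-Complex.I * k * x) * F x) n = fourierCoef F (n + k) := by
  unfold fourierCoef
  congr 1
  refine intervalIntegral.integral_congr fun x _ => ?_
  simp only
  rw [← mul_assoc, ← Complex.exp_add]
  congr 2
  push_cast; ring

theorem coef_sq (t : ℝ) (u G : ℝ → ℂ) (hu : MemLp u 2 (volume.restrict (Set.Ioc 0 (2 * Real.pi))))
    (hGm : Measurable G) (B : ℝ) (hB : ∀ x, ‖G x‖ ≤ B) (hG : Function.Periodic G (2 * Real.pi))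
    (huG : ∀ n : ℤ, fourierCoef u n = Complex.exp (-Complex.I * t * (n : ℂ) ^ 2) * fourierCoef G n)
    (hum : Measurable u) (k : ℤ) :
    fourierCoef (fun x => ((‖u x‖ ^ 2 : ℝ) : ℂ)) k = Complex.exp (-Complex.I * t * (k : ℂ) ^ 2) *
      ((1 / (2 * Real.pi)) * ∫ x in (0:ℝ)..(2 * Real.pi), (starRingEnd ℂ) (G (x + 2 * t * k)) *
        (Complex.exp (-Complex.I * k * x) * G x)) := by
  have hexp : ∀ x : ℝ, ‖Complex.exp (-Complex.I * k * x)‖ = 1 := by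
    intro x
    have := Complex.norm_exp_ofReal_mul_I (-k * x)
    rw [← this]; congr 2; push_cast; ring
  have hexpm : Measurable (fun x : ℝ => Complex.exp (-Complex.I * k * x)) := by fun_prop
  have hu' : MemLp (fun x : ℝ => Complex.exp (-Complex.I * k * x) * u x) 2
      (volume.restrict (Set.Ioc 0 (2 * Real.pi))) := by
    refine hu.mono (hexpm.mul hum).aestronglyMeasurable (ae_of_all _ fun x => ?_)
    rw [norm_mul, hexp, one_mul]
  have hG1 := memLp_of_bdd (fun x => G (x + 2 * t * k)) (hGm.comp (by fun_prop)) B (fun x => hB _)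
  have hG2 := memLp_of_bdd (fun x : ℝ => Complex.exp (-Complex.I * k * x) * G x) (hexpm.mul hGm) B
    (fun x => by rw [norm_mul, hexp, one_mul]; exact hB _)
  have p1 := parseval u _ hu hu'
  have p2 := (parseval _ _ hG1 hG2).mul_left (Complex.exp (-Complex.I * t * (k : ℂ) ^ 2))
  have h1 : fourierCoef (fun x => ((‖u x‖ ^ 2 : ℝ) : ℂ)) k = (1 / (2 * Real.pi)) *
      ∫ x in (0:ℝ)..(2 * Real.pi), (starRingEnd ℂ) (u x) * (Complex.exp (-Complex.I * k * x) * u x) := by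
    unfold fourierCoef
    congr 1
    refine intervalIntegral.integral_congr fun x _ => ?_
    simp only
    rw [mul_left_comm, ← Complex.normSq_eq_conj_mul_self, Complex.normSq_eq_norm_sq]
  rw [h1]
  refine p1.unique ?_
  convert! p2 using 1
  ext n
  have := coef_shift G hG (2 * t * k) n
  push_cast at this
  rw [this, coef_mod, coef_mod, huG, huG, map_mul, map_mul, ← Complex.exp_conj, ← Complex.exp_conj]
  have h2 : Complex.exp ((starRingEnd ℂ) (-Complex.I * t * (n : ℂ) ^ 2)) *
      Complex.exp (-Complex.I * t * ((n + k : ℤ) : ℂ) ^ 2) =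
      Complex.exp (-Complex.I * t * (k : ℂ) ^ 2) *
        Complex.exp ((starRingEnd ℂ) (Complex.I * n * (2 * t * k))) := by
    rw [← Complex.exp_add, ← Complex.exp_add]
    congr 1
    simp only [map_mul, map_neg, Complex.conj_I, Complex.conj_ofReal, map_pow, Complex.conj_ofNat,
      map_intCast]
    push_cast
    ring
  linear_combination (starRingEnd ℂ) (fourierCoef G n) * fourierCoef G (n + k) * h2

/-- grid step function -/
noncomputable def gridFun (q : ℕ) (D : ℤ → ℂ) (x : ℝ) : ℂ := D ⌊x / (2 * Real.pi / q)⌋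

theorem gridFun_meas (q : ℕ) (D : ℤ → ℂ) : Measurable (gridFun q D) :=
  measurable_from_top.comp (Int.measurable_floor.comp (by fun_prop))

theorem D_zmul (q : ℕ) (D : ℤ → ℂ) (hD : ∀ j, D (j + q) = D j) (j z : ℤ) : D (j + z * q) = D j := by
  have : Function.Periodic D (q : ℤ) := hD
  exact (this.int_mul z) j

theorem D_bdd (q : ℕ) (hq : 0 < q) (D : ℤ → ℂ) (hD : ∀ j, D (j + q) = D j) :
    ∃ B, ∀ j, ‖D j‖ ≤ B := by
  refine ⟨∑ i ∈ Finset.range q, ‖D i‖, fun j => ?_⟩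
  have h1 : D j = D (j % q) := by
    conv_lhs => rw [← Int.emod_add_ediv_mul j q]
    rw [D_zmul q D hD]
  have h2 : 0 ≤ j % (q:ℤ) := Int.emod_nonneg _ (by omega)
  have h3 : j % (q:ℤ) < q := Int.emod_lt_of_pos _ (by omega)
  obtain ⟨m, hm⟩ := Int.eq_ofNat_of_zero_le h2
  rw [h1, hm]
  exact Finset.single_le_sum (f := fun i : ℕ => ‖D i‖) (fun i _ => norm_nonneg _)
    (Finset.mem_range.mpr (by omega))

theorem gridFun_per (q : ℕ) (hq : 0 < q) (D : ℤ → ℂ) (hD : ∀ j, D (j + q) = D j) :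
    Function.Periodic (gridFun q D) (2 * Real.pi) := by
  intro x
  unfold gridFun
  have : (x + 2 * Real.pi) / (2 * Real.pi / q) = x / (2 * Real.pi / q) + (q : ℤ) := by
    have := Real.pi_pos
    push_cast
    field_simp
  rw [this, Int.floor_add_intCast, hD]

theorem grid_integral (q : ℕ) (hq : 0 < q) (D : ℤ → ℂ) (hD : ∀ j, D (j + q) = D j)
    (k : ℕ) (hk : 0 < k) (hqk : q ∣ k) (r : ℝ) (z : ℤ) (hz1 : (z:ℝ) ≤ r / (2 * Real.pi))
    (hz2 : r / (2 * Real.pi) < z + 1 / q) :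
    ∫ x in (0:ℝ)..(2 * Real.pi), (starRingEnd ℂ) (gridFun q D (x + r)) *
        (Complex.exp (-Complex.I * k * x) * gridFun q D x) =
      (Complex.exp (Complex.I * k * r) - 1) / (-Complex.I * k) *
        ∑ j ∈ Finset.range q, ((starRingEnd ℂ) (D j) * D j - (starRingEnd ℂ) (D (j + 1)) * D j) := by
  have hpi := Real.pi_pos
  have hq' : (0:ℝ) < q := by exact_mod_cast hq
  set w : ℝ := 2 * Real.pi / q with hw
  have hw0 : 0 < w := by positivity
  have hwq : w * q = 2 * Real.pi := by rw [hw]; field_simp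
  obtain ⟨B, hB⟩ := D_bdd q hq D hD
  set Φ : ℝ → ℂ := fun x => (starRingEnd ℂ) (gridFun q D (x + r)) *
        (Complex.exp (-Complex.I * k * x) * gridFun q D x) with hΦ
  have hexp : ∀ x : ℝ, ‖Complex.exp (-Complex.I * k * x)‖ = 1 := by
    intro x
    have := Complex.norm_exp_ofReal_mul_I (-k * x)
    rw [← this]; congr 2; push_cast; ring
  have hB0 : 0 ≤ B := (norm_nonneg _).trans (hB 0)
  have hii : ∀ a b, IntervalIntegrable Φ volume a b := by
    refine ii_of_bdd Φ ?_ (B * B) ?_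
    · refine (Complex.continuous_conj.measurable.comp ((gridFun_meas q D).comp (by fun_prop))).mul
        (Measurable.mul (by fun_prop) (gridFun_meas q D))
    · intro x
      simp only [hΦ]
      rw [norm_mul, norm_mul, hexp, one_mul, RCLike.norm_conj]
      exact mul_le_mul (hB _) (hB _) (norm_nonneg _) hB0
  set ρ : ℝ := r - 2 * Real.pi * z with hρ
  have hρ0 : 0 ≤ ρ := by rw [le_div_iff₀ (by positivity)] at hz1; linarith
  have hρ1 : ρ < w := by
    rw [div_lt_iff₀ (by positivity)] at hz2
    have : w = 1 / q * (2 * Real.pi) := by rw [hw]; ring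
    rw [this]; linarith
  have hc0 : (-Complex.I * k : ℂ) ≠ 0 := by simp; omega
  set κ := (Complex.exp (Complex.I * k * r) - 1) / (-Complex.I * k) with hκ
  obtain ⟨l, hl⟩ := hqk
  have hwqC : (w:ℂ) * q = 2 * Real.pi := by exact_mod_cast hwq
  have e1 : ∀ j : ℕ, Complex.exp (-Complex.I * k * ((j * w : ℝ) : ℂ)) = 1 := by
    intro j
    rw [Complex.exp_eq_one_iff]
    refine ⟨-(l * j), ?_⟩
    rw [hl]; push_cast
    linear_combination (-Complex.I * l * j) * hwqC
  have e2 : ∀ j : ℕ, Complex.exp (-Complex.I * k * ((j * w - ρ : ℝ) : ℂ)) = Complex.exp (Complex.I * k * r) := by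
    intro j
    rw [Complex.exp_eq_exp_iff_exists_int]
    refine ⟨-(l * j) - k * z, ?_⟩
    rw [hl, hρ]; push_cast
    linear_combination (-Complex.I * l * j) * hwqC
  have cell : ∀ j : ℕ, ∫ x in (j * w)..((j + 1 : ℕ) * w), Φ x =
      κ * ((starRingEnd ℂ) (D j) * D j - (starRingEnd ℂ) (D (j + 1)) * D j) := by
    intro j
    have hj1 : (j:ℝ) * w ≤ (j + 1 : ℕ) * w - ρ := by push_cast; linarith
    have hj2 : ((j + 1 : ℕ) : ℝ) * w - ρ ≤ (j + 1 : ℕ) * w := by linarith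
    have hshift : ∀ x : ℝ, (x + r) / w = (x + ρ) / w + ((z * q : ℤ) : ℝ) := by
      intro x
      rw [hρ]; push_cast
      field_simp
      linear_combination (-z) * hwq
    rw [← intervalIntegral.integral_add_adjacent_intervals (hii _ ((j + 1 : ℕ) * w - ρ)) (hii _ _)]
    have i1 : ∫ x in (j * w)..((j + 1 : ℕ) * w - ρ), Φ x =
        ∫ x in (j * w)..((j + 1 : ℕ) * w - ρ), (starRingEnd ℂ) (D j) * D j * Complex.exp (-Complex.I * k * (x:ℂ)) := by
      refine intervalIntegral.integral_congr_Ioo_of_le hj1 fun x hx => ?_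
      have g1 : gridFun q D x = D j := by
        unfold gridFun
        rw [← hw]
        congr 1
        rw [Int.floor_eq_iff, le_div_iff₀ hw0, div_lt_iff₀ hw0]
        have h1 := hx.1; have h2 := hx.2
        push_cast at h1 h2 ⊢
        constructor <;> linarith
      have g2 : gridFun q D (x + r) = D j := by
        unfold gridFun
        rw [← hw, hshift, Int.floor_add_intCast, D_zmul q D hD]
        congr 1
        rw [Int.floor_eq_iff, le_div_iff₀ hw0, div_lt_iff₀ hw0]
        have h1 := hx.1; have h2 := hx.2
        push_cast at h1 h2 ⊢
        constructor <;> linarith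
      simp only [hΦ, g1, g2]; ring
    have i2 : ∫ x in ((j + 1 : ℕ) * w - ρ)..((j + 1 : ℕ) * w), Φ x =
        ∫ x in ((j + 1 : ℕ) * w - ρ)..((j + 1 : ℕ) * w), (starRingEnd ℂ) (D (j + 1)) * D j * Complex.exp (-Complex.I * k * (x:ℂ)) := by
      refine intervalIntegral.integral_congr_Ioo_of_le hj2 fun x hx => ?_
      have g1 : gridFun q D x = D j := by
        unfold gridFun
        rw [← hw]
        congr 1
        rw [Int.floor_eq_iff, le_div_iff₀ hw0, div_lt_iff₀ hw0]
        have h1 := hx.1; have h2 := hx.2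
        push_cast at h1 h2 ⊢
        constructor <;> linarith
      have g2 : gridFun q D (x + r) = D (j + 1) := by
        unfold gridFun
        rw [← hw, hshift, Int.floor_add_intCast, D_zmul q D hD]
        congr 1
        rw [Int.floor_eq_iff, le_div_iff₀ hw0, div_lt_iff₀ hw0]
        have h1 := hx.1; have h2 := hx.2
        push_cast at h1 h2 ⊢
        constructor <;> linarith
      simp only [hΦ, g1, g2]; ring
    rw [i1, i2, intervalIntegral.integral_const_mul, intervalIntegral.integral_const_mul,
      integral_exp_mul_complex hc0, integral_exp_mul_complex hc0, e1, e1, e2, hκ]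
    ring
  have hs := intervalIntegral.sum_integral_adjacent_intervals (f := Φ) (μ := volume)
    (a := fun j : ℕ => (j:ℝ) * w) (n := q) (fun j _ => hii _ _)
  rw [Nat.cast_zero, zero_mul, mul_comm (q:ℝ), hwq] at hs
  rw [← hs, Finset.mul_sum]
  exact Finset.sum_congr rfl fun j _ => cell j

theorem grid_nonconst (q : ℕ) (D : ℤ → ℂ) (hD : ∀ j, D (j + q) = D j)
    (h0 : ∑ j ∈ Finset.range q, ((starRingEnd ℂ) (D j) * D j - (starRingEnd ℂ) (D (j + 1)) * D j) = 0) :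
    ∀ j : ℕ, j ≤ q → D j = D 0 := by
  have hs : ∑ j ∈ Finset.range q, ‖D (j + 1)‖ ^ 2 = ∑ j ∈ Finset.range q, ‖D j‖ ^ 2 := by
    have h1 := Finset.sum_range_succ (fun j : ℕ => ‖D j‖ ^ 2) q
    have h2 := Finset.sum_range_succ' (fun j : ℕ => ‖D j‖ ^ 2) q
    have h3 := hD 0
    rw [zero_add] at h3
    push_cast at h1 h2
    rw [h3] at h1
    linarith
  have hid : ∀ j : ℕ, ‖D j - D (j + 1)‖ ^ 2 = 2 * ((starRingEnd ℂ) (D j) * D j - (starRingEnd ℂ) (D (j + 1)) * D j).re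
      + (‖D (j + 1)‖ ^ 2 - ‖D j‖ ^ 2) := by
    intro j
    rw [← Complex.normSq_eq_norm_sq, ← Complex.normSq_eq_norm_sq, ← Complex.normSq_eq_norm_sq]
    simp [Complex.normSq_apply]
    ring
  have hz : ∑ j ∈ Finset.range q, ‖D j - D (j + 1)‖ ^ 2 = 0 := by
    simp_rw [hid]
    rw [Finset.sum_add_distrib, ← Finset.mul_sum, ← Complex.re_sum, h0, Finset.sum_sub_distrib, hs]
    simp
  rw [Finset.sum_eq_zero_iff_of_nonneg (fun _ _ => by positivity)] at hz
  intro j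
  induction j with
  | zero => intro _; rfl
  | succ j ih =>
    intro hj
    have := hz j (Finset.mem_range.mpr (by omega))
    have h1 : D j - D (j + 1) = 0 := by simpa using this
    rw [← ih (by omega)]
    push_cast
    exact (sub_eq_zero.mp h1).symm

theorem step_repr (L : ℕ) (c : Fin L → ℂ) (a b : Fin L → ℝ) (g : ℝ → ℂ)
    (hrat : ∀ ℓ : Fin L, (∃ r : ℚ, a ℓ = (r : ℝ) * Real.pi) ∧
      ∃ r : ℚ, b ℓ = (r : ℝ) * Real.pi)
    (hg : ∀ x : ℝ, g x = ∑ ℓ : Fin L, Set.indicator (Set.Ico (a ℓ) (b ℓ)) (fun _ => c ℓ) x) :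
    ∃ q : ℕ, 0 < q ∧ ∃ D : ℤ → ℂ, (∀ j, D (j + q) = D j) ∧
      ∀ x ∈ Set.Ico (0:ℝ) (2 * Real.pi), g x = gridFun q D x := by
  have hpi := Real.pi_pos
  choose ra hra using fun ℓ => (hrat ℓ).1
  choose rb hrb using fun ℓ => (hrat ℓ).2
  set Q : ℕ := ∏ ℓ, ((ra ℓ).den * (rb ℓ).den) with hQ
  have hQ0 : 0 < Q := Finset.prod_pos fun ℓ _ => Nat.mul_pos (ra ℓ).pos (rb ℓ).pos
  have hQR : (0:ℝ) < Q := by exact_mod_cast hQ0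
  have aux : ∀ r : ℚ, r.den ∣ Q → ∃ A : ℤ, (r : ℝ) * Real.pi = A * (2 * Real.pi / (2 * Q : ℕ)) := by
    rintro r ⟨m, hm⟩
    refine ⟨r.num * m, ?_⟩
    have hr : (r : ℝ) * r.den = r.num := by exact_mod_cast Rat.mul_den_eq_num r
    push_cast
    rw [← hr]
    field_simp
    rw [hm]; push_cast; ring
  have hA : ∀ ℓ, ∃ A : ℤ, a ℓ = A * (2 * Real.pi / (2 * Q : ℕ)) := fun ℓ => by
    rw [hra]
    exact aux _ ((Dvd.intro _ rfl).trans (Finset.dvd_prod_of_mem _ (Finset.mem_univ ℓ)))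
  have hB : ∀ ℓ, ∃ A : ℤ, b ℓ = A * (2 * Real.pi / (2 * Q : ℕ)) := fun ℓ => by
    rw [hrb]
    exact aux _ ((Dvd.intro_left _ rfl).trans (Finset.dvd_prod_of_mem _ (Finset.mem_univ ℓ)))
  choose A hA using hA
  choose B hB using hB
  refine ⟨2 * Q, by omega, fun j => ∑ ℓ, if A ℓ ≤ j % (2 * Q : ℕ) ∧ j % (2 * Q : ℕ) < B ℓ then c ℓ else 0, ?_, ?_⟩
  · intro j
    simp only [Int.add_emod_right]
  · intro x hx
    rw [hg]
    unfold gridFun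
    set w : ℝ := 2 * Real.pi / (2 * Q : ℕ) with hw
    have hw0 : 0 < w := by rw [hw]; push_cast; positivity
    have h1 : 0 ≤ ⌊x / w⌋ := Int.floor_nonneg.mpr (div_nonneg hx.1 hw0.le)
    have h2 : ⌊x / w⌋ < (2 * Q : ℕ) := by
      rw [Int.floor_lt, div_lt_iff₀ hw0, hw]
      have := hx.2
      push_cast
      field_simp
      linarith
    refine Finset.sum_congr rfl fun ℓ _ => ?_
    rw [Int.emod_eq_of_lt h1 h2, Set.indicator_apply, hA, hB]
    simp only [Set.mem_Ico, Int.le_floor, Int.floor_lt, le_div_iff₀ hw0, div_lt_iff₀ hw0]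


theorem lowerL2 (f : ℝ → ℝ) (hf : Continuous f) (hp : Function.Periodic f (2 * Real.pi))
    (P : ℕ) (hP : 0 < P) (c : ℝ) (hc : 0 < c)
    (hgood : ∀ i : ℕ, ∃ k : ℕ, P * i ≤ k ∧ k < P * (i + 1) ∧
      c / k ≤ ‖fourierCoef (fun x => (f x : ℂ)) k‖) :
    ∀ᶠ h in nhdsWithin (0:ℝ) (Set.Ioi 0), c ^ 2 / (36 * P) * h ≤
      ∫ x in (0:ℝ)..(2 * Real.pi), |f (x + h) - f x| ^ 2 := by
  have hP' : (0:ℝ) < P := by exact_mod_cast hP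
  have hpi := Real.pi_gt_three
  have hpi4 := Real.pi_lt_d2
  choose k hk1 hk2 hk3 using hgood
  have hinj : Function.Injective k := by
    refine (strictMono_nat_of_lt_succ fun i => ?_).injective
    exact lt_of_lt_of_le (hk2 i) (hk1 (i + 1))
  filter_upwards [Ioo_mem_nhdsGT (show (0:ℝ) < 1 / (2 * P) by positivity)] with h hh
  obtain ⟨hh0, hh1⟩ := hh
  rw [lt_div_iff₀ (by positivity)] at hh1
  set n0 := ⌈1 / (h * P)⌉₊ with hn0
  have hn1 : 1 / (h * P) ≤ n0 := Nat.le_ceil _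
  have hn2 : (n0 : ℝ) < 1 / (h * P) + 1 := Nat.ceil_lt_add_one (by positivity)
  have hn1' : 1 ≤ n0 * (h * P) := by rwa [div_le_iff₀ (by positivity)] at hn1
  have hn2' : n0 * (h * P) ≤ 3 / 2 := by
    have := mul_lt_mul_of_pos_right hn2 (show 0 < h * P by positivity)
    rw [add_mul, div_mul_cancel₀ _ (by positivity), one_mul] at this
    linarith
  set F : ℝ → ℂ := fun x => (f x : ℂ) with hF
  have hFc : Continuous F := Complex.continuous_ofReal.comp hf
  have hFp : Function.Periodic F (2 * Real.pi) := fun x => by simp only [hF]; rw [hp]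
  have hcoef : ∀ n : ℤ, fourierCoef (fun x => F (x + h) - F x) n =
      (Complex.exp (Complex.I * (n * h : ℝ)) - 1) * fourierCoef F n := by
    intro n
    have h1 : fourierCoef (fun x => F (x + h) - F x) n =
      fourierCoef (fun x => F (x + h)) n - fourierCoef F n := by
      unfold fourierCoef
      rw [← mul_sub, ← intervalIntegral.integral_sub]
      · congr 1
        refine intervalIntegral.integral_congr fun x _ => ?_
        simp only; ring
      · exact Continuous.intervalIntegrable (by fun_prop) _ _
      · exact Continuous.intervalIntegrable (by fun_prop) _ _
    rw [h1, coef_shift F hFp]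
    push_cast
    ring_nf
  have hmem : MemLp (fun x => F (x + h) - F x) 2 (volume.restrict (Set.Ioc 0 (2 * Real.pi))) := by
    have hc : Continuous (fun x => F (x + h) - F x) := by fun_prop
    obtain ⟨B, hB⟩ := (isCompact_Icc (a := (0:ℝ)) (b := 2 * Real.pi)).exists_bound_of_continuousOn hc.continuousOn
    refine MemLp.of_bound hc.aestronglyMeasurable B ?_
    exact (ae_restrict_iff' measurableSet_Ioc).mpr (ae_of_all _ fun x hx => hB x ⟨hx.1.le, hx.2⟩)
  have hps := parseval_sq _ hmem
  have hinj' : Function.Injective (fun i : ℕ => (k i : ℤ)) := fun i j hij => hinj (by simpa using hij)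
  have hle := sum_le_hasSum ((Finset.Ico n0 (2 * n0)).map ⟨_, hinj'⟩) (fun _ _ => by positivity) hps
  rw [Finset.sum_map] at hle
  have hterm : ∀ i ∈ Finset.Ico n0 (2 * n0), c ^ 2 * h ^ 2 / 36 ≤
      ‖fourierCoef (fun x => F (x + h) - F x) (k i)‖ ^ 2 := by
    intro i hi
    rw [Finset.mem_Ico] at hi
    have a1 : (P * n0 : ℝ) ≤ k i := by
      exact_mod_cast (Nat.mul_le_mul_left P hi.1).trans (hk1 i)
    have a2 : (k i : ℝ) ≤ P * (2 * n0) := by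
      exact_mod_cast (hk2 i).le.trans (Nat.mul_le_mul_left P hi.2)
    have b1 : 1 ≤ k i * h := by nlinarith
    have b2 : k i * h ≤ 3 := by nlinarith
    rw [hcoef, norm_mul]
    have hkp : (0:ℝ) < k i := by
      by_contra hcon
      nlinarith
    have c1 : 1 / 2 ≤ ‖Complex.exp (Complex.I * (((k i : ℤ) * h : ℝ) : ℂ)) - 1‖ := by
      rw [Complex.norm_exp_I_mul_ofReal_sub_one, Real.norm_eq_abs]
      push_cast
      have := Real.mul_le_sin (x := (k i : ℝ) * h / 2) (by positivity) (by linarith)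
      have h3 : 1 / 4 ≤ 2 / Real.pi * ((k i : ℝ) * h / 2) := by
        rw [div_mul_eq_mul_div, le_div_iff₀ (by positivity)]
        linarith
      exact le_trans (by linarith) (le_abs_self _)
    have c2 : c * h / 3 ≤ ‖fourierCoef F (k i)‖ := by
      refine le_trans ?_ (hk3 i)
      rw [div_le_div_iff₀ (by norm_num) hkp]
      nlinarith
    have c3 : (1 / 2) * (c * h / 3) ≤ ‖Complex.exp (Complex.I * (((k i : ℤ) * h : ℝ) : ℂ)) - 1‖ *
      ‖fourierCoef F (k i)‖ := mul_le_mul c1 c2 (by positivity) (by positivity)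
    have c4 := pow_le_pow_left₀ (by positivity) c3 2
    linarith
  have hsum := Finset.sum_le_sum hterm
  rw [Finset.sum_const, Nat.card_Ico, nsmul_eq_mul, show 2 * n0 - n0 = n0 by omega] at hsum
  have h5 : ∫ x in (0:ℝ)..(2 * Real.pi), ‖F (x + h) - F x‖ ^ 2 =
      ∫ x in (0:ℝ)..(2 * Real.pi), |f (x + h) - f x| ^ 2 := by
    refine intervalIntegral.integral_congr fun x _ => ?_
    simp only [hF]
    rw [← Complex.ofReal_sub, Complex.norm_real, Real.norm_eq_abs]
  have h6 := hsum.trans hle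
  rw [h5] at h6
  set R := ∫ x in (0:ℝ)..(2 * Real.pi), |f (x + h) - f x| ^ 2 with hR
  have hR0 : 0 ≤ R := intervalIntegral.integral_nonneg (by positivity) (fun _ _ => by positivity)
  have h7 : (2 * Real.pi)⁻¹ * R ≤ R := by
    refine mul_le_of_le_one_left hR0 (inv_le_one_of_one_le₀ (by linarith))
  refine le_trans ?_ (h6.trans h7)
  rw [div_mul_eq_mul_div, div_le_iff₀ (by positivity)]
  have : n0 * (c ^ 2 * h ^ 2 / 36) * (36 * P) = c ^ 2 * h * (n0 * (h * P)) := by ring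
  rw [this]
  exact le_mul_of_one_le_right (by positivity) hn1'

theorem dims_of (u : ℝ → ℂ) (huc : Continuous u) (hup : Function.Periodic u (2 * Real.pi))
    (hH : ∀ θ : ℝ, 0 < θ → θ < 1 / 2 → ∃ C > 0, ∀ x y, ‖u x - u y‖ ≤ C * |x - y| ^ θ)
    (c : ℝ) (hc : 0 < c)
    (hl : ∀ᶠ h in nhdsWithin (0:ℝ) (Set.Ioi 0), c * h ≤
      ∫ x in (0:ℝ)..(2 * Real.pi), |‖u (x + h)‖ ^ 2 - ‖u x‖ ^ 2| ^ 2) :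
    upperMinkowskiDim (graphOn (fun x => ‖u x‖ ^ 2)) = 3 / 2 ∧
      upperMinkowskiDim (graphOn (fun x => ‖u x‖)) = 3 / 2 := by
  have hpi := Real.pi_pos
  obtain ⟨B0, hB0⟩ := (hup.isBounded_of_continuous Real.two_pi_pos.ne' huc).exists_norm_le
  obtain ⟨B, hBpos, hB⟩ : ∃ B > 0, ∀ x, ‖u x‖ ≤ B :=
    ⟨max B0 1, by positivity, fun x => (hB0 _ ⟨x, rfl⟩).trans (le_max_left _ _)⟩
  have hn : ∀ x y, |‖u x‖ - ‖u y‖| ≤ ‖u x - u y‖ := fun x y => abs_norm_sub_norm_le _ _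
  have hs : ∀ x y, |‖u x‖ ^ 2 - ‖u y‖ ^ 2| ≤ 2 * B * |‖u x‖ - ‖u y‖| := by
    intro x y
    rw [sq_sub_sq, abs_mul]
    gcongr
    rw [abs_of_nonneg (by positivity)]
    linarith [hB x, hB y]
  have hs2 : ∀ θ : ℝ, 0 < θ → θ < 1 / 2 → ∃ C > 0, ∀ x y, |‖u x‖ ^ 2 - ‖u y‖ ^ 2| ≤ C * |x - y| ^ θ := by
    intro θ h1 h2
    obtain ⟨C, hC, h⟩ := hH θ h1 h2
    refine ⟨2 * B * C, by positivity, fun x y => (hs x y).trans ?_⟩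
    calc 2 * B * |‖u x‖ - ‖u y‖| ≤ 2 * B * (C * |x - y| ^ θ) := by
          refine mul_le_mul_of_nonneg_left ((hn x y).trans (h x y)) (by positivity)
      _ = _ := by ring
  have hlow : ∀ δ : ℝ, δ > 0 → ∃ A > 0, ∀ᶠ h in nhdsWithin (0:ℝ) (Set.Ioi 0),
      A * h ^ (1 / 2 + δ) ≤ ∫ x in (0:ℝ)..(2 * Real.pi), |‖u (x + h)‖ ^ 2 - ‖u x‖ ^ 2| := by
    intro δ hδ
    set θ : ℝ := max (1/2 - δ) (1/4) with hθ
    have hθ1 : 1/4 ≤ θ := le_max_right _ _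
    have hθ2 : θ < 1/2 := max_lt (by linarith) (by norm_num)
    have hθ3 : 1/2 - δ ≤ θ := le_max_left _ _
    obtain ⟨C, hC, h'⟩ := hs2 θ (by linarith) hθ2
    refine ⟨c / C, by positivity, ?_⟩
    filter_upwards [hl, Ioo_mem_nhdsGT (one_pos (α := ℝ))] with h hlh hh
    have hh0 := hh.1
    have h2 : ∫ x in (0:ℝ)..(2 * Real.pi), |‖u (x + h)‖ ^ 2 - ‖u x‖ ^ 2| ^ 2 ≤
        ∫ x in (0:ℝ)..(2 * Real.pi), C * h ^ θ * |‖u (x + h)‖ ^ 2 - ‖u x‖ ^ 2| := by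
      refine intervalIntegral.integral_mono_on (by positivity)
        (Continuous.intervalIntegrable (by fun_prop) _ _)
        (Continuous.intervalIntegrable (by fun_prop) _ _) fun x _ => ?_
      rw [sq]
      gcongr
      have := h' (x + h) x
      rwa [add_sub_cancel_left, abs_of_pos hh0] at this
    rw [intervalIntegral.integral_const_mul] at h2
    have h3 := hlh.trans h2
    set R := ∫ x in (0:ℝ)..(2 * Real.pi), |‖u (x + h)‖ ^ 2 - ‖u x‖ ^ 2|
    have h4 : h = h ^ θ * h ^ (1 - θ) := by
      rw [← Real.rpow_add hh0]; simp
    have h5 : h ^ (1 / 2 + δ) ≤ h ^ (1 - θ) :=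
      Real.rpow_le_rpow_of_exponent_ge hh0 hh.2.le (by linarith)
    have h6 : c * h ^ (1 - θ) ≤ C * R := by
      have hpos : 0 < h ^ θ := by positivity
      refine le_of_mul_le_mul_left ?_ hpos
      calc h ^ θ * (c * h ^ (1 - θ)) = c * (h ^ θ * h ^ (1 - θ)) := by ring
        _ = c * h := by rw [← h4]
        _ ≤ _ := h3
        _ = _ := by ring
    rw [div_mul_eq_mul_div, div_le_iff₀ hC]
    calc c * h ^ (1 / 2 + δ) ≤ c * h ^ (1 - θ) := by gcongr
      _ ≤ _ := h6
      _ = _ := by ring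
  constructor
  · exact dim_of_bounds _ (fun x => by simp only [hup x]) hs2 hlow
  · refine dim_of_bounds _ (fun x => by simp only [hup x]) ?_ ?_
    · intro θ h1 h2
      obtain ⟨C, hC, h⟩ := hH θ h1 h2
      exact ⟨C, hC, fun x y => (hn x y).trans (h x y)⟩
    · intro δ hδ
      obtain ⟨A, hA, h⟩ := hlow δ hδ
      refine ⟨A / (2 * B), by positivity, ?_⟩
      filter_upwards [h] with h hh
      rw [div_mul_eq_mul_div, div_le_iff₀ (by positivity)]
      refine hh.trans ?_
      rw [mul_comm _ (2 * B), ← intervalIntegral.integral_const_mul]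
      refine intervalIntegral.integral_mono_on (by positivity)
        (Continuous.intervalIntegrable (by fun_prop) _ _)
        (Continuous.intervalIntegrable (by fun_prop) _ _) fun x _ => hs _ _

theorem final_of_u (t : ℝ) (ht : Irrational (t / Real.pi)) (q : ℕ) (hq : 0 < q) (D : ℤ → ℂ)
    (hD : ∀ j, D (j + q) = D j)
    (hnc : ∑ j ∈ Finset.range q, ((starRingEnd ℂ) (D j) * D j - (starRingEnd ℂ) (D (j + 1)) * D j) ≠ 0)
    (u : ℝ → ℂ) (huc : Continuous u) (hup : Function.Periodic u (2 * Real.pi))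
    (hH : ∀ θ : ℝ, 0 < θ → θ < 1 / 2 → ∃ C > 0, ∀ x y, ‖u x - u y‖ ≤ C * |x - y| ^ θ)
    (hcoef : ∀ n : ℤ, fourierCoef u n = Complex.exp (-Complex.I * t * (n : ℂ) ^ 2) *
      fourierCoef (gridFun q D) n) :
    upperMinkowskiDim (graphOn (fun x => ‖u x‖ ^ 2)) = 3 / 2 ∧
      upperMinkowskiDim (graphOn (fun x => ‖u x‖)) = 3 / 2 := by
  have hpi := Real.pi_pos
  set S0 := ∑ j ∈ Finset.range q, ((starRingEnd ℂ) (D j) * D j - (starRingEnd ℂ) (D (j + 1)) * D j) with hS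
  obtain ⟨P, hP, c, hc, hk⟩ := good_k (t / Real.pi) ht q hq
  obtain ⟨B, hB⟩ := D_bdd q hq D hD
  have hS0 : 0 < ‖S0‖ := norm_pos_iff.mpr hnc
  have humem : MemLp u 2 (volume.restrict (Set.Ioc 0 (2 * Real.pi))) := by
    obtain ⟨B, hB⟩ := (isCompact_Icc (a := (0:ℝ)) (b := 2 * Real.pi)).exists_bound_of_continuousOn huc.continuousOn
    refine MemLp.of_bound huc.aestronglyMeasurable B ?_
    exact (ae_restrict_iff' measurableSet_Ioc).mpr (ae_of_all _ fun x hx => hB x ⟨hx.1.le, hx.2⟩)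
  refine dims_of u huc hup hH _ ?_ (lowerL2 (fun x => ‖u x‖ ^ 2) (by fun_prop)
    (fun x => by simp only [hup x]) P hP (c * ‖S0‖ / (2 * Real.pi)) (by positivity) ?_)
  · positivity
  · intro i
    obtain ⟨k, hk1, hk2, hqk, ⟨z, hz1, hz2⟩, hck⟩ := hk i
    refine ⟨k, hk1, hk2, ?_⟩
    have hk0 : 0 < k := by
      rcases Nat.eq_zero_or_pos k with h | h
      · rw [h] at hck
        simp at hck
        linarith
      · exact h
    have hk0' : (0:ℝ) < k := by exact_mod_cast hk0
    have h1 := coef_sq t u (gridFun q D) humem (gridFun_meas q D) B (fun x => hB _)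
      (gridFun_per q hq D hD) hcoef huc.measurable k
    have hr : (2 * t * k) / (2 * Real.pi) = t / Real.pi * k := by field_simp
    have h2 := grid_integral q hq D hD k hk0 hqk (2 * t * k) z (by rw [hr]; exact hz1) (by rw [hr]; exact hz2)
    push_cast at h1 h2 ⊢
    rw [h1, h2]
    have e1 : ‖Complex.exp (-Complex.I * t * (k : ℂ) ^ 2)‖ = 1 := by
      have := Complex.norm_exp_ofReal_mul_I (-t * k ^ 2)
      rw [← this]; congr 2; push_cast; ring
    have e2 : Complex.exp (Complex.I * k * (2 * t * k)) =
        Complex.exp (2 * Real.pi * (t / Real.pi : ℝ) * (k : ℂ) ^ 2 * Complex.I) := by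
      congr 1
      have := Complex.ofReal_ne_zero.mpr Real.pi_ne_zero
      push_cast
      field_simp
    have e3 : ‖(1 / (2 * Real.pi) : ℂ)‖ = 1 / (2 * Real.pi) := by
      rw [norm_div, norm_mul]
      simp [abs_of_pos hpi]
    rw [norm_mul, e1, one_mul, norm_mul, norm_mul, e3, norm_div, e2, norm_mul (-Complex.I)]
    rw [norm_neg, Complex.norm_I, one_mul, Complex.norm_natCast]
    calc c * ‖S0‖ / (2 * Real.pi) / k = 1 / (2 * Real.pi) * (c / k * ‖S0‖) := by ring
      _ ≤ _ := by gcongr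


noncomputable def expSum (t : ℝ) (N : ℕ) (y : ℝ) : ℂ :=
  ∑ n ∈ Finset.range N, Complex.exp (Complex.I * ((-(t * ((n:ℝ) + 1) ^ 2) + ((n:ℝ) + 1) * y : ℝ) : ℂ))

theorem vdc (z : ℕ → ℂ) (hz : ∀ n, ‖z n‖ = 1) (N : ℕ) :
    ‖∑ n ∈ Finset.range N, z n‖ ^ 2 ≤ N + 2 * ∑ h ∈ Finset.range N,
      (if h = 0 then 0 else ‖∑ n ∈ Finset.range (N - h), z (n + h) * (starRingEnd ℂ) (z n)‖) := by
  -- exact identity by double counting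
  have key : ∀ N : ℕ, (∑ n ∈ Finset.range N, z n) * (starRingEnd ℂ) (∑ n ∈ Finset.range N, z n) =
      N + ∑ h ∈ Finset.range N, (if h = 0 then 0 else
        ((∑ n ∈ Finset.range (N - h), z (n + h) * (starRingEnd ℂ) (z n)) +
        (starRingEnd ℂ) (∑ n ∈ Finset.range (N - h), z (n + h) * (starRingEnd ℂ) (z n)))) := by
    intro N
    induction N with
    | zero => simp
    | succ N ih =>
      rw [Finset.sum_range_succ, map_add, add_mul, mul_add, mul_add, ih]
      have h1 : z N * (starRingEnd ℂ) (z N) = 1 := by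
        rw [Complex.mul_conj, Complex.normSq_eq_norm_sq, hz]; simp
      rw [h1]
      have hcross : z N * (starRingEnd ℂ) (∑ n ∈ Finset.range N, z n) =
          ∑ h ∈ Finset.range (N + 1), (if h = 0 then 0 else z N * (starRingEnd ℂ) (z (N - h))) := by
        rw [Finset.sum_range_succ']
        simp only [map_sum, Finset.mul_sum]
        rw [← Finset.sum_range_reflect]
        simp only [Nat.add_eq_zero_iff, one_ne_zero, and_false, if_false, if_true, add_zero]
        refine Finset.sum_congr rfl fun i hi => ?_
        rw [Nat.sub_sub, add_comm 1 i]
      have hcross2 : (∑ n ∈ Finset.range N, z n) * (starRingEnd ℂ) (z N) =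
          (starRingEnd ℂ) (z N * (starRingEnd ℂ) (∑ n ∈ Finset.range N, z n)) := by
        rw [map_mul, Complex.conj_conj, mul_comm]
      rw [hcross2, hcross, map_sum]
      have hext : ∑ h ∈ Finset.range N, (if h = 0 then 0 else
        ((∑ n ∈ Finset.range (N - h), z (n + h) * (starRingEnd ℂ) (z n)) +
        (starRingEnd ℂ) (∑ n ∈ Finset.range (N - h), z (n + h) * (starRingEnd ℂ) (z n)))) =
        ∑ h ∈ Finset.range (N + 1), (if h = 0 then 0 else
        ((∑ n ∈ Finset.range (N - h), z (n + h) * (starRingEnd ℂ) (z n)) +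
        (starRingEnd ℂ) (∑ n ∈ Finset.range (N - h), z (n + h) * (starRingEnd ℂ) (z n)))) := by
        rw [Finset.sum_range_succ _ N]; simp
      rw [hext]
      have hfin : ∑ h ∈ Finset.range (N + 1), (if h = 0 then 0 else
        ((∑ n ∈ Finset.range (N + 1 - h), z (n + h) * (starRingEnd ℂ) (z n)) +
        (starRingEnd ℂ) (∑ n ∈ Finset.range (N + 1 - h), z (n + h) * (starRingEnd ℂ) (z n)))) =
        ∑ h ∈ Finset.range (N + 1), (if h = 0 then 0 else
        ((∑ n ∈ Finset.range (N - h), z (n + h) * (starRingEnd ℂ) (z n)) +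
        (starRingEnd ℂ) (∑ n ∈ Finset.range (N - h), z (n + h) * (starRingEnd ℂ) (z n)))) +
        ∑ h ∈ Finset.range (N + 1), (starRingEnd ℂ) (if h = 0 then 0 else z N * (starRingEnd ℂ) (z (N - h))) +
        ∑ h ∈ Finset.range (N + 1), (if h = 0 then 0 else z N * (starRingEnd ℂ) (z (N - h))) := by
        rw [← Finset.sum_add_distrib, ← Finset.sum_add_distrib]
        refine Finset.sum_congr rfl fun h hh => ?_
        rw [Finset.mem_range] at hh
        by_cases h0 : h = 0
        · simp [h0]
        · simp only [h0, if_false]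
          rw [show N + 1 - h = (N - h) + 1 by omega, Finset.sum_range_succ, show N - h + h = N by omega, map_add]
          ring
      rw [hfin]
      push_cast
      ring
  have h2 : ((‖∑ n ∈ Finset.range N, z n‖ ^ 2 : ℝ) : ℂ) = (∑ n ∈ Finset.range N, z n) * (starRingEnd ℂ) (∑ n ∈ Finset.range N, z n) := by
    rw [Complex.mul_conj, Complex.normSq_eq_norm_sq]
  rw [key] at h2
  have h3 : ‖∑ n ∈ Finset.range N, z n‖ ^ 2 = ‖((‖∑ n ∈ Finset.range N, z n‖ ^ 2 : ℝ) : ℂ)‖ := by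
    rw [Complex.norm_real, Real.norm_eq_abs, abs_of_nonneg (by positivity)]
  rw [h3, h2]
  refine (norm_add_le _ _).trans ?_
  rw [Complex.norm_natCast, Finset.mul_sum]
  gcongr
  refine (norm_sum_le _ _).trans (Finset.sum_le_sum fun h _ => ?_)
  split_ifs
  · simp
  · refine (norm_add_le _ _).trans ?_
    rw [RCLike.norm_conj]; linarith

theorem geom_bd (M : ℕ) (s : ℝ) (hs : Real.sin s ≠ 0) (w : ℂ) (hw : ‖w‖ = 1) :
    ‖∑ n ∈ Finset.range M, w * Complex.exp (Complex.I * ((2 * s : ℝ) : ℂ)) ^ n‖ ≤ 1 / |Real.sin s| := by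
  have hn := Complex.norm_exp_I_mul_ofReal_sub_one (2 * s)
  rw [show 2 * s / 2 = s by ring] at hn
  have hne : Complex.exp (Complex.I * ((2 * s : ℝ) : ℂ)) ≠ 1 := by
    intro h
    rw [h] at hn
    simp at hn
    exact hs hn
  rw [← Finset.mul_sum, norm_mul, hw, one_mul, geom_sum_eq hne, norm_div, hn]
  have : ‖Complex.exp (Complex.I * ((2 * s : ℝ) : ℂ)) ^ M - 1‖ ≤ 2 := by
    refine (norm_sub_le _ _).trans ?_
    rw [norm_pow, mul_comm, Complex.norm_exp_ofReal_mul_I]; norm_num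
  rw [Real.norm_eq_abs, abs_mul, abs_two]
  have h0 : 0 < |Real.sin s| := abs_pos.mpr hs
  rw [div_le_div_iff₀ (by positivity) h0]
  nlinarith

theorem expSum_sq (t : ℝ) (ht : ∀ h : ℕ, h ≠ 0 → Real.sin (h * t) ≠ 0) (δ : ℝ) (hδ : 0 < δ) (hδ1 : δ < 1)
    (N : ℕ) (y : ℝ) :
    ‖expSum t N y‖ ^ 2 ≤ N + 2 * ((N:ℝ) ^ δ * ∑ h ∈ Finset.range N,
      (if h = 0 then 0 else |Real.sin (h * t)| ^ (-(1 - δ)))) := by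
  unfold expSum
  refine (vdc _ (fun n => by rw [mul_comm, Complex.norm_exp_ofReal_mul_I]) N).trans ?_
  rw [Finset.mul_sum _ _ ((N:ℝ) ^ δ)]
  gcongr with h hh
  rw [Finset.mem_range] at hh
  by_cases h0 : h = 0
  · simp [h0]
  simp only [h0, if_false]
  have hs0 : 0 < |Real.sin (h * t)| := abs_pos.mpr (ht h h0)
  have hN : (0:ℝ) < N := by exact_mod_cast (by omega : 0 < N)
  set A := ∑ n ∈ Finset.range (N - h), Complex.exp (Complex.I * ((-(t * (((n + h : ℕ):ℝ) + 1) ^ 2) + (((n + h : ℕ):ℝ) + 1) * y : ℝ) : ℂ)) *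
    (starRingEnd ℂ) (Complex.exp (Complex.I * ((-(t * ((n:ℝ) + 1) ^ 2) + ((n:ℝ) + 1) * y : ℝ) : ℂ))) with hA
  have h1 : ‖A‖ ≤ 1 / |Real.sin (h * t)| := by
    have h2 := geom_bd (N - h) (-(h * t)) (by rw [Real.sin_neg, neg_ne_zero]; exact ht h h0)
      (Complex.exp (Complex.I * ((-(t * (h ^ 2 + 2 * h)) + h * y : ℝ) : ℂ)))
      (by rw [mul_comm, Complex.norm_exp_ofReal_mul_I])
    rw [Real.sin_neg, abs_neg] at h2
    refine le_trans (le_of_eq ?_) h2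
    rw [hA]
    congr 1
    refine Finset.sum_congr rfl fun n _ => ?_
    rw [← Complex.exp_conj, ← Complex.exp_add, ← Complex.exp_nat_mul, ← Complex.exp_add]
    congr 1
    rw [map_mul, Complex.conj_I, Complex.conj_ofReal]
    push_cast
    ring
  have h2 : ‖A‖ ≤ N := by
    refine (norm_sum_le _ _).trans ?_
    have : ∀ n ∈ Finset.range (N - h), ‖Complex.exp (Complex.I * ((-(t * (((n + h : ℕ):ℝ) + 1) ^ 2) + (((n + h : ℕ):ℝ) + 1) * y : ℝ) : ℂ)) *
    (starRingEnd ℂ) (Complex.exp (Complex.I * ((-(t * ((n:ℝ) + 1) ^ 2) + ((n:ℝ) + 1) * y : ℝ) : ℂ)))‖ = 1 := by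
      intro n _
      rw [norm_mul, RCLike.norm_conj, mul_comm Complex.I, mul_comm Complex.I, Complex.norm_exp_ofReal_mul_I, Complex.norm_exp_ofReal_mul_I, one_mul]
    rw [Finset.sum_congr rfl this]
    simp
  calc ‖A‖ = ‖A‖ ^ δ * ‖A‖ ^ (1 - δ) := by
        rw [← Real.rpow_add_of_nonneg (norm_nonneg _) hδ.le (by linarith)]; simp
    _ ≤ (N:ℝ) ^ δ * (1 / |Real.sin (h * t)|) ^ (1 - δ) := by
        gcongr
    _ = _ := by
        rw [one_div, Real.inv_rpow hs0.le, Real.rpow_neg hs0.le]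

theorem sin_int (δ : ℝ) (hδ : 0 < δ) (hδ1 : δ < 1) :
    ∀ a b : ℝ, IntervalIntegrable (fun s => |Real.sin s| ^ (-(1 - δ))) volume a b := by
  have hpi := Real.pi_pos
  set f : ℝ → ℝ := fun s => |Real.sin s| ^ (-(1 - δ)) with hf
  have hmeas : Measurable f := by
    rw [hf]; fun_prop
  have h1 : IntervalIntegrable f volume 0 (Real.pi / 2) := by
    have h2 : IntervalIntegrable (fun s : ℝ => (2 / Real.pi) ^ (-(1 - δ)) * s ^ (-(1 - δ))) volume 0 (Real.pi / 2) :=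
      (intervalIntegral.intervalIntegrable_rpow' (by linarith)).const_mul _
    refine h2.mono_fun hmeas.aestronglyMeasurable ?_
    rw [Set.uIoc_of_le (by positivity)]
    refine (ae_restrict_iff' measurableSet_Ioc).mpr (ae_of_all _ fun s hs => ?_)
    have hs0 := hs.1
    have h3 := Real.mul_abs_le_abs_sin (x := s) (by rw [abs_of_pos hs0]; exact hs.2)
    rw [abs_of_pos hs0] at h3
    show ‖|Real.sin s| ^ (-(1 - δ))‖ ≤ ‖(2 / Real.pi) ^ (-(1 - δ)) * s ^ (-(1 - δ))‖
    rw [← Real.mul_rpow (by positivity) hs0.le, Real.norm_of_nonneg (by positivity), Real.norm_of_nonneg (by positivity)]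
    exact Real.rpow_le_rpow_of_nonpos (by positivity) h3 (by linarith)
  have h2 : IntervalIntegrable f volume (-(Real.pi / 2)) 0 := by
    rw [IntervalIntegrable.iff_comp_neg]
    simp only [hf, Real.sin_neg, abs_neg, neg_neg, neg_zero]
    exact h1.symm
  have hper : Function.Periodic f Real.pi := fun x => by simp only [hf, Real.sin_add_pi, abs_neg]
  have h3 := h2.trans h1
  exact fun a b => hper.intervalIntegrable hpi.ne' (t := -(Real.pi / 2)) (by convert h3 using 1; ring) a b

theorem sin_sum_ae (δ : ℝ) (hδ : 0 < δ) (hδ1 : δ < 1) :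
    ∀ᵐ t : ℝ, Summable (fun h : ℕ => ((h:ℝ) + 1) ^ (-(1 + δ)) * |Real.sin (((h:ℝ) + 1) * t)| ^ (-(1 - δ))) := by
  have hpi := Real.pi_pos
  set f : ℝ → ℝ := fun s => |Real.sin s| ^ (-(1 - δ)) with hf
  have hint := sin_int δ hδ hδ1
  have hper : Function.Periodic f Real.pi := fun x => by simp only [hf, Real.sin_add_pi, abs_neg]
  have hmeas : Measurable f := by
    rw [hf]; fun_prop
  have hloc : ∀ m : ℕ, ∀ᵐ t ∂(volume.restrict (Set.Ioc (-(m * Real.pi)) (m * Real.pi))),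
      Summable (fun h : ℕ => ((h:ℝ) + 1) ^ (-(1 + δ)) * f (((h:ℝ) + 1) * t)) := by
    intro m
    set μ := (volume.restrict (Set.Ioc (-((m:ℝ) * Real.pi)) (m * Real.pi))) with hμ
    have hle : -((m:ℝ) * Real.pi) ≤ m * Real.pi := by
      have : 0 ≤ (m:ℝ) * Real.pi := by positivity
      linarith
    have hInt : ∀ h : ℕ, Integrable (fun t => f (((h:ℝ) + 1) * t)) μ := by
      intro h
      rw [hμ]
      have := (hint (((h:ℝ) + 1) * (-((m:ℝ) * Real.pi))) (((h:ℝ) + 1) * (m * Real.pi))).comp_mul_left (c := (h:ℝ) + 1)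
      rw [mul_div_cancel_left₀ _ (by positivity), mul_div_cancel_left₀ _ (by positivity)] at this
      exact (intervalIntegrable_iff_integrableOn_Ioc_of_le hle).mp this
    set I := ∫ s in (0:ℝ)..(0 + Real.pi), f s with hI
    have hval : ∀ h : ℕ, ∫ t, f (((h:ℝ) + 1) * t) ∂μ = 2 * m * I := by
      intro h
      rw [hμ, ← intervalIntegral.integral_of_le hle]
      rw [intervalIntegral.integral_comp_mul_left _ (by positivity)]
      have h1 := hper.intervalIntegral_add_zsmul_eq (2 * m * (h + 1) : ℕ) (((h:ℝ) + 1) * (-((m:ℝ) * Real.pi))) hint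
      have h2 : (((h:ℝ) + 1) * (-((m:ℝ) * Real.pi))) + ((2 * m * (h + 1) : ℕ) : ℤ) • Real.pi = ((h:ℝ) + 1) * (m * Real.pi) := by
        rw [zsmul_eq_mul]; push_cast; ring
      rw [h2] at h1
      rw [h1, hper.intervalIntegral_add_eq _ 0, zsmul_eq_mul, smul_eq_mul]
      push_cast
      have : (h:ℝ) + 1 ≠ 0 := by positivity
      rw [← hI]
      field_simp
    have hsummable : Summable (fun h : ℕ => ((h:ℝ) + 1) ^ (-(1 + δ)) * (2 * m * I)) := by
      refine Summable.mul_right _ ?_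
      have := (summable_nat_add_iff 1).mpr (Real.summable_nat_rpow.mpr (show -(1 + δ) < -1 by linarith))
      simpa using this
    have hm : ∀ h : ℕ, Measurable (fun t => ENNReal.ofReal (((h:ℝ) + 1) ^ (-(1 + δ)) * f (((h:ℝ) + 1) * t))) := by
      intro h
      fun_prop
    have hf0 : ∀ s, 0 ≤ f s := fun s => by simp only [hf]; positivity
    have hI0 : 0 ≤ I := intervalIntegral.integral_nonneg (by simpa using hpi.le) (fun s _ => hf0 s)
    have hlt := ae_lt_top (μ := μ) (Measurable.tsum hm) (by
      rw [lintegral_tsum (fun h => (hm h).aemeasurable)]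
      have : ∀ h : ℕ, ∫⁻ t, ENNReal.ofReal (((h:ℝ) + 1) ^ (-(1 + δ)) * f (((h:ℝ) + 1) * t)) ∂μ =
          ENNReal.ofReal (((h:ℝ) + 1) ^ (-(1 + δ)) * (2 * m * I)) := by
        intro h
        rw [← ofReal_integral_eq_lintegral_ofReal ((hInt h).const_mul _)
          (ae_of_all _ fun t => mul_nonneg (by positivity) (hf0 _)), integral_const_mul, hval]
      simp only [this]
      exact hsummable.tsum_ofReal_ne_top)
    filter_upwards [hlt] with t ht
    have h5 := ENNReal.summable_toReal ht.ne
    refine h5.congr fun h => ?_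
    rw [ENNReal.toReal_ofReal (mul_nonneg (by positivity) (hf0 _))]
  have h6 := ae_all_iff.mpr fun m => (ae_restrict_iff' measurableSet_Ioc).mp (hloc m)
  filter_upwards [h6] with t ht
  obtain ⟨m, hm⟩ := exists_nat_gt (|t|)
  have h3 := Real.pi_gt_three
  have : |t| < m * Real.pi := by
    have := abs_nonneg t
    nlinarith
  exact ht m ⟨(abs_lt.mp this).1, (abs_lt.mp this).2.le⟩

theorem irr_ae : ∀ᵐ t : ℝ, Irrational (t / Real.pi) := by
  have hc : (Set.range (fun r : ℚ => (r:ℝ) * Real.pi)).Countable := Set.countable_range _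
  filter_upwards [hc.ae_notMem volume] with t ht
  rintro ⟨r, hr⟩
  exact ht ⟨r, by simp only [hr]; field_simp⟩

theorem weyl_ae : ∀ᵐ t : ℝ, ∀ δ : ℝ, 0 < δ → ∃ C > 0, ∀ (N : ℕ) (y : ℝ),
    ‖expSum t N y‖ ≤ C * (N:ℝ) ^ (1 / 2 + δ) := by
  have h1 := ae_all_iff.mpr fun m : ℕ => sin_sum_ae (1 / ((m:ℝ) + 2)) (by positivity) (by
    rw [div_lt_one (by positivity)]; linarith [Nat.cast_nonneg (α := ℝ) m])
  filter_upwards [h1, irr_ae] with t ht hirr δ' hδ'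
  obtain ⟨m, hm⟩ := exists_nat_gt (1 / δ')
  specialize ht m
  set δ : ℝ := 1 / ((m:ℝ) + 2) with hδdef
  have hδ : 0 < δ := by positivity
  have hδ1 : δ < 1 := by
    rw [hδdef, div_lt_one (by positivity)]; linarith [Nat.cast_nonneg (α := ℝ) m]
  have hδδ : δ ≤ δ' := by
    rw [hδdef, div_le_iff₀ (by positivity)]
    rw [div_lt_iff₀ hδ'] at hm
    nlinarith
  have hsin : ∀ h : ℕ, h ≠ 0 → Real.sin (h * t) ≠ 0 := by
    intro h h0 hs
    obtain ⟨n, hn⟩ := Real.sin_eq_zero_iff.mp hs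
    apply hirr
    refine ⟨n / h, ?_⟩
    have : (h:ℝ) ≠ 0 := by exact_mod_cast h0
    push_cast
    rw [div_eq_div_iff this Real.pi_ne_zero, hn]
    ring
  set T := ∑' h : ℕ, ((h:ℝ) + 1) ^ (-(1 + δ)) * |Real.sin (((h:ℝ) + 1) * t)| ^ (-(1 - δ)) with hT
  have hT0 : 0 ≤ T := tsum_nonneg fun h => by positivity
  refine ⟨Real.sqrt (1 + 2 * T), by positivity, fun N y => ?_⟩
  rcases Nat.eq_zero_or_pos N with hN | hN
  · subst hN
    simp only [expSum, Finset.range_zero, Finset.sum_empty, norm_zero]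
    positivity
  have hN1 : (1:ℝ) ≤ N := by exact_mod_cast hN
  have hsum : ∑ h ∈ Finset.range N, (if h = 0 then 0 else |Real.sin (h * t)| ^ (-(1 - δ))) ≤ (N:ℝ) ^ (1 + δ) * T := by
    obtain ⟨M, rfl⟩ : ∃ M, N = M + 1 := ⟨N - 1, by omega⟩
    rw [Finset.sum_range_succ']
    simp only [Nat.add_eq_zero_iff, one_ne_zero, and_false, if_false, if_true, add_zero]
    have h2 := ht.sum_le_tsum (Finset.range M) (fun _ _ => by positivity)
    refine le_trans ?_ (mul_le_mul_of_nonneg_left h2 (by positivity))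
    rw [Finset.mul_sum]
    refine Finset.sum_le_sum fun h hh => ?_
    rw [Finset.mem_range] at hh
    push_cast
    rw [← mul_assoc]
    refine le_mul_of_one_le_left (by positivity) ?_
    rw [Real.rpow_neg (by positivity), ← div_eq_mul_inv, one_le_div (by positivity)]
    have : (h:ℝ) ≤ M := by exact_mod_cast hh.le
    gcongr
  have hsq := expSum_sq t hsin δ hδ hδ1 N y
  have hb : ‖expSum t N y‖ ^ 2 ≤ (1 + 2 * T) * ((N:ℝ) ^ (1 / 2 + δ)) ^ 2 := by
    have e1 : ((N:ℝ) ^ (1 / 2 + δ)) ^ 2 = (N:ℝ) ^ δ * (N:ℝ) ^ (1 + δ) := by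
      rw [← Real.rpow_natCast, ← Real.rpow_mul (by positivity), ← Real.rpow_add (by positivity)]
      congr 1
      push_cast; ring
    have e2 : (N:ℝ) ≤ ((N:ℝ) ^ (1 / 2 + δ)) ^ 2 := by
      rw [← Real.rpow_natCast, ← Real.rpow_mul (by positivity)]
      refine Real.self_le_rpow_of_one_le hN1 ?_
      push_cast; linarith
    have e3 := mul_le_mul_of_nonneg_left hsum (show 0 ≤ (N:ℝ) ^ δ by positivity)
    rw [← mul_assoc, ← e1] at e3
    nlinarith
  have hb2 := Real.le_sqrt_of_sq_le hb
  rw [Real.sqrt_mul (by positivity), Real.sqrt_sq (by positivity)] at hb2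
  refine hb2.trans ?_
  gcongr

theorem expSum_succ (t : ℝ) (N : ℕ) (y : ℝ) : expSum t (N + 1) y = expSum t N y +
    Complex.exp (Complex.I * ((-(t * ((N:ℝ) + 1) ^ 2) + ((N:ℝ) + 1) * y : ℝ) : ℂ)) := by
  unfold expSum
  rw [Finset.sum_range_succ]

theorem expSum_deriv (t : ℝ) (N : ℕ) (y : ℝ) : HasDerivAt (expSum t N)
    (Complex.I * (N * expSum t N y - ∑ M ∈ Finset.range N, expSum t M y)) y := by
  induction N with
  | zero =>
    have : expSum t 0 = fun _ => 0 := by funext y; simp [expSum]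
    rw [this]
    simpa using hasDerivAt_const y (0:ℂ)
  | succ N ih =>
    have h1 : HasDerivAt (fun y : ℝ => Complex.exp (Complex.I * ((-(t * ((N:ℝ) + 1) ^ 2) + ((N:ℝ) + 1) * y : ℝ) : ℂ)))
        (Complex.exp (Complex.I * ((-(t * ((N:ℝ) + 1) ^ 2) + ((N:ℝ) + 1) * y : ℝ) : ℂ)) * (Complex.I * (((N:ℝ) + 1 : ℝ) : ℂ))) y := by
      refine HasDerivAt.cexp ?_
      refine HasDerivAt.const_mul _ ?_
      refine HasDerivAt.ofReal_comp ?_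
      have := (((hasDerivAt_id y).const_mul ((N:ℝ) + 1)).const_add (-(t * ((N:ℝ) + 1) ^ 2)))
      simpa using this
    have h2 := ih.add h1
    have h3 : expSum t (N + 1) = expSum t N + (fun y : ℝ => Complex.exp (Complex.I * ((-(t * ((N:ℝ) + 1) ^ 2) + ((N:ℝ) + 1) * y : ℝ) : ℂ))) := by
      funext y; rw [expSum_succ]; rfl
    rw [h3]
    refine h2.congr_deriv ?_
    rw [Finset.sum_range_succ]
    simp only [Pi.add_apply]
    push_cast
    ring

theorem expSum_cont (t : ℝ) (N : ℕ) : Continuous (expSum t N) :=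
  continuous_iff_continuousAt.mpr fun y => (expSum_deriv t N y).continuousAt

theorem expSum_per (t : ℝ) (N : ℕ) : Function.Periodic (expSum t N) (2 * Real.pi) := by
  intro y
  unfold expSum
  refine Finset.sum_congr rfl fun n _ => ?_
  symm
  rw [← Complex.exp_periodic.int_mul (n + 1 : ℤ)]
  congr 1
  push_cast
  ring

theorem expSum_holder (t C p θ : ℝ) (hC : 0 < C) (hp : 0 < p) (hθ : 0 < θ) (hθ1 : θ < 1)
    (hb : ∀ (N : ℕ) (y : ℝ), ‖expSum t N y‖ ≤ C * (N:ℝ) ^ p) (N : ℕ) (x y : ℝ) :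
    ‖expSum t N x - expSum t N y‖ ≤ 2 * C * (N:ℝ) ^ p * (|x - y| * N) ^ θ := by
  have h1 : ‖expSum t N x - expSum t N y‖ ≤ 2 * C * (N:ℝ) ^ p * (|x - y| * N) := by
    have hd : ∀ z ∈ (Set.univ : Set ℝ), ‖Complex.I * (N * expSum t N z - ∑ M ∈ Finset.range N, expSum t M z)‖ ≤
        2 * C * (N:ℝ) ^ p * N := by
      intro z _
      rw [norm_mul, Complex.norm_I, one_mul]
      refine (norm_sub_le _ _).trans ?_
      rw [norm_mul, Complex.norm_natCast]
      have e1 : (N:ℝ) * ‖expSum t N z‖ ≤ N * (C * (N:ℝ) ^ p) := by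
        gcongr; exact hb N z
      have e2 : ‖∑ M ∈ Finset.range N, expSum t M z‖ ≤ N * (C * (N:ℝ) ^ p) := by
        refine (norm_sum_le _ _).trans ?_
        refine (Finset.sum_le_card_nsmul _ _ (C * (N:ℝ) ^ p) fun M hM => ?_).trans ?_
        · refine (hb M z).trans ?_
          have : (M:ℝ) ≤ N := by exact_mod_cast (Finset.mem_range.mp hM).le
          gcongr
        · simp
      linarith
    have := convex_univ.norm_image_sub_le_of_norm_hasDerivWithin_le
      (fun z _ => (expSum_deriv t N z).hasDerivWithinAt) hd (Set.mem_univ y) (Set.mem_univ x)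
    rw [Real.norm_eq_abs] at this
    linarith
  have h2 : ‖expSum t N x - expSum t N y‖ ≤ 2 * C * (N:ℝ) ^ p := by
    refine (norm_sub_le _ _).trans ?_
    linarith [hb N x, hb N y]
  set a := |x - y| * N with ha
  have ha0 : 0 ≤ a := by positivity
  rcases le_total a 1 with h | h
  · refine h1.trans ?_
    gcongr
    rcases ha0.eq_or_lt with h0 | h0
    · rw [← h0]; positivity
    · calc a = a ^ (1:ℝ) := by simp
        _ ≤ a ^ θ := Real.rpow_le_rpow_of_exponent_ge h0 h hθ1.le
  · refine h2.trans ?_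
    exact le_mul_of_one_le_right (by positivity) (Real.one_le_rpow h hθ.le)

noncomputable def Vp (t : ℝ) (y : ℝ) : ℂ :=
  ∑' N : ℕ, expSum t (N + 1) y / (((N:ℂ) + 1) * ((N:ℂ) + 2))

theorem summ_aux (p : ℝ) (hp : p < 1) : Summable (fun N : ℕ => ((N:ℝ) + 1) ^ p / (((N:ℝ) + 1) * ((N:ℝ) + 2))) := by
  have h1 : Summable (fun N : ℕ => ((N:ℝ) + 1) ^ (p - 2)) := by
    have := (summable_nat_add_iff 1).mpr (Real.summable_nat_rpow.mpr (show p - 2 < -1 by linarith))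
    simpa using this
  refine h1.of_nonneg_of_le (fun N => by positivity) fun N => ?_
  rw [Real.rpow_sub (by positivity), Real.rpow_two, sq]
  gcongr
  linarith

theorem norm_den (N : ℕ) : ‖((N:ℂ) + 1) * ((N:ℂ) + 2)‖ = ((N:ℝ) + 1) * ((N:ℝ) + 2) := by
  have : ((N:ℂ) + 1) * ((N:ℂ) + 2) = ((((N:ℝ) + 1) * ((N:ℝ) + 2) : ℝ) : ℂ) := by push_cast; ring
  rw [this, Complex.norm_real, Real.norm_of_nonneg (by positivity)]

theorem Vp_bound (t C : ℝ) (p : ℝ) (hb : ∀ (N : ℕ) (y : ℝ), ‖expSum t N y‖ ≤ C * (N:ℝ) ^ p) (N : ℕ) (y : ℝ) :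
    ‖expSum t (N + 1) y / (((N:ℂ) + 1) * ((N:ℂ) + 2))‖ ≤ C * (((N:ℝ) + 1) ^ p / (((N:ℝ) + 1) * ((N:ℝ) + 2))) := by
  rw [norm_div, norm_den, ← mul_div_assoc]
  gcongr
  have := hb (N + 1) y
  push_cast at this
  exact this

theorem Vp_hasSum (t : ℝ) (hW : ∀ δ : ℝ, 0 < δ → ∃ C > 0, ∀ (N : ℕ) (y : ℝ),
    ‖expSum t N y‖ ≤ C * (N:ℝ) ^ (1 / 2 + δ)) (y : ℝ) :
    HasSum (fun N : ℕ => expSum t (N + 1) y / (((N:ℂ) + 1) * ((N:ℂ) + 2))) (Vp t y) := by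
  obtain ⟨C, hC, hb⟩ := hW (1/4) (by norm_num)
  refine (Summable.of_norm_bounded ((summ_aux _ ?_).mul_left C) (fun N => Vp_bound t C _ hb N y)).hasSum
  norm_num

theorem Vp_holder (t : ℝ) (hW : ∀ δ : ℝ, 0 < δ → ∃ C > 0, ∀ (N : ℕ) (y : ℝ),
    ‖expSum t N y‖ ≤ C * (N:ℝ) ^ (1 / 2 + δ)) (θ : ℝ) (hθ : 0 < θ) (hθ1 : θ < 1 / 2) :
    ∃ C > 0, ∀ x y, ‖Vp t x - Vp t y‖ ≤ C * |x - y| ^ θ := by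
  obtain ⟨C, hC, hb⟩ := hW ((1/2 - θ) / 2) (by linarith)
  have hs := summ_aux (1 / 2 + (1/2 - θ) / 2 + θ) (by linarith)
  set p := 1 / 2 + (1/2 - θ) / 2 with hp
  set S := ∑' N : ℕ, ((N:ℝ) + 1) ^ (p + θ) / (((N:ℝ) + 1) * ((N:ℝ) + 2)) with hS
  have hS0 : 0 ≤ S := tsum_nonneg fun N => by positivity
  refine ⟨2 * C * S + 1, by positivity, fun x y => ?_⟩
  have h1 := (Vp_hasSum t hW x).sub (Vp_hasSum t hW y)
  have h2 : HasSum (fun N : ℕ => 2 * C * |x - y| ^ θ * (((N:ℝ) + 1) ^ (p + θ) / (((N:ℝ) + 1) * ((N:ℝ) + 2))))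
      (2 * C * |x - y| ^ θ * S) := hs.hasSum.mul_left _
  have h3 : ‖Vp t x - Vp t y‖ ≤ 2 * C * |x - y| ^ θ * S := by
    rw [← h1.tsum_eq]
    refine tsum_of_norm_bounded h2 fun N => ?_
    rw [← sub_div, norm_div, norm_den, ← mul_div_assoc]
    gcongr
    have := expSum_holder t C p θ hC (by linarith) hθ (by linarith) hb (N + 1) x y
    push_cast at this
    refine this.trans (le_of_eq ?_)
    rw [Real.mul_rpow (by positivity) (by positivity), Real.rpow_add (show (0:ℝ) < (N:ℝ) + 1 by positivity) p θ]
    ring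
  refine h3.trans ?_
  have : 0 ≤ |x - y| ^ θ := by positivity
  nlinarith

theorem cont_of_holder (u : ℝ → ℂ) (C θ : ℝ) (hθ : 0 < θ) (h : ∀ x y, ‖u x - u y‖ ≤ C * |x - y| ^ θ) :
    Continuous u := by
  rw [continuous_iff_continuousAt]
  intro y
  rw [ContinuousAt, tendsto_iff_norm_sub_tendsto_zero]
  have h1 : Tendsto (fun x : ℝ => C * |x - y| ^ θ) (nhds y) (nhds 0) := by
    have : Continuous (fun x : ℝ => C * |x - y| ^ θ) := by
      refine continuous_const.mul (Continuous.rpow_const (by fun_prop) fun x => Or.inr hθ.le)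
    have h2 := this.tendsto y
    simpa [Real.zero_rpow hθ.ne'] using h2
  exact squeeze_zero (fun x => norm_nonneg _) (fun x => h x y) h1

theorem Vp_cont (t : ℝ) (hW : ∀ δ : ℝ, 0 < δ → ∃ C > 0, ∀ (N : ℕ) (y : ℝ),
    ‖expSum t N y‖ ≤ C * (N:ℝ) ^ (1 / 2 + δ)) : Continuous (Vp t) := by
  obtain ⟨C, _, h⟩ := Vp_holder t hW (1/4) (by norm_num) (by norm_num)
  exact cont_of_holder _ C _ (by norm_num) h

theorem Vp_per (t : ℝ) : Function.Periodic (Vp t) (2 * Real.pi) := by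
  intro y
  unfold Vp
  simp only [expSum_per t _ y]

theorem exp_coef (k : ℤ) : ∫ x in (0:ℝ)..(2 * Real.pi), Complex.exp (Complex.I * k * x) =
    if k = 0 then (2 * Real.pi : ℂ) else 0 := by
  split_ifs with h
  · simp [h]
  · have hc : Complex.I * (k:ℂ) ≠ 0 := mul_ne_zero Complex.I_ne_zero (by exact_mod_cast h)
    rw [integral_exp_mul_complex hc]
    have : Complex.exp (Complex.I * k * ((2 * Real.pi : ℝ) : ℂ)) = 1 := by
      rw [Complex.exp_eq_one_iff]
      exact ⟨k, by push_cast; ring⟩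
    rw [this]; simp

theorem expSum_coef (t : ℝ) (N : ℕ) (m : ℤ) : fourierCoef (expSum t N) m =
    if 0 < m ∧ m ≤ N then Complex.exp (-Complex.I * t * (m:ℂ) ^ 2) else 0 := by
  have hpi : (2 * Real.pi : ℂ) ≠ 0 := by
    exact_mod_cast Real.two_pi_pos.ne'
  induction N with
  | zero =>
    have : expSum t 0 = fun _ => 0 := by funext y; simp [expSum]
    rw [this, if_neg (by push_cast; omega)]
    simp [fourierCoef]
  | succ N ih =>
    have h1 : fourierCoef (expSum t (N + 1)) m = fourierCoef (expSum t N) m +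
      (1 / (2 * Real.pi)) * (Complex.exp (-Complex.I * t * ((N:ℂ) + 1) ^ 2) *
        ∫ x in (0:ℝ)..(2 * Real.pi), Complex.exp (Complex.I * ((N + 1 - m : ℤ) : ℂ) * x)) := by
      unfold fourierCoef
      rw [← mul_add, ← intervalIntegral.integral_const_mul (Complex.exp (-Complex.I * t * ((N:ℂ) + 1) ^ 2)), ← intervalIntegral.integral_add]
      · congr 1
        refine intervalIntegral.integral_congr fun x _ => ?_
        rw [expSum_succ, mul_add, ← Complex.exp_add, ← Complex.exp_add]
        congr 2
        push_cast
        ring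
      · have := expSum_cont t N
        exact Continuous.intervalIntegrable (by fun_prop) _ _
      · exact Continuous.intervalIntegrable (by fun_prop) _ _
    rw [h1, ih, exp_coef]
    by_cases hm : m = N + 1
    · subst hm
      rw [if_neg (by omega), if_pos (by omega), if_pos (by push_cast; omega)]
      push_cast
      field_simp
      ring
    · rw [if_neg (show ¬ ((N:ℤ) + 1 - m = 0) by omega)]
      have h5 : (0 < m ∧ m ≤ (N:ℤ)) ↔ (0 < m ∧ m ≤ ((N + 1 : ℕ) : ℤ)) := by push_cast; omega
      simp only [mul_zero, add_zero, h5]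

theorem tele (k : ℕ) : HasSum (fun N : ℕ => if k ≤ N then 1 / (((N:ℝ) + 1) * ((N:ℝ) + 2)) else 0) (1 / ((k:ℝ) + 1)) := by
  rw [hasSum_iff_tendsto_nat_of_nonneg (fun N => by split_ifs <;> positivity)]
  have h1 : ∀ M : ℕ, ∑ N ∈ Finset.range (M + k), (if k ≤ N then 1 / (((N:ℝ) + 1) * ((N:ℝ) + 2)) else 0) =
      1 / ((k:ℝ) + 1) - 1 / (((M + k : ℕ) : ℝ) + 1) := by
    intro M
    induction M with
    | zero =>
      rw [zero_add, sub_self]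
      refine Finset.sum_eq_zero fun N hN => if_neg ?_
      rw [Finset.mem_range] at hN; omega
    | succ M ih =>
      rw [show M + 1 + k = (M + k) + 1 by omega, Finset.sum_range_succ, ih, if_pos (by omega)]
      push_cast
      have h1 : (M:ℝ) + k + 1 ≠ 0 := by positivity
      have h2 : (M:ℝ) + k + 2 ≠ 0 := by positivity
      have h3 : (M:ℝ) + k + 1 + 1 ≠ 0 := by positivity
      have h4 : (k:ℝ) + 1 ≠ 0 := by positivity
      field_simp
      ring
  rw [← tendsto_add_atTop_iff_nat k]
  simp only [h1]
  have h2 := (tendsto_add_atTop_iff_nat k).mpr (tendsto_one_div_add_atTop_nhds_zero_nat (𝕜 := ℝ))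
  simpa using h2.const_sub (1 / ((k:ℝ) + 1))

theorem Vp_coef (t : ℝ) (hW : ∀ δ : ℝ, 0 < δ → ∃ C > 0, ∀ (N : ℕ) (y : ℝ),
    ‖expSum t N y‖ ≤ C * (N:ℝ) ^ (1 / 2 + δ)) (m : ℤ) :
    fourierCoef (Vp t) m = if 0 < m then Complex.exp (-Complex.I * t * (m:ℂ) ^ 2) / m else 0 := by
  have hpi : (2 * Real.pi : ℂ) ≠ 0 := by
    exact_mod_cast Real.two_pi_pos.ne'
  have h1 : HasSum (fun N : ℕ => ∫ x in (0:ℝ)..(2 * Real.pi), Complex.exp (-Complex.I * (m:ℂ) * (x:ℂ)) *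
      (expSum t (N + 1) x / (((N:ℂ) + 1) * ((N:ℂ) + 2))))
      (∫ x in (0:ℝ)..(2 * Real.pi), Complex.exp (-Complex.I * (m:ℂ) * (x:ℂ)) * Vp t x) := by
    obtain ⟨C, hC, hb⟩ := hW (1/4) (by norm_num)
    have hsm := (summ_aux (1 / 2 + 1 / 4) (by norm_num)).mul_left C
    refine intervalIntegral.hasSum_integral_of_dominated_convergence
      (fun N _ => C * (((N:ℝ) + 1) ^ (1 / 2 + 1 / 4 : ℝ) / (((N:ℝ) + 1) * ((N:ℝ) + 2)))) ?_ ?_ ?_ ?_ ?_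
    · intro N
      have := expSum_cont t (N + 1)
      exact Continuous.aestronglyMeasurable (by fun_prop)
    · intro N
      refine ae_of_all _ fun x _ => ?_
      rw [norm_mul]
      have : ‖Complex.exp (-Complex.I * (m:ℂ) * (x:ℂ))‖ = 1 := by
        have := Complex.norm_exp_ofReal_mul_I (-(m * x))
        rw [← this]; congr 2; push_cast; ring
      rw [this, one_mul]
      exact Vp_bound t C _ hb N x
    · exact ae_of_all _ fun x _ => hsm
    · exact intervalIntegrable_const
    · exact ae_of_all _ fun x _ => (Vp_hasSum t hW x).mul_left _
  have h2 := h1.mul_left (1 / (2 * Real.pi) : ℂ)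
  have h3 : ∀ N : ℕ, (1 / (2 * Real.pi) : ℂ) * (∫ x in (0:ℝ)..(2 * Real.pi), Complex.exp (-Complex.I * (m:ℂ) * (x:ℂ)) *
      (expSum t (N + 1) x / (((N:ℂ) + 1) * ((N:ℂ) + 2)))) =
      fourierCoef (expSum t (N + 1)) m / (((N:ℂ) + 1) * ((N:ℂ) + 2)) := by
    intro N
    unfold fourierCoef
    rw [mul_div_assoc, ← intervalIntegral.integral_div]
    simp only [mul_div_assoc]
  simp only [h3, expSum_coef] at h2
  have h4 : fourierCoef (Vp t) m = (1 / (2 * Real.pi) : ℂ) * ∫ x in (0:ℝ)..(2 * Real.pi), Complex.exp (-Complex.I * (m:ℂ) * (x:ℂ)) * Vp t x := rfl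
  rw [← h4] at h2
  refine h2.unique ?_
  by_cases hm : 0 < m
  · obtain ⟨k, rfl⟩ : ∃ k : ℕ, m = k + 1 := ⟨(m - 1).toNat, by omega⟩
    rw [if_pos hm]
    have h5 := (Complex.hasSum_ofReal.mpr (tele k)).mul_left (Complex.exp (-Complex.I * t * (((k + 1 : ℤ) : ℂ)) ^ 2))
    convert h5 using 1
    · funext N
      by_cases hk : k ≤ N
      · rw [if_pos (by push_cast; omega), if_pos hk]
        push_cast
        ring
      · rw [if_neg (by push_cast; omega), if_neg hk]
        simp
    · push_cast; ring
  · rw [if_neg hm]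
    simp only [hm, false_and, if_false, zero_div]
    exact hasSum_zero

theorem coef_refl (F : ℝ → ℂ) (hF : Function.Periodic F (2 * Real.pi)) (m : ℤ) :
    fourierCoef (fun y => F (-y)) m = fourierCoef F (-m) := by
  unfold fourierCoef
  congr 1
  have h1 := intervalIntegral.integral_comp_neg (a := 0) (b := 2 * Real.pi)
    (fun x : ℝ => Complex.exp (-Complex.I * ((-m : ℤ) : ℂ) * (x:ℂ)) * F x)
  have h2 : Function.Periodic (fun x : ℝ => Complex.exp (-Complex.I * ((-m : ℤ) : ℂ) * (x:ℂ)) * F x) (2 * Real.pi) := by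
    intro x
    simp only [hF x]
    rw [← Complex.exp_periodic.int_mul m (-Complex.I * ((-m : ℤ) : ℂ) * (x:ℂ))]
    congr 2
    push_cast
    ring
  have h3 := h2.intervalIntegral_add_eq (-(2 * Real.pi)) 0
  rw [neg_add_cancel, zero_add] at h3
  rw [neg_zero, h3] at h1
  rw [← h1]
  refine intervalIntegral.integral_congr fun x _ => ?_
  simp only
  congr 2
  push_cast
  ring

noncomputable def Vf (t : ℝ) (y : ℝ) : ℂ := Vp t y - Vp t (-y)

theorem Vf_cont (t : ℝ) (hW : ∀ δ : ℝ, 0 < δ → ∃ C > 0, ∀ (N : ℕ) (y : ℝ),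
    ‖expSum t N y‖ ≤ C * (N:ℝ) ^ (1 / 2 + δ)) : Continuous (Vf t) := by
  have := Vp_cont t hW
  unfold Vf
  fun_prop

theorem Vf_per (t : ℝ) : Function.Periodic (Vf t) (2 * Real.pi) := by
  intro y
  unfold Vf
  rw [Vp_per t y, neg_add, ← sub_eq_add_neg, (Vp_per t).sub_eq]

theorem Vf_holder (t : ℝ) (hW : ∀ δ : ℝ, 0 < δ → ∃ C > 0, ∀ (N : ℕ) (y : ℝ),
    ‖expSum t N y‖ ≤ C * (N:ℝ) ^ (1 / 2 + δ)) (θ : ℝ) (hθ : 0 < θ) (hθ1 : θ < 1 / 2) :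
    ∃ C > 0, ∀ x y, ‖Vf t x - Vf t y‖ ≤ C * |x - y| ^ θ := by
  obtain ⟨C, hC, h⟩ := Vp_holder t hW θ hθ hθ1
  refine ⟨2 * C, by positivity, fun x y => ?_⟩
  have h1 := h x y
  have h2 := h (-x) (-y)
  rw [show -x - -y = -(x - y) by ring, abs_neg] at h2
  have : Vf t x - Vf t y = (Vp t x - Vp t y) - (Vp t (-x) - Vp t (-y)) := by unfold Vf; ring
  rw [this]
  refine (norm_sub_le _ _).trans ?_
  linarith

theorem Vf_coef (t : ℝ) (hW : ∀ δ : ℝ, 0 < δ → ∃ C > 0, ∀ (N : ℕ) (y : ℝ),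
    ‖expSum t N y‖ ≤ C * (N:ℝ) ^ (1 / 2 + δ)) (m : ℤ) :
    fourierCoef (Vf t) m = Complex.exp (-Complex.I * t * (m:ℂ) ^ 2) / m := by
  have hc := Vp_cont t hW
  have h1 : fourierCoef (Vf t) m = fourierCoef (Vp t) m - fourierCoef (fun y => Vp t (-y)) m := by
    unfold fourierCoef Vf
    rw [← mul_sub, ← intervalIntegral.integral_sub]
    · simp only [mul_sub]
    · exact Continuous.intervalIntegrable (by fun_prop) _ _
    · exact Continuous.intervalIntegrable (by fun_prop) _ _
  rw [h1, coef_refl _ (Vp_per t), Vp_coef t hW, Vp_coef t hW]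
  rcases lt_trichotomy m 0 with h | h | h
  · rw [if_neg (by omega), if_pos (by omega)]
    push_cast
    rw [neg_sq, div_neg]; ring
  · subst h; simp
  · rw [if_pos h, if_neg (by omega)]; simp

theorem ind_int (a b : ℝ) (c : ℂ) (h0 : 0 ≤ a) (hab : a < b) (h2 : b ≤ 2 * Real.pi) (n : ℤ) :
    IntervalIntegrable (fun x : ℝ => Complex.exp (-Complex.I * n * x) * Set.indicator (Set.Ico a b) (fun _ => c) x)
      volume 0 (2 * Real.pi) ∧
    ∫ x in (0:ℝ)..(2 * Real.pi), Complex.exp (-Complex.I * n * x) * Set.indicator (Set.Ico a b) (fun _ => c) x =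
      c * ∫ x in a..b, Complex.exp (-Complex.I * n * x) := by
  have hpi := Real.two_pi_pos
  constructor
  · refine ii_of_bdd _ ?_ ‖c‖ ?_ _ _
    · refine Measurable.mul (by fun_prop) (measurable_const.indicator measurableSet_Ico)
    · intro x
      rw [norm_mul]
      have : ‖Complex.exp (-Complex.I * (n:ℂ) * (x:ℂ))‖ = 1 := by
        have := Complex.norm_exp_ofReal_mul_I (-(n * x))
        rw [← this]; congr 2; push_cast; ring
      rw [this, one_mul]
      exact norm_indicator_le_norm_self (fun _ => c) x
  · have e : (fun x : ℝ => Complex.exp (-Complex.I * n * x) * Set.indicator (Set.Ico a b) (fun _ => c) x) =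
        Set.indicator (Set.Ico a b) (fun x : ℝ => c * Complex.exp (-Complex.I * n * x)) := by
      funext x
      by_cases hx : x ∈ Set.Ico a b
      · simp only [Set.indicator_of_mem hx]; ring
      · simp only [Set.indicator_of_notMem hx]; ring
    rw [e, intervalIntegral.integral_of_le hpi.le, ← integral_Ico_eq_integral_Ioc,
      setIntegral_indicator measurableSet_Ico, Set.inter_eq_right.mpr (Set.Ico_subset_Ico h0 h2),
      integral_Ico_eq_integral_Ioc, ← intervalIntegral.integral_of_le hab.le,
      intervalIntegral.integral_const_mul]

theorem coef_g (L : ℕ) (c : Fin L → ℂ) (a b : Fin L → ℝ) (g : ℝ → ℂ)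
    (hab : ∀ ℓ : Fin L, a ℓ < b ℓ) (h0 : ∀ ℓ : Fin L, 0 ≤ a ℓ) (h2π : ∀ ℓ : Fin L, b ℓ ≤ 2 * Real.pi)
    (hg : ∀ x : ℝ, g x = ∑ ℓ : Fin L, Set.indicator (Set.Ico (a ℓ) (b ℓ)) (fun _ => c ℓ) x)
    (n : ℤ) (hn : n ≠ 0) :
    fourierCoef g n = ∑ ℓ : Fin L, c ℓ / (2 * Real.pi * Complex.I) *
      ((Complex.exp (-Complex.I * n * a ℓ) - Complex.exp (-Complex.I * n * b ℓ)) / n) := by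
  have hn' : (n:ℂ) ≠ 0 := by exact_mod_cast hn
  have hpi : (Real.pi : ℂ) ≠ 0 := by exact_mod_cast Real.pi_ne_zero
  unfold fourierCoef
  simp only [hg, Finset.mul_sum]
  rw [intervalIntegral.integral_finsetSum (fun ℓ _ => (ind_int _ _ (c ℓ) (h0 ℓ) (hab ℓ) (h2π ℓ) n).1), Finset.mul_sum]
  refine Finset.sum_congr rfl fun ℓ _ => ?_
  rw [(ind_int _ _ (c ℓ) (h0 ℓ) (hab ℓ) (h2π ℓ) n).2, integral_exp_mul_complex (mul_ne_zero (neg_ne_zero.mpr Complex.I_ne_zero) hn')]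
  have := Complex.I_ne_zero
  field_simp
  ring

theorem coef_lin (L : ℕ) (k : ℂ) (w : Fin L → ℂ) (F : Fin L → ℝ → ℂ) (hF : ∀ ℓ, Continuous (F ℓ)) (n : ℤ) :
    fourierCoef (fun x => k + ∑ ℓ, w ℓ * F ℓ x) n = (if n = 0 then k else 0) + ∑ ℓ, w ℓ * fourierCoef (F ℓ) n := by
  have hpi : (Real.pi : ℂ) ≠ 0 := by exact_mod_cast Real.pi_ne_zero
  have h1 : ∫ x in (0:ℝ)..(2 * Real.pi), Complex.exp (-Complex.I * n * x) * (k + ∑ ℓ, w ℓ * F ℓ x) =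
      k * (∫ x in (0:ℝ)..(2 * Real.pi), Complex.exp (Complex.I * ((-n : ℤ) : ℂ) * x)) +
        ∑ ℓ, w ℓ * ∫ x in (0:ℝ)..(2 * Real.pi), Complex.exp (-Complex.I * n * x) * F ℓ x := by
    simp only [← intervalIntegral.integral_const_mul]
    rw [← intervalIntegral.integral_finsetSum, ← intervalIntegral.integral_add]
    · refine intervalIntegral.integral_congr fun x _ => ?_
      simp only [mul_add, Finset.mul_sum]
      congr 1
      · push_cast; rw [mul_comm]; congr 2; ring
      · refine Finset.sum_congr rfl fun ℓ _ => by ring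
    · exact Continuous.intervalIntegrable (by fun_prop) _ _
    · exact Continuous.intervalIntegrable (by fun_prop) _ _
    · intro ℓ _
      have := hF ℓ
      exact Continuous.intervalIntegrable (by fun_prop) _ _
  unfold fourierCoef
  rw [h1, exp_coef, mul_add, Finset.mul_sum]
  congr 1
  · by_cases h : n = 0
    · rw [if_pos (by omega), if_pos h]; field_simp
    · rw [if_neg (by omega), if_neg h]; simp
  · refine Finset.sum_congr rfl fun ℓ _ => by ring

theorem density_fractal_dimension
    (L : ℕ) (hL : 0 < L) (c : Fin L → ℂ) (a b : Fin L → ℝ) (g : ℝ → ℂ)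
    (hab : ∀ ℓ : Fin L, a ℓ < b ℓ)
    (h0 : ∀ ℓ : Fin L, 0 ≤ a ℓ)
    (h2π : ∀ ℓ : Fin L, b ℓ ≤ 2 * Real.pi)
    (hord : ∀ ℓ : Fin L, ∀ hℓ : (ℓ : ℕ) + 1 < L, b ℓ ≤ a ⟨(ℓ : ℕ) + 1, hℓ⟩)
    (hrat : ∀ ℓ : Fin L, (∃ r : ℚ, a ℓ = (r : ℝ) * Real.pi) ∧
      ∃ r : ℚ, b ℓ = (r : ℝ) * Real.pi)
    (hg : ∀ x : ℝ, g x = ∑ ℓ : Fin L, Set.indicator (Set.Ico (a ℓ) (b ℓ)) (fun _ => c ℓ) x)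
    (hnc : ¬ ∃ z : ℂ, ∀ x ∈ Set.Ico (0 : ℝ) (2 * Real.pi), g x = z) :
    ∀ᵐ t : ℝ, ∃ u : ℝ → ℂ, Continuous u ∧ Function.Periodic u (2 * Real.pi) ∧
      (∀ n : ℤ, fourierCoef u n =
        Complex.exp (-Complex.I * (t : ℂ) * (n : ℂ) ^ 2) * fourierCoef g n) ∧
      upperMinkowskiDim (graphOn (fun x => ‖u x‖ ^ 2)) = 3 / 2 ∧
      upperMinkowskiDim (graphOn (fun x => ‖u x‖)) = 3 / 2 := by
  have hpi := Real.pi_pos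
  obtain ⟨q, hq, D, hD, hgD⟩ := step_repr L c a b g hrat hg
  have hq' : (0:ℝ) < q := by exact_mod_cast hq
  have hncD : ∑ j ∈ Finset.range q, ((starRingEnd ℂ) (D j) * D j - (starRingEnd ℂ) (D (j + 1)) * D j) ≠ 0 := by
    intro hz
    have hcst := grid_nonconst q D hD hz
    refine hnc ⟨D 0, fun x hx => ?_⟩
    rw [hgD x hx]
    unfold gridFun
    have hw : 0 < 2 * Real.pi / q := by positivity
    have e1 : 0 ≤ ⌊x / (2 * Real.pi / q)⌋ := Int.floor_nonneg.mpr (div_nonneg hx.1 hw.le)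
    have e2 : ⌊x / (2 * Real.pi / q)⌋ < q := by
      rw [Int.floor_lt]
      rw [div_lt_iff₀ hw]
      push_cast
      rw [mul_div_cancel₀ _ hq'.ne']
      exact hx.2
    obtain ⟨j, hj⟩ := Int.eq_ofNat_of_zero_le e1
    rw [hj] at e2 ⊢
    exact hcst j (by omega)
  have hgc : ∀ n, fourierCoef g n = fourierCoef (gridFun q D) n := by
    intro n
    unfold fourierCoef
    congr 1
    rw [intervalIntegral.integral_of_le (by positivity), intervalIntegral.integral_of_le (by positivity),
      ← integral_Ico_eq_integral_Ioc, ← integral_Ico_eq_integral_Ioc]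
    refine setIntegral_congr_fun measurableSet_Ico fun x hx => ?_
    simp only [hgD x hx]
  filter_upwards [weyl_ae, irr_ae] with t hW ht
  set w : Fin L → ℂ := fun ℓ => c ℓ / (2 * Real.pi * Complex.I) with hw
  set F : Fin L → ℝ → ℂ := fun ℓ x => Vf t (x + -a ℓ) - Vf t (x + -b ℓ) with hF
  set u : ℝ → ℂ := fun x => fourierCoef g 0 + ∑ ℓ, w ℓ * F ℓ x with hu
  have hVc := Vf_cont t hW
  have hVp := Vf_per t
  have hFc : ∀ ℓ, Continuous (F ℓ) := fun ℓ => by simp only [hF]; fun_prop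
  have huc : Continuous u := by
    simp only [hu]; fun_prop
  have hup : Function.Periodic u (2 * Real.pi) := by
    intro x
    simp only [hu, hF]
    congr 1
    refine Finset.sum_congr rfl fun ℓ _ => ?_
    rw [show x + 2 * Real.pi + -a ℓ = (x + -a ℓ) + 2 * Real.pi by ring,
      show x + 2 * Real.pi + -b ℓ = (x + -b ℓ) + 2 * Real.pi by ring, hVp, hVp]
  have hFcoef : ∀ ℓ n, fourierCoef (F ℓ) n = (Complex.exp (-Complex.I * n * a ℓ) - Complex.exp (-Complex.I * n * b ℓ)) *
      (Complex.exp (-Complex.I * t * (n:ℂ) ^ 2) / n) := by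
    intro ℓ n
    have h1 : fourierCoef (F ℓ) n = fourierCoef (fun x => Vf t (x + -a ℓ)) n - fourierCoef (fun x => Vf t (x + -b ℓ)) n := by
      simp only [hF]
      unfold fourierCoef
      rw [← mul_sub, ← intervalIntegral.integral_sub]
      · simp only [mul_sub]
      · exact Continuous.intervalIntegrable (by fun_prop) _ _
      · exact Continuous.intervalIntegrable (by fun_prop) _ _
    rw [h1, coef_shift _ hVp, coef_shift _ hVp, Vf_coef t hW, ← sub_mul]
    congr 3 <;> (push_cast; ring)
  have hcoef : ∀ n : ℤ, fourierCoef u n =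
        Complex.exp (-Complex.I * (t : ℂ) * (n : ℂ) ^ 2) * fourierCoef g n := by
    intro n
    rw [hu, coef_lin L _ w F hFc]
    by_cases hn : n = 0
    · subst hn
      simp [hFcoef]
    · rw [if_neg hn, zero_add, coef_g L c a b g hab h0 h2π hg n hn, Finset.mul_sum]
      refine Finset.sum_congr rfl fun ℓ _ => ?_
      rw [hFcoef]
      ring
  have hH : ∀ θ : ℝ, 0 < θ → θ < 1 / 2 → ∃ C > 0, ∀ x y, ‖u x - u y‖ ≤ C * |x - y| ^ θ := by
    intro θ h1 h2
    obtain ⟨C, hC, h⟩ := Vf_holder t hW θ h1 h2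
    refine ⟨∑ ℓ, ‖w ℓ‖ * (2 * C) + 1, by positivity, fun x y => ?_⟩
    have e1 : u x - u y = ∑ ℓ, w ℓ * ((Vf t (x + -a ℓ) - Vf t (y + -a ℓ)) - (Vf t (x + -b ℓ) - Vf t (y + -b ℓ))) := by
      simp only [hu, hF]
      rw [add_sub_add_left_eq_sub, ← Finset.sum_sub_distrib]
      refine Finset.sum_congr rfl fun ℓ _ => by ring
    rw [e1, add_mul, Finset.sum_mul]
    have e3 : 0 ≤ |x - y| ^ θ := by positivity
    refine le_trans (norm_sum_le _ _) (le_trans (Finset.sum_le_sum fun ℓ _ => ?_) (le_add_of_nonneg_right (by positivity)))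
    rw [norm_mul, mul_assoc]
    refine mul_le_mul_of_nonneg_left ?_ (norm_nonneg _)
    refine (norm_sub_le _ _).trans ?_
    have f1 := h (x + -a ℓ) (y + -a ℓ)
    have f2 := h (x + -b ℓ) (y + -b ℓ)
    rw [add_sub_add_right_eq_sub] at f1 f2
    linarith
  refine ⟨u, huc, hup, hcoef, ?_⟩
  exact final_of_u t ht q hq D hD hncD u huc hup hH (fun n => by rw [hcoef, hgc])
end

section
/- Fix an integer k ≥ 2. For almost every t ∈ ℝ the following holds: for every ε > 0 there is a constant C = C(t,k,ε) such that for every integer N ≥ 1, sup_{x∈ℝ} |Σ_{n=1}^{N} e^{itn^k + inx}| ≤ C N^{1 − 2^{1−k} + ε}. -/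
open Finset MeasureTheory

local instance instTwoPiPos' : Fact (0 < 2 * Real.pi) := Fact.mk Real.two_pi_pos

noncomputable def wS (f : Polynomial ℝ) (L : ℕ) : ℂ :=
  ∑ n ∈ Finset.range L, Complex.exp (Complex.I * ((f.eval (n : ℝ) : ℝ) : ℂ))

lemma vdc_eq (z : ℕ → ℂ) (hz : ∀ n, ‖z n‖ = 1) (L : ℕ) :
    ‖∑ n ∈ range L, z n‖ ^ 2 = L + 2 * (∑ h ∈ range L, ∑ n ∈ range (L - 1 - h),
      z (n + (h + 1)) * starRingEnd ℂ (z n)).re := by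
  induction L with
  | zero => simp
  | succ L ih =>
    have key : ∑ h ∈ range (L + 1), ∑ n ∈ range (L + 1 - 1 - h),
      z (n + (h + 1)) * starRingEnd ℂ (z n) = (∑ h ∈ range L, ∑ n ∈ range (L - 1 - h),
      z (n + (h + 1)) * starRingEnd ℂ (z n)) + z L * starRingEnd ℂ (∑ n ∈ range L, z n) := by
      rw [sum_range_succ]
      simp only [Nat.add_sub_cancel, Nat.sub_self, range_zero, sum_empty, add_zero]
      rw [map_sum, mul_sum, ← sum_range_reflect (fun n => z L * starRingEnd ℂ (z n)) L,
        ← sum_add_distrib]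
      refine sum_congr rfl fun h hh => ?_
      have hh := mem_range.1 hh
      have e1 : L - h = (L - 1 - h) + 1 := by omega
      have e2 : L - 1 - h + (h + 1) = L := by omega
      rw [e1, sum_range_succ, e2]
    rw [key, sum_range_succ, Complex.add_re, mul_add, ← add_assoc]
    push_cast
    have : ‖∑ n ∈ range L, z n + z L‖ ^ 2 = ‖∑ n ∈ range L, z n‖ ^ 2 + 1
        + 2 * (z L * starRingEnd ℂ (∑ n ∈ range L, z n)).re := by
      have h1 : ‖z L‖ ^ 2 = 1 := by rw [hz]; norm_num
      rw [← h1, Complex.sq_norm, Complex.sq_norm, Complex.sq_norm, Complex.normSq_add]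
      rw [← Complex.conj_re (z L * _)]
      simp [mul_comm]
    rw [this, ih]; ring

lemma poly_diff (f : Polynomial ℝ) (j : ℕ) (hf : f.natDegree ≤ j + 1) (h : ℝ) :
    (Polynomial.taylor h f - f).natDegree ≤ j ∧
    (Polynomial.taylor h f - f).coeff j = (j + 1) * h * f.coeff (j + 1) := by
  have hh : ∀ n, j ≤ n → (Polynomial.taylor h f).coeff n = f.coeff n +
      (n + 1) * h * f.coeff (n + 1) := by
    intro n hn
    rw [Polynomial.taylor_coeff]
    have hd : (Polynomial.hasseDeriv n f).natDegree < 2 := by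
      have := Polynomial.natDegree_hasseDeriv_le f n
      omega
    rw [Polynomial.eval_eq_sum_range' hd, sum_range_succ, sum_range_succ]
    simp [Polynomial.hasseDeriv_coeff]
    have : (1 + n).choose n = n + 1 := by rw [add_comm]; exact Nat.choose_succ_self_right n
    rw [this, add_comm 1 n]; push_cast; ring
  constructor
  · rw [Polynomial.natDegree_le_iff_coeff_eq_zero]
    intro n hn
    have : f.coeff (n + 1) = 0 := Polynomial.coeff_eq_zero_of_natDegree_lt (by omega)
    rw [Polynomial.coeff_sub, hh n hn.le, this]; ring
  · rw [Polynomial.coeff_sub, hh j le_rfl]; ring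

lemma wS_sq (f : Polynomial ℝ) (L N : ℕ) (hL : L ≤ N) :
    ‖wS f L‖ₑ ^ 2 ≤ N + 2 * ∑ h ∈ range N,
      ‖wS (Polynomial.taylor ((h + 1 : ℕ) : ℝ) f - f) (L - 1 - h)‖ₑ := by
  have h1 : ‖wS f L‖ ^ 2 ≤ N + 2 * ∑ h ∈ range N,
      ‖wS (Polynomial.taylor ((h + 1 : ℕ) : ℝ) f - f) (L - 1 - h)‖ := by
    unfold wS
    rw [vdc_eq _ (fun n => by rw [mul_comm]; exact Complex.norm_exp_ofReal_mul_I _)]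
    have hLN : (L : ℝ) ≤ N := by exact_mod_cast hL
    gcongr
    refine (Complex.re_le_norm _).trans ((norm_sum_le _ _).trans ?_)
    refine (sum_le_sum_of_subset_of_nonneg (range_mono hL) (fun _ _ _ => norm_nonneg _)).trans ?_
    refine sum_le_sum fun h _ => le_of_eq ?_
    congr 1
    refine sum_congr rfl fun n _ => ?_
    rw [← Complex.exp_conj, ← Complex.exp_add]
    congr 1
    rw [Polynomial.eval_sub, Polynomial.taylor_eval]
    simp
    ring
  have := ENNReal.ofReal_le_ofReal h1
  rw [ENNReal.ofReal_add (by positivity) (by positivity), ENNReal.ofReal_mul (by norm_num),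
    ENNReal.ofReal_sum_of_nonneg (fun _ _ => norm_nonneg _), ENNReal.ofReal_pow (norm_nonneg _)] at this
  simpa using this

lemma exp_sub_lower (β : ℝ) : 2 * (‖(β : AddCircle (2 * Real.pi))‖ / Real.pi) ≤
    ‖Complex.exp (Complex.I * β) - 1‖ := by
  have hpi := Real.pi_pos
  obtain ⟨b, hb, hbb⟩ : ∃ b : ℝ, |b| ≤ Real.pi ∧ ∃ m : ℤ, β = b + m * (2 * Real.pi) := by
    refine ⟨β - round ((2 * Real.pi)⁻¹ * β) * (2 * Real.pi), ?_, round ((2 * Real.pi)⁻¹ * β), by ring⟩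
    rw [← AddCircle.norm_eq]
    refine (AddCircle.norm_le_half_period _ (by positivity)).trans (le_of_eq ?_)
    rw [abs_of_pos (by positivity)]; ring
  obtain ⟨m, rfl⟩ := hbb
  have e1 : ((b + m * (2 * Real.pi) : ℝ) : AddCircle (2 * Real.pi)) = (b : AddCircle (2 * Real.pi)) := by
    rw [AddCircle.coe_add, ← zsmul_eq_mul, AddCircle.coe_zsmul, AddCircle.coe_period, smul_zero,
      add_zero]
  have e2 : Complex.exp (Complex.I * ((b + m * (2 * Real.pi) : ℝ) : ℂ)) =
      Complex.exp (Complex.I * b) := by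
    have : Complex.I * ((b + m * (2 * Real.pi) : ℝ) : ℂ) =
      Complex.I * b + m * (2 * Real.pi * Complex.I) := by push_cast; ring
    rw [this, Complex.exp_add, Complex.exp_int_mul_two_pi_mul_I, mul_one]
  rw [e1, e2, Complex.norm_exp_I_mul_ofReal_sub_one,
    (AddCircle.norm_coe_eq_abs_iff _ (by positivity)).2
      (by rw [abs_of_pos (by positivity : 0 < 2 * Real.pi)]; linarith)]
  have h2 : |b / 2| ≤ Real.pi / 2 := by rw [abs_div, abs_two]; linarith
  have h3 := Real.mul_abs_le_abs_sin h2
  rw [norm_mul, Real.norm_eq_abs, Real.norm_eq_abs, abs_two]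
  rw [abs_div, abs_two] at h3
  have : 2 / Real.pi * (|b| / 2) = |b| / Real.pi := by field_simp
  linarith

noncomputable def G0 (r : ℝ) (b : AddCircle (2 * Real.pi)) : ENNReal :=
  (ENNReal.ofReal (‖b‖ / Real.pi)) ^ (-r)

lemma G0_meas (r : ℝ) : Measurable (G0 r) := by
  unfold G0
  have : Measurable fun b : AddCircle (2 * Real.pi) => ‖b‖ := continuous_norm.measurable
  fun_prop

lemma G0_int (r : ℝ) (hr : r < 1) : ∫⁻ b, G0 r b ≠ ⊤ := by
  have hpi := Real.pi_pos
  rw [← (AddCircle.measurePreserving_mk (2 * Real.pi) (-Real.pi)).lintegral_comp (G0_meas r)]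
  have hI : IntegrableOn (fun x : ℝ => (|x| / Real.pi) ^ (-r))
      (Set.Ioc (-Real.pi) (-Real.pi + 2 * Real.pi)) := by
    rw [← intervalIntegrable_iff_integrableOn_Ioc_of_le (by linarith)]
    refine intervalIntegrable_of_even (fun x => by rw [abs_neg]) (fun x hx => ?_)
    have := (intervalIntegral.intervalIntegrable_rpow' (a := 0) (b := x) (r := -r)
      (by linarith)).div_const (Real.pi ^ (-r))
    refine this.congr ?_
    intro y hy
    rw [Set.uIoc_of_le hx.le] at hy
    simp only
    rw [abs_of_pos hy.1, Real.div_rpow hy.1.le hpi.le]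
  have h2 := hI.lintegral_lt_top
  refine ne_of_lt (lt_of_le_of_lt (le_of_eq ?_) h2)
  apply lintegral_congr_ae
  have h0 : ∀ᵐ x : ℝ ∂(volume.restrict (Set.Ioc (-Real.pi) (-Real.pi + 2 * Real.pi))), x ≠ 0 :=
    ae_restrict_of_ae (by simp [ae_iff])
  filter_upwards [h0, ae_restrict_mem measurableSet_Ioc] with x hx hx2
  unfold G0
  have hx3 : |x| ≤ Real.pi := abs_le.2 ⟨by linarith [hx2.1], by linarith [hx2.2]⟩
  rw [(AddCircle.norm_coe_eq_abs_iff _ (by positivity)).2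
      (by rw [abs_of_pos (by positivity : 0 < 2 * Real.pi)]; linarith),
      ENNReal.ofReal_rpow_of_pos (by positivity)]

lemma wS_le (f : Polynomial ℝ) (L : ℕ) : ‖wS f L‖ ≤ L := by
  unfold wS
  refine (norm_sum_le _ _).trans ?_
  simp [mul_comm Complex.I, Complex.norm_exp_ofReal_mul_I]

lemma wS_lin (f : Polynomial ℝ) (hf : f.natDegree ≤ 1) (L : ℕ) :
    ‖wS f L‖ * (‖(f.coeff 1 : AddCircle (2 * Real.pi))‖ / Real.pi) ≤ 1 := by
  have h1 := exp_sub_lower (f.coeff 1)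
  have h2 : ‖wS f L‖ * ‖Complex.exp (Complex.I * (f.coeff 1 : ℝ)) - 1‖ ≤ 2 := by
    have e : wS f L = Complex.exp (Complex.I * (f.coeff 0 : ℝ)) *
        ∑ n ∈ range L, Complex.exp (Complex.I * (f.coeff 1 : ℝ)) ^ n := by
      unfold wS
      rw [mul_sum]
      refine sum_congr rfl fun n _ => ?_
      rw [← Complex.exp_nat_mul, ← Complex.exp_add,
        Polynomial.eval_eq_sum_range' (Nat.lt_succ_of_le hf), sum_range_succ, sum_range_succ]
      congr 1
      simp
      ring
    rw [e, ← norm_mul, mul_assoc, geom_sum_mul, norm_mul, mul_comm Complex.I,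
      Complex.norm_exp_ofReal_mul_I, one_mul]
    refine (norm_sub_le _ _).trans ?_
    rw [norm_pow, mul_comm Complex.I, Complex.norm_exp_ofReal_mul_I]
    norm_num
  have := mul_le_mul_of_nonneg_left h1 (norm_nonneg (wS f L))
  linarith

def P (j : ℕ) : Prop := ∀ δ : ℝ, 0 < δ → ∃ G : AddCircle (2 * Real.pi) → ENNReal,
  Measurable G ∧ ∫⁻ b, G b ≠ ⊤ ∧ ∀ f : Polynomial ℝ, f.natDegree ≤ j + 1 →
    ∀ N L : ℕ, 1 ≤ N → L ≤ N →
      ‖wS f L‖ₑ ^ ((2 : ℝ) ^ j) ≤ (N : ENNReal) ^ ((2 : ℝ) ^ j - 1 + δ) *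
        G (f.coeff (j + 1) : AddCircle (2 * Real.pi))

lemma P_zero : P 0 := by
  intro δ' hδ'
  obtain ⟨δ, hδ, hδ1, hle⟩ : ∃ δ : ℝ, 0 < δ ∧ δ ≤ 1 ∧ δ ≤ δ' :=
    ⟨min δ' 1, lt_min hδ' one_pos, min_le_right _ _, min_le_left _ _⟩
  refine ⟨G0 (1 - δ), G0_meas _, G0_int _ (by linarith), fun f hf N L hN hL => ?_⟩
  have hN1 : (1 : ENNReal) ≤ N := by exact_mod_cast hN
  simp only [pow_zero, ENNReal.rpow_one, sub_self, zero_add] at *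
  refine le_trans ?_ (mul_le_mul_left (ENNReal.rpow_le_rpow_of_exponent_le hN1 hle) _)
  have e : ‖wS f L‖ₑ = ‖wS f L‖ₑ ^ δ * ‖wS f L‖ₑ ^ (1 - δ) := by
    rw [← ENNReal.rpow_add_of_nonneg _ _ hδ.le (by linarith)]; simp
  rw [e]
  have h1 : ‖wS f L‖ₑ ≤ N := by
    rw [← ofReal_norm, ← ENNReal.ofReal_natCast]
    exact ENNReal.ofReal_le_ofReal ((wS_le f L).trans (by exact_mod_cast hL))
  have h2 : ‖wS f L‖ₑ ≤ (ENNReal.ofReal (‖(f.coeff 1 : AddCircle (2 * Real.pi))‖ / Real.pi))⁻¹ := by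
    rw [ENNReal.le_inv_iff_mul_le, ← ofReal_norm, ← ENNReal.ofReal_mul (norm_nonneg _)]
    exact ENNReal.ofReal_le_one.2 (wS_lin f hf L)
  unfold G0
  rw [ENNReal.rpow_neg, ← ENNReal.inv_rpow]
  exact mul_le_mul' (ENNReal.rpow_le_rpow h1 hδ.le) (ENNReal.rpow_le_rpow h2 (by linarith))

lemma P_succ (j : ℕ) (hP : P j) : P (j + 1) := by
  intro δ' hδ'
  obtain ⟨δ, hδ, hδe⟩ : ∃ δ : ℝ, 0 < δ ∧ δ' = δ + δ := ⟨δ' / 2, by linarith, by ring⟩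
  subst hδe
  obtain ⟨G, hGm, hGi, hG⟩ := hP δ hδ
  set q : ℝ := (2 : ℝ) ^ j with hq
  have hq1 : 1 ≤ q := one_le_pow₀ (by norm_num)
  have hmp : ∀ h : ℕ, MeasurePreserving (fun b : AddCircle (2 * Real.pi) =>
      (((j + 2) * (h + 1) : ℕ) : ℤ) • b) := fun h => Measure.measurePreserving_zsmul volume (by positivity)
  set c : ℕ → ENNReal := fun h => ((h + 1 : ℕ) : ENNReal) ^ (-(1 + δ)) with hc
  set T : AddCircle (2 * Real.pi) → ENNReal := fun b =>
    ∑' h : ℕ, c h * G ((((j + 2) * (h + 1) : ℕ) : ℤ) • b) with hT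
  have hTm : Measurable T := by
    refine Measurable.tsum fun h => ?_
    exact (hGm.comp (hmp h).measurable).const_mul _
  have hcs : ∑' h, c h ≠ ⊤ := by
    have h1 : Summable fun h : ℕ => 1 / (((h + 1 : ℕ) : ℝ)) ^ (1 + δ) :=
      (summable_nat_add_iff 1).2 (Real.summable_one_div_nat_rpow.2 (by linarith))
    have h2 := h1.tsum_ofReal_ne_top
    convert h2 using 3 with h
    rw [hc]
    simp only
    rw [one_div, ← Real.rpow_neg (by positivity), ← ENNReal.ofReal_rpow_of_pos (by positivity),
      ENNReal.ofReal_natCast]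
  have hTi : ∫⁻ b, T b ≠ ⊤ := by
    have : ∫⁻ b, T b = (∑' h, c h) * ∫⁻ b, G b := by
      rw [hT]
      simp only
      have hm : ∀ h : ℕ, AEMeasurable (fun b => c h * G ((((j + 2) * (h + 1) : ℕ) : ℤ) • b)) :=
        fun h => ((hGm.comp (hmp h).measurable).const_mul _).aemeasurable
      rw [lintegral_tsum hm, ← ENNReal.tsum_mul_right]
      refine tsum_congr fun h => ?_
      have hm1 : Measurable (fun b => G ((((j + 2) * (h + 1) : ℕ) : ℤ) • b)) :=
        hGm.comp (hmp h).measurable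
      rw [lintegral_const_mul _ hm1, (hmp h).lintegral_comp hGm]
    rw [this]
    exact ENNReal.mul_ne_top hcs hGi
  refine ⟨fun b => 2 ^ (q - 1) * (1 + 2 ^ q * T b), by fun_prop, ?_, ?_⟩
  · rw [lintegral_const_mul _ (by fun_prop), lintegral_add_left (by fun_prop),
      lintegral_const_mul _ hTm]
    refine ENNReal.mul_ne_top (by finiteness) (ENNReal.add_ne_top.2 ⟨?_, ENNReal.mul_ne_top (by finiteness) hTi⟩)
    rw [lintegral_const]
    finiteness
  intro f hf N L hN hL
  have hN1 : (1 : ENNReal) ≤ N := by exact_mod_cast hN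
  have hN0 : (N : ENNReal) ≠ 0 := (zero_lt_one.trans_le hN1).ne'
  have hNt : (N : ENNReal) ≠ ⊤ := ENNReal.natCast_ne_top N
  set b : AddCircle (2 * Real.pi) := (f.coeff (j + 1 + 1) : AddCircle (2 * Real.pi)) with hb
  have hS : ∀ h ∈ range N, ‖wS (Polynomial.taylor ((h + 1 : ℕ) : ℝ) f - f) (L - 1 - h)‖ₑ ^ q ≤
      (N : ENNReal) ^ (q - 1 + δ) * ((N : ENNReal) ^ (1 + δ) *
        (c h * G ((((j + 2) * (h + 1) : ℕ) : ℤ) • b))) := by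
    intro h hh
    obtain ⟨p1, p2⟩ := poly_diff f (j + 1) hf ((h + 1 : ℕ) : ℝ)
    refine (hG _ p1 N (L - 1 - h) hN (by omega)).trans ?_
    have e : (((Polynomial.taylor ((h + 1 : ℕ) : ℝ) f - f).coeff (j + 1) : ℝ) :
        AddCircle (2 * Real.pi)) = (((j + 2) * (h + 1) : ℕ) : ℤ) • b := by
      rw [p2, hb, ← AddCircle.coe_zsmul, zsmul_eq_mul]
      congr 1
      push_cast; ring
    rw [e, ← mul_assoc (_ ^ (1 + δ))]
    gcongr
    refine le_mul_of_one_le_left (zero_le) ?_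
    have hh' : ((h + 1 : ℕ) : ENNReal) ≤ N := by exact_mod_cast mem_range.1 hh
    rw [hc]
    simp only
    rw [ENNReal.rpow_neg, ← div_eq_mul_inv, ENNReal.le_div_iff_mul_le (by simp) (by simp), one_mul]
    exact ENNReal.rpow_le_rpow hh' (by linarith)
  have hsum : ∑ h ∈ range N, ‖wS (Polynomial.taylor ((h + 1 : ℕ) : ℝ) f - f) (L - 1 - h)‖ₑ ^ q ≤
      (N : ENNReal) ^ (q - 1 + δ) * ((N : ENNReal) ^ (1 + δ) * T b) := by
    refine (sum_le_sum hS).trans ?_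
    rw [← mul_sum, ← mul_sum]
    gcongr
    exact ENNReal.sum_le_tsum _
  have hexp : (2 : ℝ) ^ (j + 1) = 2 * q := by rw [pow_succ, hq]; ring
  rw [hexp, ENNReal.rpow_mul]
  calc (‖wS f L‖ₑ ^ (2 : ℝ)) ^ q
      ≤ (N + 2 * ∑ h ∈ range N,
      ‖wS (Polynomial.taylor ((h + 1 : ℕ) : ℝ) f - f) (L - 1 - h)‖ₑ) ^ q := by
        refine ENNReal.rpow_le_rpow ?_ (by linarith)
        have := wS_sq f L N hL
        rwa [← ENNReal.rpow_natCast] at this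
    _ ≤ 2 ^ (q - 1) * ((N : ENNReal) ^ q + (2 * ∑ h ∈ range N,
      ‖wS (Polynomial.taylor ((h + 1 : ℕ) : ℝ) f - f) (L - 1 - h)‖ₑ) ^ q) :=
        ENNReal.rpow_add_le_mul_rpow_add_rpow _ _ hq1
    _ ≤ 2 ^ (q - 1) * ((N : ENNReal) ^ (2 * q - 1 + (δ + δ)) + 2 ^ q * ((N : ENNReal) ^ (q - 1) *
          ((N : ENNReal) ^ (q - 1 + δ) * ((N : ENNReal) ^ (1 + δ) * T b)))) := by
        rw [ENNReal.mul_rpow_of_nonneg _ _ (by linarith : 0 ≤ q)]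
        gcongr
        · linarith
        · refine (ENNReal.rpow_sum_le_const_mul_sum_rpow _ _ hq1).trans ?_
          rw [card_range]
          gcongr
    _ = _ := by
        have : (N : ENNReal) ^ (2 * q - 1 + (δ + δ)) = (N : ENNReal) ^ (q - 1) *
          ((N : ENNReal) ^ (q - 1 + δ) * (N : ENNReal) ^ (1 + δ)) := by
          rw [← ENNReal.rpow_add _ _ hN0 hNt, ← ENNReal.rpow_add _ _ hN0 hNt]
          congr 1; ring
        rw [this]; ring

lemma P_all (j : ℕ) : P j := by
  induction j with
  | zero => exact P_zero
  | succ j ih => exact P_succ j ih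

lemma ae_real {p : AddCircle (2 * Real.pi) → Prop} (h : ∀ᵐ b, p b) :
    ∀ᵐ t : ℝ, p (t : AddCircle (2 * Real.pi)) := by
  have h1 : ∀ n : ℤ, ∀ᵐ t : ℝ ∂volume.restrict (Set.Ioc (n • (2 * Real.pi))
      (n • (2 * Real.pi) + 2 * Real.pi)), p (t : AddCircle (2 * Real.pi)) := fun n =>
    (AddCircle.measurePreserving_mk (2 * Real.pi) _).quasiMeasurePreserving.ae h
  have h2 := (ae_restrict_iUnion_iff (μ := (volume : Measure ℝ)) _
    (fun t : ℝ => p (t : AddCircle (2 * Real.pi)))).2 h1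
  have h3 : (⋃ n : ℤ, Set.Ioc (n • (2 * Real.pi)) (n • (2 * Real.pi) + 2 * Real.pi)) = Set.univ := by
    have := iUnion_Ioc_zsmul Real.two_pi_pos
    simpa [add_smul, add_mul] using this
  rwa [h3, Measure.restrict_univ] at h2

/-- For almost every `t`: for every `ε > 0` there is `C = C(t,k,ε)` with
`sup_x |Σ_{n=1}^N e^{itn^k + inx}| ≤ C N^{1 - 2^{1-k} + ε}` for all `N ≥ 1`. -/
theorem weyl_sum_higher_ae (k : ℕ) (hk : 2 ≤ k) :
    ∀ᵐ t : ℝ, ∀ ε : ℝ, 0 < ε → ∃ C : ℝ, ∀ N : ℕ, 1 ≤ N → ∀ x : ℝ,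
      ‖∑ n ∈ Finset.Icc 1 N,
          Complex.exp (Complex.I * ((n : ℂ) * (x : ℂ) + (t : ℂ) * (n : ℂ) ^ k))‖ ≤
        C * (N : ℝ) ^ ((1 : ℝ) - (2 : ℝ) ^ ((1 : ℤ) - (k : ℤ)) + ε) := by
  obtain ⟨j, rfl⟩ : ∃ j, k = j + 1 := ⟨k - 1, by omega⟩
  have hj : 1 ≤ j := by omega
  have hP := fun m : ℕ => P_all j (1 / ((m : ℝ) + 1)) (by positivity)
  choose G hGm hGi hG using hP
  have hae : ∀ᵐ b : AddCircle (2 * Real.pi), ∀ m, G m b < ⊤ :=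
    ae_all_iff.2 fun m => ae_lt_top (hGm m) (hGi m)
  filter_upwards [ae_real hae] with t ht ε hε
  obtain ⟨m, hm⟩ := exists_nat_one_div_lt hε
  set q : ℝ := (2 : ℝ) ^ j with hq
  have hq1 : 1 ≤ q := one_le_pow₀ (by norm_num)
  have hq0 : 0 < q := by linarith
  refine ⟨(G m t).toReal ^ (1 / q), fun N hN x => ?_⟩
  have hN1 : (1 : ℝ) ≤ N := by exact_mod_cast hN
  let f : Polynomial ℝ := Polynomial.taylor 1 (Polynomial.C x * Polynomial.X +
    Polynomial.C t * Polynomial.X ^ (j + 1))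
  have hg1 : (Polynomial.C x * Polynomial.X +
    Polynomial.C t * Polynomial.X ^ (j + 1)).natDegree ≤ j + 1 := by
    refine Polynomial.natDegree_add_le_of_degree_le ?_ (Polynomial.natDegree_C_mul_X_pow_le _ _)
    exact (Polynomial.natDegree_C_mul_le x _).trans (Polynomial.natDegree_X_le.trans (by omega))
  have hf1 : f.natDegree ≤ j + 1 := by rw [Polynomial.natDegree_taylor]; exact hg1
  have hf2 : f.coeff (j + 1) = t := by
    have := (poly_diff _ (j + 1) (hg1.trans (Nat.le_succ _)) 1).2
    rw [Polynomial.coeff_sub, Polynomial.coeff_eq_zero_of_natDegree_lt (n := j + 1 + 1)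
      (lt_of_le_of_lt hg1 (Nat.lt_succ_self _)), mul_zero, sub_eq_zero] at this
    rw [show f.coeff (j + 1) = _ from this]
    simp only [Polynomial.coeff_add, Polynomial.coeff_C_mul, Polynomial.coeff_X_pow_self,
      Polynomial.coeff_X_of_ne_one (by omega : j + 1 ≠ 1), mul_zero, zero_add, mul_one]
  have hsum : ∑ n ∈ Finset.Icc 1 N,
      Complex.exp (Complex.I * ((n : ℂ) * (x : ℂ) + (t : ℂ) * (n : ℂ) ^ (j + 1))) = wS f N := by
    unfold wS
    rw [← Finset.Ico_add_one_right_eq_Icc, Finset.sum_Ico_eq_sum_range]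
    refine sum_congr rfl fun n _ => ?_
    rw [Polynomial.taylor_eval]
    congr 1
    simp
    ring
  rw [hsum]
  have hb := hG m f hf1 N N hN le_rfl
  rw [hf2] at hb
  have hb2 := ENNReal.toReal_mono (ENNReal.mul_ne_top (by finiteness) (ht m).ne) hb
  rw [ENNReal.toReal_mul, ← ENNReal.toReal_rpow, ← ENNReal.toReal_rpow, toReal_enorm,
    ENNReal.toReal_natCast] at hb2
  have hb3 := Real.rpow_le_rpow (by positivity) hb2 (by positivity : 0 ≤ 1 / q)
  rw [← Real.rpow_mul (norm_nonneg _), mul_one_div_cancel hq0.ne', Real.rpow_one,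
    Real.mul_rpow (by positivity) (by positivity), ← Real.rpow_mul (by positivity)] at hb3
  refine hb3.trans ?_
  rw [mul_comm]
  gcongr
  have hz : (2 : ℝ) ^ ((1 : ℤ) - ((j + 1 : ℕ) : ℤ)) = 1 / q := by
    rw [show (1 : ℤ) - ((j + 1 : ℕ) : ℤ) = -(j : ℤ) by push_cast; ring, zpow_neg, zpow_natCast,
      one_div]
  rw [hz]
  have : 1 / ((m : ℝ) + 1) * (1 / q) ≤ 1 / ((m : ℝ) + 1) :=
    mul_le_of_le_one_right (by positivity) (by rw [div_le_one hq0]; exact hq1)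
  have e : (q - 1 + 1 / ((m : ℝ) + 1)) * (1 / q) = 1 - 1 / q + 1 / ((m : ℝ) + 1) * (1 / q) := by
    field_simp
  rw [e]; linarith
end

section
/- Fix an integer k ≥ 3 and let g: T → ℂ have bounded variation. Then for almost every t ∈ ℝ, the L²(T) function e^{it(−i∂ₓ)^k}g has a representative which is α-Hölder continuous for every exponent 0 < α < 2^{1−k} (with Hölder constant depending on g, t, k and α). -/
open MeasureTheory

open scoped ENNReal

abbrev Circ := AddCircle (2 * Real.pi)

instance instFactTwoPi : Fact (0 < 2 * Real.pi) := ⟨Real.two_pi_pos⟩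

noncomputable def ee (a : Circ) : ℂ := (AddCircle.toCircle a : ℂ)

lemma ee_coe (x : ℝ) : ee (x : Circ) = Complex.exp (Complex.I * x) := by
  unfold ee
  rw [AddCircle.toCircle_apply_mk]
  rw [div_self Real.two_pi_pos.ne', one_mul, Circle.coe_exp, mul_comm]

lemma ee_add (a b : Circ) : ee (a + b) = ee a * ee b := by
  simp [ee, AddCircle.toCircle_add]

lemma ee_nsmul (n : ℕ) (a : Circ) : ee (n • a) = ee a ^ n := by
  simp [ee, AddCircle.toCircle_nsmul]

lemma ee_norm (a : Circ) : ‖ee a‖ = 1 := Circle.norm_coe _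

lemma ee_sub (a b : Circ) : ee (a - b) = ee a * (starRingEnd ℂ) (ee b) := by
  rw [sub_eq_add_neg, ee_add]
  congr 1
  rw [ee, AddCircle.toCircle_neg, Circle.coe_inv_eq_conj]; rfl

def WPoly : ℕ → Circ → (ℕ → Circ) → Prop
  | 0, c, p => ∀ n, p n = c
  | j + 1, c, p => ∀ h : ℕ, WPoly j (h • c) (fun n => p (n + h) - p n)

lemma WPoly.add : ∀ {j : ℕ} {c d : Circ} {p q : ℕ → Circ}, WPoly j c p → WPoly j d q →
    WPoly j (c + d) (fun n => p n + q n)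
  | 0, c, d, p, q, hp, hq => fun n => by simp only [hp n, hq n]
  | j + 1, c, d, p, q, hp, hq => fun h => by
      have := (hp h).add (hq h)
      rw [nsmul_add]
      convert this using 2
      exact add_sub_add_comm _ _ _ _

lemma WPoly.zero : ∀ {j : ℕ}, WPoly j 0 (fun _ => 0)
  | 0 => fun n => rfl
  | j + 1 => fun h => by
      simp only [smul_zero, sub_self]
      exact WPoly.zero

lemma WPoly.sum {ι : Type*} (s : Finset ι) {j : ℕ} (c : ι → Circ) (p : ι → ℕ → Circ)
    (h : ∀ i ∈ s, WPoly j (c i) (p i)) :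
    WPoly j (∑ i ∈ s, c i) (fun n => ∑ i ∈ s, p i n) := by
  classical
  induction s using Finset.induction_on with
  | empty => simpa using WPoly.zero
  | insert a s ha ih =>
    simp only [Finset.sum_insert ha]
    exact (h a (Finset.mem_insert_self _ _)).add
      (ih (fun i hi => h i (Finset.mem_insert_of_mem hi)))

lemma wPoly_pow (a : ℝ) : ∀ (j m : ℕ) (r : ℝ), m ≤ j →
    WPoly j (((if m = j then (j.factorial : ℝ) * r else 0 : ℝ)) : Circ)
      (fun n => ((r * ((n : ℝ) + a) ^ m : ℝ) : Circ))
  | 0, m, r, hm => by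
      intro n
      obtain rfl : m = 0 := by omega
      simp
  | j + 1, m, r, hm => by
      intro h
      have key := WPoly.sum (Finset.range m) (j := j)
        (fun i => (((if i = j then (j.factorial : ℝ) * (r * (m.choose i) * (h : ℝ) ^ (m - i))
          else 0 : ℝ)) : Circ))
        (fun i n => (((r * (m.choose i) * (h : ℝ) ^ (m - i)) * ((n : ℝ) + a) ^ i : ℝ) : Circ))
        (fun i hi => wPoly_pow a j i _ (by have := Finset.mem_range.1 hi; omega))
      convert key using 1
      · rw [← AddCircle.coe_nsmul]
        rw [← QuotientAddGroup.mk_sum]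
        congr 1
        rcases Nat.lt_or_ge m (j + 1) with h1 | h1
        · rw [if_neg (by omega), Finset.sum_eq_zero]
          · simp
          · intro i hi
            rw [if_neg]
            have := Finset.mem_range.1 hi; omega
        · obtain rfl : m = j + 1 := by omega
          rw [if_pos rfl, Finset.sum_ite_eq']
          simp [Nat.factorial_succ]
          ring
      · funext n
        rw [← QuotientAddGroup.mk_sum, ← AddCircle.coe_sub]
        congr 1
        push_cast
        rw [show (n : ℝ) + h + a = ((n : ℝ) + a) + h by ring, add_pow, Finset.sum_range_succ]
        simp only [Nat.choose_self, Nat.sub_self, pow_zero, mul_one, Nat.cast_one]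
        rw [mul_add, add_sub_cancel_right, Finset.mul_sum]
        exact Finset.sum_congr rfl (fun i _ => by ring)

lemma weyl_step (f : ℕ → ℂ) (L : ℕ) : ‖∑ n ∈ Finset.range L, f n‖ ^ 2 =
    ∑ n ∈ Finset.range L, ‖f n‖ ^ 2 + 2 * (∑ i ∈ Finset.range L,
      ∑ n ∈ Finset.range (L - (i + 1)), f (n + (i + 1)) * (starRingEnd ℂ) (f n)).re := by
  induction L with
  | zero => simp
  | succ L ih =>
    have h1 : ∑ i ∈ Finset.range (L + 1),
      ∑ n ∈ Finset.range (L + 1 - (i + 1)), f (n + (i + 1)) * (starRingEnd ℂ) (f n) =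
      (∑ i ∈ Finset.range L,
      ∑ n ∈ Finset.range (L - (i + 1)), f (n + (i + 1)) * (starRingEnd ℂ) (f n)) +
      f L * (starRingEnd ℂ) (∑ n ∈ Finset.range L, f n) := by
      rw [Finset.sum_range_succ]
      simp only [Nat.sub_self, Finset.range_zero, Finset.sum_empty, add_zero]
      rw [map_sum, Finset.mul_sum, ← Finset.sum_range_reflect (fun n => f L * (starRingEnd ℂ) (f n)),
        ← Finset.sum_add_distrib]
      refine Finset.sum_congr rfl (fun i hi => ?_)
      have hi := Finset.mem_range.1 hi
      rw [show L + 1 - (i + 1) = (L - (i + 1)) + 1 by omega, Finset.sum_range_succ]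
      rw [show L - (i + 1) + (i + 1) = L by omega, show L - 1 - i = L - (i + 1) by omega]
    rw [h1, Finset.sum_range_succ, Finset.sum_range_succ, Complex.add_re]
    have h2 : ∀ z w : ℂ, ‖z + w‖ ^ 2 = ‖z‖ ^ 2 + ‖w‖ ^ 2 + 2 * (w * (starRingEnd ℂ) z).re := by
      intro z w
      rw [← Complex.normSq_eq_norm_sq, ← Complex.normSq_eq_norm_sq, ← Complex.normSq_eq_norm_sq,
        Complex.normSq_add]
      simp
      ring
    rw [h2, ih]
    ring

lemma weyl_ineq (f : ℕ → ℂ) (hf : ∀ n, ‖f n‖ = 1) {L N : ℕ} (hL : L ≤ N) :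
    ‖∑ n ∈ Finset.range L, f n‖ₑ ^ 2 ≤ N + 2 * ∑ i ∈ Finset.range N,
      ‖∑ n ∈ Finset.range (L - (i + 1)), f (n + (i + 1)) * (starRingEnd ℂ) (f n)‖ₑ := by
  have h : ‖∑ n ∈ Finset.range L, f n‖ ^ 2 ≤ N + 2 * ∑ i ∈ Finset.range N,
      ‖∑ n ∈ Finset.range (L - (i + 1)), f (n + (i + 1)) * (starRingEnd ℂ) (f n)‖ := by
    rw [weyl_step]
    refine add_le_add ?_ (mul_le_mul_of_nonneg_left ?_ (by norm_num))
    · simp [hf]; exact hL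
    · refine (Complex.re_le_norm _).trans ((norm_sum_le _ _).trans ?_)
      exact Finset.sum_le_sum_of_subset_of_nonneg (by simpa using hL)
        (fun _ _ _ => norm_nonneg _)
  have := ENNReal.ofReal_le_ofReal h
  rw [ENNReal.ofReal_pow (norm_nonneg _), ENNReal.ofReal_add (by positivity) (by positivity),
    ENNReal.ofReal_mul (by norm_num), ENNReal.ofReal_sum_of_nonneg (fun _ _ => norm_nonneg _)] at this
  simpa [ofReal_norm] using this


lemma geom_bound (c : Circ) (p : ℕ → Circ) (hp : WPoly 1 c p) (L : ℕ) :
    ‖∑ n ∈ Finset.range L, ee (p n)‖ₑ ≤ 2 / ‖ee c - 1‖ₑ := by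
  have hn : ∀ n, ee (p n) = ee (p 0) * ee c ^ n := by
    intro n
    have := hp n 0
    simp only [zero_add] at this
    rw [← ee_nsmul, ← ee_add, ← this]
    congr 1; abel
  rw [Finset.sum_congr rfl (fun n _ => hn n), ← Finset.mul_sum, enorm_mul, ← ofReal_norm (ee (p 0)), ee_norm, ENNReal.ofReal_one, one_mul]
  by_cases h : ee c = 1
  · rw [h, sub_self, enorm_zero, ENNReal.div_zero (by norm_num)]; exact le_top
  · have h' : ‖ee c - 1‖ₑ ≠ 0 := by simpa [sub_eq_zero] using h
    rw [ENNReal.le_div_iff_mul_le (Or.inl h') (Or.inl (by simp)), ← enorm_mul, geom_sum_mul]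
    have : ‖ee c ^ L - 1‖ ≤ 2 := by
      refine (norm_sub_le _ _).trans ?_
      rw [norm_pow, ee_norm]; norm_num
    rw [← ofReal_norm]
    exact (ENNReal.ofReal_le_ofReal this).trans (by simp)

noncomputable def DD (ε : ℝ) : ℕ → ℕ → Circ → ℝ≥0∞
  | 0, N, c => (N : ℝ≥0∞) ^ ε * (2 / ‖ee c - 1‖ₑ) ^ (1 - ε)
  | j + 1, N, c => 2 ^ (2 ^ j) * ((N : ℝ≥0∞) ^ (2 ^ j) + 2 ^ (2 ^ j) * ((N : ℝ≥0∞) ^ (2 ^ j - 1) *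
      ∑ i ∈ Finset.range N, DD ε j N ((i + 1) • c)))

lemma ee_continuous : Continuous ee :=
  continuous_subtype_val.comp AddCircle.continuous_toCircle

lemma DD_meas (ε : ℝ) (j N : ℕ) : Measurable (DD ε j N) := by
  induction j with
  | zero =>
    have : Measurable ee := ee_continuous.measurable
    change Measurable (fun c => (N : ℝ≥0∞) ^ ε * (2 / ‖ee c - 1‖ₑ) ^ (1 - ε))
    fun_prop
  | succ j ih =>
    have h : ∀ i : ℕ, Measurable (fun c => DD ε j N ((i + 1) • c)) := fun i =>
      ih.comp (continuous_nsmul (i + 1)).measurable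
    change Measurable (fun c => 2 ^ (2 ^ j) * ((N : ℝ≥0∞) ^ (2 ^ j) +
      2 ^ (2 ^ j) * ((N : ℝ≥0∞) ^ (2 ^ j - 1) *
      ∑ i ∈ Finset.range N, DD ε j N ((i + 1) • c))))
    fun_prop

lemma ennreal_pow_sum (s : Finset ℕ) (f : ℕ → ℝ≥0∞) {p : ℕ} (hp : 1 ≤ p) :
    (∑ i ∈ s, f i) ^ p ≤ (s.card : ℝ≥0∞) ^ (p - 1) * ∑ i ∈ s, f i ^ p := by
  have := ENNReal.rpow_sum_le_const_mul_sum_rpow s f (p := (p : ℝ)) (by exact_mod_cast hp)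
  have h2 : (p : ℝ) - 1 = ((p - 1 : ℕ) : ℝ) := by push_cast [hp]; ring
  rw [h2] at this
  simpa only [ENNReal.rpow_natCast] using this

lemma ennreal_pow_add (a b : ℝ≥0∞) (p : ℕ) : (a + b) ^ p ≤ 2 ^ p * (a ^ p + b ^ p) := by
  rcases le_total a b with h | h
  · calc (a + b) ^ p ≤ (2 * b) ^ p := by gcongr; rw [two_mul]; gcongr
      _ = 2 ^ p * b ^ p := mul_pow _ _ _
      _ ≤ _ := by gcongr; exact le_add_self
  · calc (a + b) ^ p ≤ (2 * a) ^ p := by gcongr; rw [two_mul]; gcongr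
      _ = 2 ^ p * a ^ p := mul_pow _ _ _
      _ ≤ _ := by gcongr; exact le_self_add

lemma weyl_bound {ε : ℝ} (h0 : 0 < ε) (h1 : ε < 1) (N : ℕ) : ∀ (j : ℕ) (c : Circ) (p : ℕ → Circ),
    WPoly (j + 1) c p → ∀ L ≤ N, ‖∑ n ∈ Finset.range L, ee (p n)‖ₑ ^ (2 ^ j) ≤ DD ε j N c
  | 0, c, p, hp, L, hL => by
    set S := ‖∑ n ∈ Finset.range L, ee (p n)‖ₑ with hS
    have hS1 : S ≤ N := by
      have h : ‖∑ n ∈ Finset.range L, ee (p n)‖ ≤ N := by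
        refine (norm_sum_le _ _).trans ?_
        simp [ee_norm]; exact hL
      rw [hS, ← ofReal_norm]
      simpa using ENNReal.ofReal_le_ofReal h
    have hS2 := geom_bound c p hp L
    rw [← hS] at hS2
    have : S = S ^ ε * S ^ (1 - ε) := by
      rw [← ENNReal.rpow_add_of_nonneg _ _ h0.le (by linarith)]
      simp
    rw [pow_zero, pow_one, this]
    unfold DD
    gcongr
  | j + 1, c, p, hp, L, hL => by
    have h := weyl_ineq (fun n => ee (p n)) (fun n => ee_norm _) hL
    rw [pow_succ' 2 j, pow_mul]
    refine (pow_le_pow_left' h _).trans ((ennreal_pow_add _ _ _).trans ?_)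
    rw [mul_pow]
    conv_rhs => unfold DD
    gcongr
    refine (ennreal_pow_sum _ _ Nat.one_le_two_pow).trans ?_
    rw [Finset.card_range]
    gcongr with i hi
    have := weyl_bound h0 h1 N j _ _ (hp (i + 1)) (L - (i + 1)) (by omega)
    simpa only [ee_sub] using this


lemma abs_rpow_int {r : ℝ} (hr : -1 < r) :
    IntervalIntegrable (fun x : ℝ => |x| ^ r) volume (-Real.pi) Real.pi := by
  have h1 : IntervalIntegrable (fun x : ℝ => |x| ^ r) volume 0 Real.pi := by
    refine (intervalIntegral.intervalIntegrable_rpow' hr).congr ?_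
    intro x hx
    rw [Set.uIoc_of_le Real.pi_pos.le] at hx
    simp only [abs_of_pos hx.1]
  have h2 : IntervalIntegrable (fun x : ℝ => |x| ^ r) volume (-Real.pi) 0 := by
    have := ((IntervalIntegrable.iff_comp_neg (by simp)).1 h1).symm
    simpa using this
  exact h2.trans h1

lemma base_fin {ε : ℝ} (h0 : 0 < ε) (h1 : ε < 1) :
    ∫⁻ c : Circ, (2 / ‖ee c - 1‖ₑ) ^ (1 - ε) < ⊤ := by
  rw [← AddCircle.lintegral_preimage (2 * Real.pi) (-Real.pi)]
  have hi := abs_rpow_int (r := -(1 - ε)) (by linarith)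
  rw [intervalIntegrable_iff, Set.uIoc_of_le (by linarith [Real.pi_pos])] at hi
  have hi2 := (hi.const_mul (Real.pi ^ (1 - ε))).hasFiniteIntegral
  rw [show -Real.pi + 2 * Real.pi = Real.pi by ring]
  refine lt_of_le_of_lt ?_ hi2
  refine lintegral_mono_ae ?_
  have hne : ∀ᵐ x : ℝ ∂(volume.restrict (Set.Ioc (-Real.pi) Real.pi)), x ≠ 0 :=
    ae_restrict_of_ae (Measure.ae_ne volume 0)
  filter_upwards [hne, ae_restrict_mem measurableSet_Ioc] with x hx hx2
  have hb : 2 / Real.pi * |x| ≤ ‖ee (x : Circ) - 1‖ := by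
    rw [ee_coe, Complex.norm_exp_I_mul_ofReal_sub_one]
    have := Real.mul_abs_le_abs_sin (x := x / 2) (by
      rw [abs_le]; constructor <;> linarith [hx2.1, hx2.2])
    rw [norm_mul, Real.norm_eq_abs, Real.norm_eq_abs]
    rw [abs_div] at this
    norm_num at this ⊢
    calc 2 / Real.pi * |x| = 2 * (|x| / Real.pi) := by ring
      _ ≤ _ := by linarith
  have hxp : 0 < |x| := abs_pos.2 hx
  have hpos : 0 < 2 / Real.pi * |x| := by have := Real.pi_pos; positivity
  have h3 : 2 / ‖ee (x : Circ) - 1‖ₑ ≤ ENNReal.ofReal (Real.pi / |x|) := by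
    rw [← ofReal_norm, show (2 : ℝ≥0∞) = ENNReal.ofReal 2 by simp,
      ← ENNReal.ofReal_div_of_pos (hpos.trans_le hb)]
    apply ENNReal.ofReal_le_ofReal
    calc 2 / ‖ee (x : Circ) - 1‖ ≤ 2 / (2 / Real.pi * |x|) := by gcongr
      _ = Real.pi / |x| := by field_simp
  refine (ENNReal.rpow_le_rpow h3 (by linarith)).trans ?_
  rw [ENNReal.ofReal_rpow_of_pos (by have := Real.pi_pos; positivity)]
  rw [← ofReal_norm]
  apply ENNReal.ofReal_le_ofReal
  refine le_trans (le_of_eq ?_) (Real.le_norm_self _)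
  rw [Real.div_rpow Real.pi_pos.le hxp.le, Real.rpow_neg hxp.le, div_eq_mul_inv]

lemma nsmul_mp (i : ℕ) : MeasurePreserving (fun c : Circ => (i + 1) • c) volume volume := by
  have := MeasureTheory.Measure.measurePreserving_zsmul (volume : Measure Circ) (n := ((i + 1 : ℕ) : ℤ)) (by positivity)
  simpa only [natCast_zsmul] using this

lemma DD_int {ε : ℝ} (h0 : 0 < ε) (h1 : ε < 1) (j : ℕ) : ∃ C : ℝ≥0∞, C ≠ ⊤ ∧ ∀ N : ℕ, 1 ≤ N →
    ∫⁻ c, DD ε j N c ≤ C * (N : ℝ≥0∞) ^ ((2 : ℝ) ^ j - 1 + ε) := by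
  induction j with
  | zero =>
    refine ⟨_, (base_fin h0 h1).ne, fun N hN => ?_⟩
    have : ∫⁻ c, DD ε 0 N c = (N : ℝ≥0∞) ^ ε * ∫⁻ c : Circ, (2 / ‖ee c - 1‖ₑ) ^ (1 - ε) := by
      rw [← lintegral_const_mul]
      · rfl
      · have : Measurable ee := ee_continuous.measurable
        fun_prop
    rw [this, mul_comm]
    simp
  | succ j ih =>
    obtain ⟨C, hC, ih⟩ := ih
    refine ⟨2 ^ (2 ^ j) * (volume (Set.univ : Set Circ) + 2 ^ (2 ^ j) * C), ?_, fun N hN => ?_⟩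
    · have : volume (Set.univ : Set Circ) ≠ ⊤ := measure_ne_top _ _
      finiteness
    have hm : ∀ i : ℕ, Measurable (fun c => DD ε j N ((i + 1) • c)) := fun i =>
      (DD_meas ε j N).comp (continuous_nsmul (i + 1)).measurable
    have e1 : ∫⁻ c, DD ε (j + 1) N c = 2 ^ (2 ^ j) * ((N : ℝ≥0∞) ^ (2 ^ j) * 
        volume (Set.univ : Set Circ) + 2 ^ (2 ^ j) * ((N : ℝ≥0∞) ^ (2 ^ j - 1) *
        (N * ∫⁻ c, DD ε j N c))) := by
      change ∫⁻ c, 2 ^ (2 ^ j) * ((N : ℝ≥0∞) ^ (2 ^ j) +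
        2 ^ (2 ^ j) * ((N : ℝ≥0∞) ^ (2 ^ j - 1) *
        ∑ i ∈ Finset.range N, DD ε j N ((i + 1) • c))) = _
      rw [lintegral_const_mul _ (by fun_prop), lintegral_add_left (by fun_prop),
        lintegral_const_mul _ (by fun_prop), lintegral_const_mul _ (by fun_prop),
        lintegral_finsetSum _ (fun i _ => hm i), lintegral_const]
      congr 4
      rw [Finset.sum_congr rfl (fun i _ => (nsmul_mp i).lintegral_comp (DD_meas ε j N))]
      simp
    rw [e1]
    have hN1 : (1 : ℝ≥0∞) ≤ N := by exact_mod_cast hN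
    have hN0 : (N : ℝ≥0∞) ≠ 0 := by positivity
    have hNt : (N : ℝ≥0∞) ≠ ⊤ := by simp
    have h2j : (1 : ℝ) ≤ 2 ^ j := one_le_pow₀ (by norm_num)
    have e2 : (N : ℝ≥0∞) ^ (2 ^ j) ≤ (N : ℝ≥0∞) ^ ((2 : ℝ) ^ (j + 1) - 1 + ε) := by
      rw [← ENNReal.rpow_natCast]
      apply ENNReal.rpow_le_rpow_of_exponent_le hN1
      push_cast; rw [pow_succ]; linarith
    have e3 : (N : ℝ≥0∞) ^ (2 ^ j - 1) * (N * (N : ℝ≥0∞) ^ ((2 : ℝ) ^ j - 1 + ε)) =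
        (N : ℝ≥0∞) ^ ((2 : ℝ) ^ (j + 1) - 1 + ε) := by
      rw [← mul_assoc, ← pow_succ, Nat.sub_add_cancel Nat.one_le_two_pow, ← ENNReal.rpow_natCast,
        ← ENNReal.rpow_add _ _ hN0 hNt]
      congr 1
      push_cast; rw [pow_succ]; ring
    set Y := (N : ℝ≥0∞) ^ ((2 : ℝ) ^ (j + 1) - 1 + ε) with hY
    have e4 : (N : ℝ≥0∞) ^ (2 ^ j - 1) * (N * ∫⁻ c, DD ε j N c) ≤ C * Y := by
      calc (N : ℝ≥0∞) ^ (2 ^ j - 1) * (N * ∫⁻ c, DD ε j N c) ≤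
          (N : ℝ≥0∞) ^ (2 ^ j - 1) * (N * (C * (N : ℝ≥0∞) ^ ((2 : ℝ) ^ j - 1 + ε))) := by
            gcongr; exact ih N hN
        _ = C * ((N : ℝ≥0∞) ^ (2 ^ j - 1) * (N * (N : ℝ≥0∞) ^ ((2 : ℝ) ^ j - 1 + ε))) := by ring
        _ = _ := by rw [e3]
    calc _ ≤ 2 ^ (2 ^ j) * (Y * volume (Set.univ : Set Circ) + 2 ^ (2 ^ j) * (C * Y)) := by
          gcongr
      _ = _ := by ring

lemma DD_ae {ε : ℝ} (h0 : 0 < ε) (h1 : ε < 1) (j : ℕ) : ∀ᵐ c : Circ, ∃ C : ℝ, 0 ≤ C ∧ ∀ ν : ℕ,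
    DD ε j (2 ^ ν) c ≤ ENNReal.ofReal (C * (2 : ℝ) ^ (ν * ((2 : ℝ) ^ j - 1 + 2 * ε))) := by
  obtain ⟨C, hC, hD⟩ := DD_int h0 h1 j
  set b : ℝ := (2 : ℝ) ^ j - 1 with hb
  have hfin : ∫⁻ c, ∑' ν : ℕ, (2 : ℝ≥0∞) ^ (-(ν * (b + 2 * ε))) * DD ε j (2 ^ ν) c ≠ ⊤ := by
    rw [lintegral_tsum (fun ν => ((DD_meas ε j _).const_mul _).aemeasurable)]
    have : ∀ ν : ℕ, ∫⁻ c, (2 : ℝ≥0∞) ^ (-(ν * (b + 2 * ε))) * DD ε j (2 ^ ν) c ≤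
        C * ((2 : ℝ≥0∞) ^ (-ε)) ^ ν := by
      intro ν
      rw [lintegral_const_mul _ (DD_meas ε j _)]
      calc _ ≤ (2 : ℝ≥0∞) ^ (-(ν * (b + 2 * ε))) * (C * ((2 ^ ν : ℕ) : ℝ≥0∞) ^ (b + ε)) := by
            gcongr; exact hD _ Nat.one_le_two_pow
        _ = C * ((2 : ℝ≥0∞) ^ (-(ν * (b + 2 * ε))) * ((2 : ℝ≥0∞) ^ (ν * (b + ε)))) := by
            push_cast
            rw [ENNReal.rpow_mul, ENNReal.rpow_natCast]; ring
        _ = _ := by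
            rw [← ENNReal.rpow_add _ _ (by norm_num) (by norm_num), ← ENNReal.rpow_natCast,
              ← ENNReal.rpow_mul]
            congr 2; ring
    refine ne_top_of_le_ne_top ?_ (ENNReal.tsum_le_tsum this)
    rw [ENNReal.tsum_mul_left, ENNReal.tsum_geometric]
    refine ENNReal.mul_ne_top hC (ENNReal.inv_ne_top.2 ?_)
    rw [ne_eq, tsub_eq_zero_iff_le, not_le]
    exact ENNReal.rpow_lt_one_of_one_lt_of_neg (by norm_num) (by linarith)
  have hmeas : Measurable (fun c => ∑' ν : ℕ, (2 : ℝ≥0∞) ^ (-(ν * (b + 2 * ε))) * DD ε j (2 ^ ν) c) :=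
    Measurable.tsum (fun ν => (DD_meas ε j _).const_mul _)
  filter_upwards [ae_lt_top hmeas hfin] with c hc
  refine ⟨(∑' ν : ℕ, (2 : ℝ≥0∞) ^ (-(ν * (b + 2 * ε))) * DD ε j (2 ^ ν) c).toReal,
    ENNReal.toReal_nonneg, fun ν => ?_⟩
  have h := ENNReal.le_tsum (f := fun ν : ℕ => (2 : ℝ≥0∞) ^ (-(ν * (b + 2 * ε))) * DD ε j (2 ^ ν) c) ν
  rw [ENNReal.ofReal_mul ENNReal.toReal_nonneg, ENNReal.ofReal_toReal hc.ne,
    ← ENNReal.ofReal_rpow_of_pos (by norm_num)]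
  rw [show ENNReal.ofReal 2 = 2 by simp]
  calc DD ε j (2 ^ ν) c = ((2 : ℝ≥0∞) ^ (-(ν * (b + 2 * ε))) * DD ε j (2 ^ ν) c) *
        (2 : ℝ≥0∞) ^ (ν * (b + 2 * ε)) := by
        rw [mul_right_comm, ← ENNReal.rpow_add _ _ (by norm_num) (by norm_num)]
        simp
    _ ≤ _ := by gcongr


lemma ae_real_of_circ {P : Circ → Prop} (h : ∀ᵐ c, P c) : ∀ᵐ t : ℝ, P (t : Circ) := by
  have h1 : ∀ n : ℤ, ∀ᵐ t : ℝ ∂(volume.restrict (Set.Ioc (0 + n • (2 * Real.pi))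
      (0 + (n + 1) • (2 * Real.pi)))), P (t : Circ) := by
    intro n
    have := (AddCircle.measurePreserving_mk (2 * Real.pi)
      (0 + n • (2 * Real.pi))).quasiMeasurePreserving.ae h
    rwa [show (0 : ℝ) + (n + 1) • (2 * Real.pi) = 0 + n • (2 * Real.pi) + 2 * Real.pi by
      rw [add_smul, one_smul, add_assoc]]
  have h2 := (ae_restrict_iUnion_iff _ _).2 h1
  rwa [iUnion_Ioc_add_zsmul Real.two_pi_pos, Measure.restrict_univ] at h2

/-- the power saving estimate for a given `t` -/
def WeylGood (k : ℕ) (t : ℝ) : Prop :=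
  ∀ δ : ℝ, 0 < δ → ∃ C : ℝ, 0 ≤ C ∧ ∀ ν L : ℕ, L ≤ 2 ^ ν → ∀ a z : ℝ,
    ‖∑ n ∈ Finset.range L,
      Complex.exp (Complex.I * ((t * ((n : ℝ) + a) ^ k + z * ((n : ℝ) + a) : ℝ) : ℂ))‖ ≤
      C * (2 : ℝ) ^ (ν * (1 - ((2 : ℝ) ^ (k - 1))⁻¹ + δ))

lemma weyl_ae_s15 (k : ℕ) (hk : 2 ≤ k) : ∀ᵐ t : ℝ, WeylGood k t := by
  obtain ⟨j, rfl⟩ : ∃ j, k = j + 1 := ⟨k - 1, by omega⟩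
  have hae : ∀ᵐ c : Circ, ∀ m : ℕ, ∃ C : ℝ, 0 ≤ C ∧ ∀ ν : ℕ,
      DD (1 / (m + 2)) j (2 ^ ν) c ≤
        ENNReal.ofReal (C * (2 : ℝ) ^ (ν * ((2 : ℝ) ^ j - 1 + 2 * (1 / ((m : ℝ) + 2))))) := by
    rw [ae_all_iff]
    intro m
    refine DD_ae (by positivity) ?_ j
    rw [div_lt_one (by positivity)]
    have : (0 : ℝ) ≤ m := by positivity
    linarith
  have hae2 := ae_real_of_circ
    ((nsmul_mp ((j + 1).factorial - 1)).quasiMeasurePreserving.ae hae)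
  filter_upwards [hae2] with t ht δ hδ
  rw [Nat.sub_add_cancel (Nat.factorial_pos _)] at ht
  obtain ⟨m, hm⟩ := exists_nat_gt (2 / δ)
  have hmδ : 2 * (1 / ((m : ℝ) + 2)) ≤ δ := by
    rw [mul_one_div, div_le_iff₀ (by positivity)]
    rw [div_lt_iff₀ hδ] at hm
    nlinarith
  obtain ⟨C, hC0, hC⟩ := ht m
  set ε : ℝ := 1 / ((m : ℝ) + 2) with hε
  have hε0 : 0 < ε := by positivity
  have hε1 : ε < 1 := by
    rw [hε, div_lt_one (by positivity)]
    have : (0 : ℝ) ≤ m := by positivity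
    linarith
  set q : ℝ := (2 : ℝ) ^ j with hq
  have hq1 : 1 ≤ q := one_le_pow₀ (by norm_num)
  refine ⟨C ^ q⁻¹, by positivity, fun ν L hL a z => ?_⟩
  rw [Nat.add_sub_cancel]
  set S := ∑ n ∈ Finset.range L,
      Complex.exp (Complex.I * ((t * ((n : ℝ) + a) ^ (j + 1) + z * ((n : ℝ) + a) : ℝ) : ℂ)) with hS
  have hp : WPoly (j + 1) ((j + 1).factorial • (t : Circ))
      (fun n : ℕ => ((t * ((n : ℝ) + a) ^ (j + 1) + z * ((n : ℝ) + a) : ℝ) : Circ)) := by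
    have h1 := wPoly_pow a (j + 1) (j + 1) t le_rfl
    have h2 := wPoly_pow a (j + 1) 1 z (by omega)
    have h3 := h1.add h2
    rw [if_pos rfl, if_neg (by omega)] at h3
    convert h3 using 1
    · rw [← AddCircle.coe_nsmul, ← AddCircle.coe_add]; simp
    · funext n
      rw [← AddCircle.coe_add, pow_one]
  have hw := weyl_bound hε0 hε1 (2 ^ ν) j _ _ hp L hL
  simp only [ee_coe] at hw
  have hw2 := hw.trans (hC ν)
  rw [← hS, ← ofReal_norm, ← ENNReal.ofReal_pow (norm_nonneg _),
    ENNReal.ofReal_le_ofReal_iff (by positivity)] at hw2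
  have hq0 : q ≠ 0 := by positivity
  have h5 : ‖S‖ = (‖S‖ ^ (2 ^ j)) ^ q⁻¹ := by
    rw [← Real.rpow_natCast, ← Real.rpow_mul (norm_nonneg _)]
    push_cast
    rw [← hq, mul_inv_cancel₀ hq0, Real.rpow_one]
  rw [h5]
  refine (Real.rpow_le_rpow (by positivity) hw2 (by positivity)).trans ?_
  rw [Real.mul_rpow hC0 (by positivity), ← Real.rpow_mul (by norm_num), mul_assoc]
  gcongr
  · norm_num
  have h6 : q⁻¹ ≤ 1 := inv_le_one_of_one_le₀ hq1
  have h7 : (q - 1 + 2 * ε) * q⁻¹ = 1 - q⁻¹ + 2 * ε * q⁻¹ := by field_simp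
  rw [h7]
  have : 2 * ε * q⁻¹ ≤ 2 * ε * 1 := by gcongr
  linarith


lemma bv_int {g : ℝ → ℂ} (hbv : BoundedVariationOn g (Set.Icc 0 (2 * Real.pi))) :
    IntervalIntegrable g volume 0 (2 * Real.pi) := by
  have real : ∀ f : ℝ → ℝ, BoundedVariationOn f (Set.Icc 0 (2 * Real.pi)) →
      IntervalIntegrable f volume 0 (2 * Real.pi) := by
    intro f hf
    obtain ⟨p, q, hp, hq, rfl⟩ := hf.locallyBoundedVariationOn.exists_monotoneOn_sub_monotoneOn
    rw [← Set.uIcc_of_le Real.two_pi_pos.le] at hp hq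
    exact hp.intervalIntegrable.sub hq.intervalIntegrable
  have h1 : IntervalIntegrable (fun x => (g x).re) volume 0 (2 * Real.pi) :=
    real _ (LipschitzWith.comp_boundedVariationOn (f := Complex.re) (C := 1)
      (LipschitzWith.of_dist_le_mul (fun x y => by
        simpa [Complex.dist_eq, Real.dist_eq] using Complex.abs_re_le_norm (x - y))) hbv)
  have h2 : IntervalIntegrable (fun x => (g x).im) volume 0 (2 * Real.pi) :=
    real _ (LipschitzWith.comp_boundedVariationOn (f := Complex.im) (C := 1)
      (LipschitzWith.of_dist_le_mul (fun x y => by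
        simpa [Complex.dist_eq, Real.dist_eq] using Complex.abs_im_le_norm (x - y))) hbv)
  have h3 : IntervalIntegrable (fun x => ((g x).re : ℂ)) volume 0 (2 * Real.pi) :=
    ⟨h1.1.ofReal, h1.2.ofReal⟩
  have h4 : IntervalIntegrable (fun x => ((g x).im : ℂ)) volume 0 (2 * Real.pi) :=
    ⟨h2.1.ofReal, h2.2.ofReal⟩
  have := h3.add (h4.mul_const Complex.I)
  refine this.congr ?_
  intro x _
  simp [Complex.re_add_im]

lemma bv_bound {g : ℝ → ℂ} (hbv : BoundedVariationOn g (Set.Icc 0 (2 * Real.pi)))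
    (hg : g (2 * Real.pi) = g 0) {φ φ' : ℝ → ℂ} (hφ : ∀ x, HasDerivAt φ (φ' x) x)
    (hc : Continuous φ') (hp : φ (2 * Real.pi) = φ 0) {A : ℝ} (hA : ∀ x, ‖φ x‖ ≤ A) :
    ‖∫ y in (0 : ℝ)..(2 * Real.pi), φ' y * g y‖ ≤
      (eVariationOn g (Set.Icc 0 (2 * Real.pi))).toReal * A := by
  set V := (eVariationOn g (Set.Icc 0 (2 * Real.pi))).toReal with hV
  obtain ⟨B, hB⟩ := (isCompact_Icc (a := (0 : ℝ)) (b := 2 * Real.pi)).exists_bound_of_continuousOn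
    hc.continuousOn
  have hgi := bv_int hbv
  have hA0 : 0 ≤ A := (norm_nonneg _).trans (hA 0)
  have hpi := Real.two_pi_pos
  have hB0 : 0 ≤ B := (norm_nonneg _).trans (hB 0 ⟨le_rfl, hpi.le⟩)
  have main : ∀ M : ℕ, ‖∫ y in (0 : ℝ)..(2 * Real.pi), φ' y * g y‖ ≤
      V * A + (2 * Real.pi * B * V) * (1 / ((M : ℝ) + 1)) := by
    intro M
    set y : ℕ → ℝ := fun j => 2 * Real.pi * ((j : ℝ) / ((M : ℝ) + 1)) with hy
    have hy0 : y 0 = 0 := by simp [hy]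
    have hyM : y (M + 1) = 2 * Real.pi := by
      simp only [hy]; push_cast; rw [div_self (by positivity), mul_one]
    have hmono : Monotone y := by
      intro i j hij
      simp only [hy]
      gcongr
    have hstep : ∀ j, y (j + 1) - y j = 2 * Real.pi * (1 / ((M : ℝ) + 1)) := by
      intro j; simp only [hy]; push_cast; ring
    have hsub : ∀ j < M + 1, Set.Icc (y j) (y (j + 1)) ⊆ Set.Icc 0 (2 * Real.pi) := by
      intro j hj
      apply Set.Icc_subset_Icc
      · rw [← hy0]; exact hmono (Nat.zero_le _)
      · rw [← hyM]; exact hmono hj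
    have hvar : ∑ j ∈ Finset.range (M + 1), (eVariationOn g (Set.Icc (y j) (y (j + 1)))).toReal
        = V := by
      rw [← ENNReal.toReal_sum (fun j hj => ne_top_of_le_ne_top hbv
        (eVariationOn.mono g (hsub j (Finset.mem_range.1 hj)))), eVariationOn.sum' g hmono, hy0, hyM]
    have hvj : ∀ j < M + 1, ∀ u ∈ Set.Icc (y j) (y (j + 1)),
        ‖g u - g (y j)‖ ≤ (eVariationOn g (Set.Icc (y j) (y (j + 1)))).toReal := by
      intro j hj u hu
      rw [← dist_eq_norm]
      exact (hbv.mono (hsub j hj)).dist_le hu ⟨le_rfl, hmono (Nat.le_succ j)⟩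
    have hgij : ∀ j < M + 1, IntervalIntegrable g volume (y j) (y (j + 1)) := by
      intro j hj
      apply hgi.mono_set
      rw [Set.uIcc_of_le (hmono (Nat.le_succ j)), Set.uIcc_of_le hpi.le]
      exact hsub j hj
    have hint : ∀ j < M + 1, IntervalIntegrable (fun u => φ' u * g u) volume (y j) (y (j + 1)) :=
      fun j hj => (hgij j hj).continuousOn_mul hc.continuousOn
    have hφi : ∀ a b, IntervalIntegrable φ' volume a b := fun a b => hc.intervalIntegrable a b
    have e1 : ∫ u in (0 : ℝ)..(2 * Real.pi), φ' u * g u =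
        ∑ j ∈ Finset.range (M + 1), ∫ u in (y j)..(y (j + 1)), φ' u * g u := by
      rw [intervalIntegral.sum_integral_adjacent_intervals hint, hy0, hyM]
    have e2 : ∀ j ∈ Finset.range (M + 1), ∫ u in (y j)..(y (j + 1)), φ' u * g u =
        (∫ u in (y j)..(y (j + 1)), φ' u * (g u - g (y j))) +
          (φ (y (j + 1)) - φ (y j)) * g (y j) := by
      intro j hj
      rw [← intervalIntegral.integral_eq_sub_of_hasDerivAt (fun x _ => hφ x) (hφi _ _),
        ← intervalIntegral.integral_mul_const, ← intervalIntegral.integral_add]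
      · congr 1; ext u; ring
      · have := (hint j (Finset.mem_range.1 hj)).sub ((hφi (y j) (y (j + 1))).mul_const (g (y j)))
        refine this.congr ?_
        intro u _
        simp only [Pi.sub_apply]
        ring
      · exact (hφi _ _).mul_const _
    have e3 : ∑ j ∈ Finset.range (M + 1), (φ (y (j + 1)) - φ (y j)) * g (y j) =
        - ∑ j ∈ Finset.range (M + 1), φ (y (j + 1)) * (g (y (j + 1)) - g (y j)) := by
      have h := Finset.sum_range_sub (fun j => φ (y j) * g (y j)) (M + 1)
      simp only [hy0, hyM, hp, hg, sub_self] at h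
      rw [eq_neg_iff_add_eq_zero, ← Finset.sum_add_distrib, ← h]
      exact Finset.sum_congr rfl (fun j _ => by ring)
    rw [e1, Finset.sum_congr rfl e2, Finset.sum_add_distrib, e3, add_comm]
    refine (norm_add_le _ _).trans (add_le_add ?_ ?_)
    · rw [norm_neg, ← hvar, Finset.sum_mul]
      refine (norm_sum_le _ _).trans (Finset.sum_le_sum (fun j hj => ?_))
      rw [norm_mul, mul_comm]
      exact mul_le_mul (hvj j (Finset.mem_range.1 hj) _ ⟨hmono (Nat.le_succ j), le_rfl⟩) (hA _)
        (norm_nonneg _) ENNReal.toReal_nonneg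
    · rw [show 2 * Real.pi * B * V * (1 / ((M : ℝ) + 1)) =
        V * (B * (2 * Real.pi * (1 / ((M : ℝ) + 1)))) by ring, ← hvar, Finset.sum_mul]
      refine (norm_sum_le _ _).trans (Finset.sum_le_sum (fun j hj => ?_))
      have hj := Finset.mem_range.1 hj
      refine (intervalIntegral.norm_integral_le_of_norm_le_const (C := B *
        (eVariationOn g (Set.Icc (y j) (y (j + 1)))).toReal) ?_).trans (le_of_eq ?_)
      · intro u hu
        rw [Set.uIoc_of_le (hmono (Nat.le_succ j))] at hu
        have hu' := Set.Ioc_subset_Icc_self hu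
        rw [norm_mul]
        exact mul_le_mul (hB u (hsub j hj hu')) (hvj j hj u hu') (norm_nonneg _) hB0
      · rw [hstep, abs_of_nonneg (by positivity)]
        ring
  have hlim : Filter.Tendsto (fun M : ℕ => V * A + (2 * Real.pi * B * V) * (1 / ((M : ℝ) + 1)))
      Filter.atTop (nhds (V * A + (2 * Real.pi * B * V) * 0)) :=
    (tendsto_one_div_add_atTop_nhds_zero_nat.const_mul _).const_add _
  rw [mul_zero, add_zero] at hlim
  exact ge_of_tendsto' hlim main


/-- the exponential monomial -/
noncomputable def emn (n : ℤ) (x : ℝ) : ℂ := Complex.exp (Complex.I * (n : ℂ) * (x : ℂ))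

lemma emn_deriv (n : ℤ) (x : ℝ) : HasDerivAt (emn n) (Complex.I * n * emn n x) x := by
  unfold emn
  have h : HasDerivAt (fun x : ℝ => Complex.I * (n : ℂ) * (x : ℂ)) (Complex.I * n) x := by
    simpa using (Complex.ofRealCLM.hasDerivAt (x := x)).const_mul (Complex.I * (n : ℂ))
  convert h.cexp using 1
  ring

lemma emn_cont (n : ℤ) : Continuous (emn n) := by unfold emn; fun_prop

lemma emn_norm (n : ℤ) (x : ℝ) : ‖emn n x‖ = 1 := by
  unfold emn
  rw [show Complex.I * (n : ℂ) * (x : ℂ) = ((n * x : ℝ) : ℂ) * Complex.I by push_cast; ring]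
  exact Complex.norm_exp_ofReal_mul_I _

lemma emn_per (n : ℤ) : Function.Periodic (emn n) (2 * Real.pi) := by
  intro x
  unfold emn
  rw [show Complex.I * (n : ℂ) * ((x + 2 * Real.pi : ℝ) : ℂ) =
    Complex.I * (n : ℂ) * (x : ℂ) + n * (2 * Real.pi * Complex.I) by push_cast; ring,
    Complex.exp_add, Complex.exp_int_mul_two_pi_mul_I, mul_one]

lemma emn_add (m n : ℤ) (x : ℝ) : emn (m + n) x = emn m x * emn n x := by
  unfold emn; rw [← Complex.exp_add]; congr 1; push_cast; ring

lemma emn_sub (n : ℤ) (x y : ℝ) : emn n (x - y) = emn n x * emn (-n) y := by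
  unfold emn; rw [← Complex.exp_add]; congr 1; push_cast; ring

lemma fourierCoef_eq (g : ℝ → ℂ) (n : ℤ) : fourierCoef g n =
    (1 / (2 * Real.pi)) * ∫ x in (0 : ℝ)..(2 * Real.pi), emn (-n) x * g x := by
  unfold fourierCoef emn
  congr 3; funext x; congr 2; push_cast; ring

lemma int_emn (n : ℤ) : ∫ x in (0 : ℝ)..(2 * Real.pi), emn n x = if n = 0 then 2 * Real.pi else 0 := by
  split_ifs with h
  · subst h; simp [emn]
  · unfold emn
    rw [integral_exp_mul_complex (by simpa using h)]
    have := emn_per n 0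
    unfold emn at this
    rw [zero_add] at this
    rw [this]; simp

lemma coef_emn (m n : ℤ) : fourierCoef (emn m) n = if m = n then 1 else 0 := by
  rw [fourierCoef_eq]
  simp_rw [← emn_add]
  rw [int_emn]
  have : (Real.pi : ℂ) ≠ 0 := by exact_mod_cast Real.pi_ne_zero
  by_cases h : m = n
  · subst h; simp; field_simp
  · rw [if_neg (by omega), if_neg h]; simp

lemma coef_sum (F : Finset ℤ) (a : ℤ → ℂ) (n : ℤ) :
    fourierCoef (fun x => ∑ m ∈ F, a m * emn m x) n = if n ∈ F then a n else 0 := by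
  have h : fourierCoef (fun x => ∑ m ∈ F, a m * emn m x) n = ∑ m ∈ F, a m * fourierCoef (emn m) n := by
    simp only [fourierCoef_eq, Finset.mul_sum]
    rw [intervalIntegral.integral_finsetSum]
    · rw [Finset.mul_sum]
      refine Finset.sum_congr rfl (fun m _ => ?_)
      rw [mul_left_comm (a m), ← intervalIntegral.integral_const_mul (a m)]
      congr 2; funext x; ring
    · intro m _
      apply Continuous.intervalIntegrable
      have := emn_cont m
      have := emn_cont (-n)
      fun_prop
  rw [h]
  simp_rw [coef_emn]
  simp

lemma conv_bound {g : ℝ → ℂ} (hbv : BoundedVariationOn g (Set.Icc 0 (2 * Real.pi)))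
    (hper : Function.Periodic g (2 * Real.pi)) (F : Finset ℤ) (c : ℤ → ℂ) {A : ℝ}
    (hA : ∀ z : ℝ, ‖∑ n ∈ F, c n * emn n z‖ ≤ A) (x : ℝ) :
    ‖∑ n ∈ F, (Complex.I * n * c n * fourierCoef g n) * emn n x‖ ≤
      (eVariationOn g (Set.Icc 0 (2 * Real.pi))).toReal * A := by
  set V := (eVariationOn g (Set.Icc 0 (2 * Real.pi))).toReal with hV
  have hder : ∀ y : ℝ, HasDerivAt (fun y => ∑ n ∈ F, c n * emn n (x - y))
      (∑ n ∈ F, c n * (-(Complex.I * n * emn n (x - y)))) y := by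
    intro y
    refine HasDerivAt.fun_sum (fun n _ => HasDerivAt.const_mul _ ?_)
    have := (emn_deriv n (x - y)).scomp y ((hasDerivAt_id y).const_sub x)
    simpa [Function.comp_def] using this
  have hcont : Continuous (fun y : ℝ => ∑ n ∈ F, c n * (-(Complex.I * n * emn n (x - y)))) := by
    have := emn_cont
    fun_prop
  have hb := bv_bound hbv (by simpa using hper 0) hder hcont (by
    refine Finset.sum_congr rfl (fun n _ => ?_)
    rw [(emn_per n).sub_eq, sub_zero]) (fun y => hA (x - y))
  have hgi := bv_int hbv
  have e : ∫ y in (0 : ℝ)..(2 * Real.pi), (∑ n ∈ F, c n * (-(Complex.I * n * emn n (x - y)))) * g y =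
      -(2 * Real.pi) * ∑ n ∈ F, (Complex.I * n * c n * fourierCoef g n) * emn n x := by
    simp_rw [Finset.sum_mul]
    rw [intervalIntegral.integral_finsetSum, Finset.mul_sum]
    · refine Finset.sum_congr rfl (fun n _ => ?_)
      have hpi : (Real.pi : ℂ) ≠ 0 := by exact_mod_cast Real.pi_ne_zero
      rw [fourierCoef_eq]
      rw [show -(2 * (Real.pi : ℂ)) * (Complex.I * n * c n * (1 / (2 * Real.pi) *
        ∫ y in (0 : ℝ)..(2 * Real.pi), emn (-n) y * g y) * emn n x) =
        (-(Complex.I * n * c n * emn n x)) * ∫ y in (0 : ℝ)..(2 * Real.pi), emn (-n) y * g y by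
          field_simp, ← intervalIntegral.integral_const_mul]
      congr 1; funext y; rw [emn_sub]; ring
    · intro n _
      apply hgi.continuousOn_mul
      have := emn_cont
      fun_prop
  rw [e, norm_mul] at hb
  refine le_trans ?_ hb
  have : (1 : ℝ) ≤ ‖-(2 * (Real.pi : ℂ))‖ := by
    rw [norm_neg, norm_mul]; simp
    rw [abs_of_pos Real.pi_pos]; linarith [Real.pi_gt_three]
  exact le_mul_of_one_le_left (norm_nonneg _) this

lemma abel_bound (f : ℕ → ℂ) (w : ℕ → ℝ) (hw : Antitone w) (hw0 : ∀ n, 0 ≤ w n) {A : ℝ} {N : ℕ}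
    (hf : ∀ L ≤ N, ‖∑ i ∈ Finset.range L, f i‖ ≤ A) :
    ‖∑ i ∈ Finset.range N, (w i : ℂ) * f i‖ ≤ w 0 * A := by
  have hid : ∀ N, ∑ i ∈ Finset.range N, (w i : ℂ) * f i = w N * ∑ i ∈ Finset.range N, f i +
      ∑ i ∈ Finset.range N, ((w i - w (i + 1) : ℝ) : ℂ) * ∑ l ∈ Finset.range (i + 1), f l := by
    intro N
    induction N with
    | zero => simp
    | succ N ih =>
      rw [Finset.sum_range_succ, ih, Finset.sum_range_succ _ N, Finset.sum_range_succ _ N]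
      simp only [Finset.sum_range_succ f N]
      push_cast
      ring
  rw [hid]
  have h2 : ∑ i ∈ Finset.range N, (w i - w (i + 1)) = w 0 - w N := Finset.sum_range_sub' w N
  calc _ ≤ w N * A + ∑ i ∈ Finset.range N, (w i - w (i + 1)) * A := by
        refine (norm_add_le _ _).trans (add_le_add ?_ ((norm_sum_le _ _).trans
          (Finset.sum_le_sum (fun i hi => ?_))))
        · rw [norm_mul, Complex.norm_real, Real.norm_of_nonneg (hw0 N)]
          exact mul_le_mul_of_nonneg_left (hf N le_rfl) (hw0 N)
        · have : 0 ≤ w i - w (i + 1) := sub_nonneg.2 (hw (Nat.le_succ i))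
          rw [norm_mul, Complex.norm_real, Real.norm_of_nonneg this]
          exact mul_le_mul_of_nonneg_left (hf _ (Finset.mem_range.1 hi)) this
    _ = w 0 * A := by rw [← Finset.sum_mul, h2]; ring


/-- dyadic block of frequencies -/
def blk (ν : ℕ) : Finset ℤ :=
  (Finset.range (2 ^ ν)).image (fun i : ℕ => ((2 : ℤ) ^ ν + i)) ∪
  (Finset.range (2 ^ ν)).image (fun i : ℕ => -((2 : ℤ) ^ ν + i))

lemma mem_blk (ν : ℕ) (n : ℤ) : n ∈ blk ν ↔ 2 ^ ν ≤ n.natAbs ∧ n.natAbs < 2 ^ (ν + 1) := by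
  unfold blk
  simp only [Finset.mem_union, Finset.mem_image, Finset.mem_range]
  have e : ((2 : ℤ) ^ ν) = ((2 ^ ν : ℕ) : ℤ) := by push_cast; rfl
  rw [e, pow_succ]
  generalize 2 ^ ν = M
  constructor
  · rintro (⟨i, hi, rfl⟩ | ⟨i, hi, rfl⟩) <;> omega
  · rintro ⟨h1, h2⟩
    rcases le_total 0 n with h | h
    · left; exact ⟨n.natAbs - M, by omega, by omega⟩
    · right; exact ⟨n.natAbs - M, by omega, by omega⟩

lemma mem_blk_log (ν : ℕ) (n : ℤ) (hn : n ≠ 0) : n ∈ blk ν ↔ ν = Nat.log 2 n.natAbs := by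
  rw [mem_blk]
  constructor
  · rintro ⟨h1, h2⟩
    exact (Nat.log_eq_of_pow_le_of_lt_pow h1 h2).symm
  · rintro rfl
    exact ⟨Nat.pow_log_le_self 2 (by omega), Nat.lt_pow_succ_log_self (by norm_num) _⟩

lemma zero_not_mem_blk (ν : ℕ) : (0 : ℤ) ∉ blk ν := by
  rw [mem_blk]; simp

lemma sum_blk (ν : ℕ) (f : ℤ → ℂ) : ∑ n ∈ blk ν, f n =
    ∑ i ∈ Finset.range (2 ^ ν), f ((2 : ℤ) ^ ν + i) +
    ∑ i ∈ Finset.range (2 ^ ν), f (-((2 : ℤ) ^ ν + i)) := by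
  unfold blk
  have hp : (0 : ℤ) < 2 ^ ν := by positivity
  rw [Finset.sum_union, Finset.sum_image, Finset.sum_image]
  · intro a _ b _ h; simpa using h
  · intro a _ b _ h; simpa using h
  · rw [Finset.disjoint_left]
    simp only [Finset.mem_image, Finset.mem_range, not_exists, not_and]
    rintro a ⟨i, _, rfl⟩ j _
    omega

/-- the multiplier -/
noncomputable def mult (k : ℕ) (t : ℝ) (n : ℤ) : ℂ := Complex.exp (Complex.I * (t : ℂ) * (n : ℂ) ^ k)

lemma blk_bounds {k : ℕ} {t : ℝ} (h1 : WeylGood k t) (h2 : WeylGood k (-t)) (δ : ℝ) (hδ : 0 < δ) :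
    ∃ C : ℝ, 0 ≤ C ∧ ∀ ν : ℕ, ∀ z : ℝ,
      ‖∑ n ∈ blk ν, mult k t n * emn n z‖ ≤ C * (2:ℝ)^(ν*(1 - ((2:ℝ)^(k-1))⁻¹ + δ)) ∧
      ‖∑ n ∈ blk ν, (mult k t n / (Complex.I * n)) * emn n z‖ ≤
        C * (2:ℝ)^(ν*(- ((2:ℝ)^(k-1))⁻¹ + δ)) := by
  have h3 : WeylGood k ((-1) ^ k * t) := by
    rcases neg_one_pow_eq_or ℝ k with h | h <;> rw [h] <;> simpa
  obtain ⟨C1, hC1, H1⟩ := h1 δ hδ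
  obtain ⟨C2, hC2, H2⟩ := h3 δ hδ
  refine ⟨C1 + C2, by positivity, fun ν z => ?_⟩
  set B := (2:ℝ)^(ν*(1 - ((2:ℝ)^(k-1))⁻¹ + δ)) with hB
  have b1 : ∀ L ≤ 2 ^ ν, ‖∑ i ∈ Finset.range L, mult k t ((2 : ℤ) ^ ν + i) *
      emn ((2 : ℤ) ^ ν + i) z‖ ≤ C1 * B := by
    intro L hL
    convert H1 ν L hL (2 ^ ν) z using 2
    refine Finset.sum_congr rfl (fun i _ => ?_)
    unfold mult emn
    rw [← Complex.exp_add]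
    congr 1; push_cast; ring
  have b2 : ∀ L ≤ 2 ^ ν, ‖∑ i ∈ Finset.range L, mult k t (-((2 : ℤ) ^ ν + i)) *
      emn (-((2 : ℤ) ^ ν + i)) z‖ ≤ C2 * B := by
    intro L hL
    convert H2 ν L hL (2 ^ ν) (-z) using 2
    refine Finset.sum_congr rfl (fun i _ => ?_)
    unfold mult emn
    rw [← Complex.exp_add]
    congr 1; push_cast
    rw [neg_pow]; ring
  constructor
  · rw [sum_blk, add_mul]
    exact (norm_add_le _ _).trans (add_le_add (b1 _ le_rfl) (b2 _ le_rfl))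
  · set w : ℕ → ℝ := fun i => ((2 : ℝ) ^ ν + i)⁻¹ with hw
    have hwa : Antitone w := by
      intro i j hij
      have : (i : ℝ) ≤ j := by exact_mod_cast hij
      exact inv_anti₀ (by positivity) (by linarith)
    have hw0 : ∀ n, 0 ≤ w n := fun n => by simp only [hw]; positivity
    have c1 := abel_bound _ w hwa hw0 b1
    have c2 := abel_bound _ w hwa hw0 b2
    have hwB : w 0 * B = (2:ℝ)^(ν*(- ((2:ℝ)^(k-1))⁻¹ + δ)) := by
      simp only [hw, hB]
      rw [Nat.cast_zero, add_zero, ← Real.rpow_natCast, ← Real.rpow_neg (by norm_num),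
        ← Real.rpow_add (by norm_num)]
      congr 1; ring
    rw [sum_blk]
    have e1 : ‖∑ i ∈ Finset.range (2 ^ ν), (mult k t ((2 : ℤ) ^ ν + i) / (Complex.I * ((2 : ℤ) ^ ν + i : ℤ))) *
      emn ((2 : ℤ) ^ ν + i) z‖ ≤ w 0 * (C1 * B) := by
      refine le_trans (le_of_eq ?_) c1
      rw [← one_mul ‖∑ i ∈ Finset.range (2 ^ ν), (w i : ℂ) * _‖,
        ← Complex.norm_I, ← norm_neg Complex.I, ← norm_mul, Finset.mul_sum]
      congr 1
      refine Finset.sum_congr rfl (fun i _ => ?_)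
      simp only [hw]
      rw [div_eq_mul_inv, mul_inv, Complex.inv_I]
      push_cast; ring
    have e2 : ‖∑ i ∈ Finset.range (2 ^ ν), (mult k t (-((2 : ℤ) ^ ν + i)) / (Complex.I * (-((2 : ℤ) ^ ν + i) : ℤ))) *
      emn (-((2 : ℤ) ^ ν + i)) z‖ ≤ w 0 * (C2 * B) := by
      refine le_trans (le_of_eq ?_) c2
      rw [← one_mul ‖∑ i ∈ Finset.range (2 ^ ν), (w i : ℂ) * _‖,
        ← Complex.norm_I, ← norm_mul, Finset.mul_sum]
      congr 1
      refine Finset.sum_congr rfl (fun i _ => ?_)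
      simp only [hw]
      rw [div_eq_mul_inv, mul_inv, Complex.inv_I, Int.cast_neg, inv_neg]
      push_cast; ring
    refine (norm_add_le _ _).trans ((add_le_add e1 e2).trans (le_of_eq ?_))
    rw [← hwB]; ring

/-- block of the solution -/
noncomputable def PP (k : ℕ) (t : ℝ) (g : ℝ → ℂ) (ν : ℕ) (x : ℝ) : ℂ :=
  ∑ n ∈ blk ν, (mult k t n * fourierCoef g n) * emn n x

lemma PP_bounds {k : ℕ} {t : ℝ} (h1 : WeylGood k t) (h2 : WeylGood k (-t)) {g : ℝ → ℂ}
    (hbv : BoundedVariationOn g (Set.Icc 0 (2 * Real.pi)))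
    (hper : Function.Periodic g (2 * Real.pi)) (δ : ℝ) (hδ : 0 < δ) :
    ∃ C : ℝ, 0 ≤ C ∧ ∀ ν : ℕ, ∀ x y : ℝ,
      ‖PP k t g ν x‖ ≤ C * (2:ℝ)^(ν*(- ((2:ℝ)^(k-1))⁻¹ + δ)) ∧
      ‖PP k t g ν x - PP k t g ν y‖ ≤ C * (2:ℝ)^(ν*(1 - ((2:ℝ)^(k-1))⁻¹ + δ)) * |x - y| := by
  obtain ⟨C, hC, H⟩ := blk_bounds h1 h2 δ hδ
  set V := (eVariationOn g (Set.Icc 0 (2 * Real.pi))).toReal with hV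
  have hV0 : 0 ≤ V := ENNReal.toReal_nonneg
  refine ⟨V * C, by positivity, fun ν x y => ⟨?_, ?_⟩⟩
  · have := conv_bound hbv hper (blk ν) (fun n => mult k t n / (Complex.I * n)) (fun z => (H ν z).2) x
    rw [mul_assoc]
    refine le_trans (le_of_eq ?_) this
    unfold PP
    congr 1
    refine Finset.sum_congr rfl (fun n hn => ?_)
    have hn0 : (n : ℂ) ≠ 0 := by
      intro h
      have : n = 0 := by exact_mod_cast h
      exact zero_not_mem_blk ν (this ▸ hn)
    have := Complex.I_ne_zero
    congr 2
    field_simp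
  · have hd : ∀ x : ℝ, HasDerivAt (PP k t g ν)
        (∑ n ∈ blk ν, (Complex.I * n * mult k t n * fourierCoef g n) * emn n x) x := by
      intro x
      unfold PP
      have : ∀ n ∈ blk ν, HasDerivAt (fun x => (mult k t n * fourierCoef g n) * emn n x)
        ((mult k t n * fourierCoef g n) * (Complex.I * n * emn n x)) x := fun n _ =>
          (emn_deriv n x).const_mul _
      have h5 := HasDerivAt.fun_sum this
      have h6 : ∑ n ∈ blk ν, (Complex.I * n * mult k t n * fourierCoef g n) * emn n x =
          ∑ n ∈ blk ν, (mult k t n * fourierCoef g n) * (Complex.I * n * emn n x) :=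
        Finset.sum_congr rfl (fun n _ => by ring)
      rw [h6]
      exact h5
    have hb := fun x => conv_bound hbv hper (blk ν) (fun n => mult k t n) (fun z => (H ν z).1) x
    have := Convex.norm_image_sub_le_of_norm_hasDerivWithin_le (s := Set.univ)
      (fun x _ => (hd x).hasDerivWithinAt) (fun x _ => hb x) convex_univ (Set.mem_univ y) (Set.mem_univ x)
    rw [Real.norm_eq_abs, ← mul_assoc] at this
    exact this

lemma PP_cont (k : ℕ) (t : ℝ) (g : ℝ → ℂ) (ν : ℕ) : Continuous (PP k t g ν) := by
  unfold PP
  have := emn_cont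
  fun_prop

lemma geo_summable {r : ℝ} (hr : r < 0) (C : ℝ) : Summable (fun ν : ℕ => C * (2:ℝ)^(ν * r)) := by
  apply Summable.mul_left
  have : (fun ν : ℕ => (2:ℝ)^(ν * r)) = fun ν : ℕ => ((2:ℝ) ^ r) ^ ν := by
    funext ν
    rw [mul_comm, Real.rpow_mul (by norm_num), Real.rpow_natCast]
  rw [this]
  exact summable_geometric_of_lt_one (by positivity) (Real.rpow_lt_one_of_one_lt_of_neg (by norm_num) hr)

lemma higher_core {k : ℕ} (hk : 3 ≤ k) {t : ℝ} (h1 : WeylGood k t) (h2 : WeylGood k (-t)) {g : ℝ → ℂ}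
    (hbv : BoundedVariationOn g (Set.Icc 0 (2 * Real.pi)))
    (hper : Function.Periodic g (2 * Real.pi)) :
    ∃ u : ℝ → ℂ, Function.Periodic u (2 * Real.pi) ∧
      (∀ n : ℤ, fourierCoef u n =
        Complex.exp (Complex.I * (t : ℂ) * (n : ℂ) ^ k) * fourierCoef g n) ∧
      ∀ α : ℝ, 0 < α → α < (2 : ℝ) ^ ((1 : ℤ) - (k : ℤ)) →
        ∃ C : ℝ, ∀ x y : ℝ, ‖u x - u y‖ ≤ C * |x - y| ^ α := by
  set σ : ℝ := ((2:ℝ)^(k-1))⁻¹ with hσ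
  have hσ0 : 0 < σ := by positivity
  have hσe : (2 : ℝ) ^ ((1 : ℤ) - (k : ℤ)) = σ := by
    rw [hσ, ← zpow_natCast, ← zpow_neg]
    congr 1
    rw [Nat.cast_sub (by omega)]; push_cast; ring
  obtain ⟨C0, hC0, H0⟩ := PP_bounds h1 h2 hbv hper (σ / 2) (by positivity)
  have hs0 : Summable (fun ν : ℕ => C0 * (2:ℝ)^(ν*(-σ + σ/2))) := geo_summable (by linarith) _
  have hsP : ∀ x, Summable (fun ν => PP k t g ν x) := fun x =>
    Summable.of_norm_bounded hs0 (fun ν => (H0 ν x x).1)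
  set P : ℝ → ℂ := fun x => ∑' ν, PP k t g ν x with hP
  refine ⟨fun x => fourierCoef g 0 + P x, ?_, ?_, ?_⟩
  · intro x
    simp only [hP, PP, (emn_per _) x]
  · intro n
    have hi : HasSum (fun ν => ∫ x in (0:ℝ)..(2 * Real.pi), emn (-n) x * PP k t g ν x)
        (∫ x in (0:ℝ)..(2 * Real.pi), emn (-n) x * P x) := by
      refine intervalIntegral.hasSum_integral_of_dominated_convergence
        (fun ν _ => C0 * (2:ℝ)^(ν*(-σ + σ/2))) (fun ν => ?_) (fun ν => ?_) ?_ ?_ ?_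
      · exact ((emn_cont _).mul (PP_cont k t g ν)).aestronglyMeasurable
      · refine Filter.Eventually.of_forall (fun x _ => ?_)
        rw [norm_mul, emn_norm, one_mul]
        exact (H0 ν x x).1
      · exact Filter.Eventually.of_forall (fun x _ => hs0)
      · exact intervalIntegrable_const
      · exact Filter.Eventually.of_forall (fun x _ => (hsP x).hasSum.mul_left _)
    have hPc : Continuous P := continuous_tsum (PP_cont k t g) hs0 (fun ν x => (H0 ν x x).1)
    have hadd : fourierCoef (fun x => fourierCoef g 0 + P x) n =
        fourierCoef (fun x => fourierCoef g 0 * emn 0 x) n + fourierCoef P n := by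
      simp only [fourierCoef_eq]
      rw [← mul_add, ← intervalIntegral.integral_add]
      · congr 2; funext x; rw [show emn 0 x = 1 by simp [emn]]; ring
      · have := emn_cont
        exact Continuous.intervalIntegrable (by fun_prop) _ _
      · exact Continuous.intervalIntegrable ((emn_cont _).mul hPc) _ _
    have hc0 := coef_sum {0} (fun _ => fourierCoef g 0) n
    simp only [Finset.sum_singleton, Finset.mem_singleton] at hc0
    have hcP : fourierCoef P n = ∑' ν, (if n ∈ blk ν then mult k t n * fourierCoef g n else 0) := by
      rw [fourierCoef_eq, ← (hi.mul_left _).tsum_eq]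
      congr 1; funext ν
      rw [← fourierCoef_eq, ← coef_sum (blk ν) (fun n => mult k t n * fourierCoef g n) n]
      rfl
    rw [hadd, hc0, hcP]
    by_cases hn : n = 0
    · subst hn
      simp [zero_not_mem_blk, show k ≠ 0 by omega]
    · rw [if_neg hn, zero_add]
      simp_rw [mem_blk_log _ n hn]
      rw [tsum_ite_eq]
      rfl
  · intro α hα hασ
    rw [hσe] at hασ
    set δ := (σ - α) / 2 with hδ
    have hδ0 : 0 < δ := by rw [hδ]; linarith
    obtain ⟨C, hC, H⟩ := PP_bounds h1 h2 hbv hper δ hδ0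
    have hσ1 : σ ≤ 1 := by
      rw [hσ]; exact inv_le_one_of_one_le₀ (one_le_pow₀ (by norm_num))
    have hs : Summable (fun ν : ℕ => (2 * C) * (2:ℝ)^(ν*(-δ))) := geo_summable (by linarith) _
    refine ⟨∑' ν : ℕ, (2 * C) * (2:ℝ)^(ν*(-δ)), fun x y => ?_⟩
    rw [add_sub_add_left_eq_sub]
    simp only [hP]
    rw [← (hsP x).tsum_sub (hsP y), ← tsum_mul_right]
    refine tsum_of_norm_bounded ((hs.mul_right _).hasSum) (fun ν => ?_)
    have hp : (2:ℝ)^(ν*(-δ)) * |x-y|^α = (2:ℝ)^(ν*(-σ+δ)) * ((2:ℝ)^(ν:ℝ) * |x - y|) ^ α := by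
      rw [Real.mul_rpow (by positivity) (abs_nonneg _), ← Real.rpow_mul (by norm_num), ← mul_assoc,
        ← Real.rpow_add (by norm_num)]
      congr 2; rw [hδ]; ring
    rw [mul_assoc, hp]
    set r := (2:ℝ)^(ν:ℝ) * |x - y| with hr
    have hr0 : 0 ≤ r := by positivity
    have hE : (0:ℝ) ≤ (2:ℝ)^(ν*(-σ+δ)) := by positivity
    rcases le_total r 1 with h | h
    · have := (H ν x y).2
      have e : C * (2:ℝ)^(ν*(1 - σ + δ)) * |x - y| = C * ((2:ℝ)^(ν*(-σ+δ)) * r) := by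
        rw [hr, ← mul_assoc ((2:ℝ)^(ν*(-σ+δ))), ← Real.rpow_add (by norm_num), mul_assoc]
        congr 3; ring
      rw [e] at this
      have hrr : r ≤ r ^ α := by
        rcases hr0.eq_or_lt with h0 | h0
        · rw [← h0]; positivity
        · calc r = r ^ (1:ℝ) := (Real.rpow_one r).symm
            _ ≤ r ^ α := Real.rpow_le_rpow_of_exponent_ge h0 h (by linarith)
      refine this.trans ?_
      have h3 : (2:ℝ)^(ν*(-σ+δ)) * r ≤ (2:ℝ)^(ν*(-σ+δ)) * r ^ α := mul_le_mul_of_nonneg_left hrr hE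
      exact mul_le_mul (by linarith) h3 (by positivity) (by positivity)
    · have a1 := (H ν x y).1
      have a2 := (H ν y x).1
      have hrr : 1 ≤ r ^ α := Real.one_le_rpow h hα.le
      refine (norm_sub_le _ _).trans ((add_le_add a1 a2).trans ?_)
      have h3 : (2:ℝ)^(ν*(-σ+δ)) ≤ (2:ℝ)^(ν*(-σ+δ)) * r ^ α := le_mul_of_one_le_right hE hrr
      have := mul_le_mul_of_nonneg_left h3 (show 0 ≤ 2 * C by positivity)
      linarith

/-- Fix `k ≥ 3` and let `g : 𝕋 → ℂ` have bounded variation.  Then for a.e. `t` the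
evolution `e^{it(-i∂ₓ)^k}g` (Fourier coefficients `e^{itn^k}ĝ(n)`) has a representative
which is `α`-Hölder continuous for every `0 < α < 2^{1-k}`. -/
theorem higher_dispersion_holder (k : ℕ) (hk : 3 ≤ k) (g : ℝ → ℂ)
    (hper : Function.Periodic g (2 * Real.pi))
    (hbv : BoundedVariationOn g (Set.Icc 0 (2 * Real.pi))) :
    ∀ᵐ t : ℝ, ∃ u : ℝ → ℂ, Function.Periodic u (2 * Real.pi) ∧
      (∀ n : ℤ, fourierCoef u n =
        Complex.exp (Complex.I * (t : ℂ) * (n : ℂ) ^ k) * fourierCoef g n) ∧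
      ∀ α : ℝ, 0 < α → α < (2 : ℝ) ^ ((1 : ℤ) - (k : ℤ)) →
        ∃ C : ℝ, ∀ x y : ℝ, ‖u x - u y‖ ≤ C * |x - y| ^ α := by
  have h1 := weyl_ae_s15 k (by omega)
  have h2 : ∀ᵐ t : ℝ, WeylGood k (-t) :=
    (Measure.measurePreserving_neg (volume : Measure ℝ)).quasiMeasurePreserving.ae h1
  filter_upwards [h1, h2] with t ht1 ht2
  exact higher_core hk ht1 ht2 hbv hper
end
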